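/- arXiv:2008.10315 — 4 statements merged into one kernel-verified Lean document; each statement's English description precedes it below -/
import Mathlib

section
/- Let U ⊆ A(n)_d be a linear subspace of codimension k ≤ d − 1, let 2 ≤ m ≤ n, and suppose U' := U ∩ A(m)_d has codimension k in A(m)_d. If both U (in ℙ^{n−1}) and U' (in ℙ^{m−1}) are base-point-free, then codim_{A(n)_{2d}} U² ≤ codim_{A(m)_{2d}} (U')². -/
open MvPolynomial Module

noncomputable section

abbrev PolyR (n : ℕ) := MvPolynomial (Fin n) ℂ

def formSpace (n d : ℕ) : Submodule ℂ (PolyR n) :=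
  homogeneousSubmodule (Fin n) ℂ d

/-- Codimension of a subspace `U` inside the space of degree-`d` forms. -/
def vcodim (n d : ℕ) (U : Submodule ℂ (PolyR n)) : ℕ :=
  finrank ℂ (formSpace n d) - finrank ℂ U

/-- `U` is base-point-free: the only common zero of its members in `ℂⁿ` is `0`. -/
def IsBPF (n : ℕ) (U : Submodule ℂ (PolyR n)) : Prop :=
  ∀ x : Fin n → ℂ, (∀ p ∈ U, eval x p = 0) → x = 0

/-- `m(n,d,k)`: maximum of `codim U²` over codimension-`k` subspaces `U ⊆ A(n)_d`. -/
def mMax (n d k : ℕ) : ℕ :=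
  sSup { s | ∃ U : Submodule ℂ (PolyR n),
    U ≤ formSpace n d ∧ vcodim n d U = k ∧ vcodim n (2 * d) (U * U) = s }

def linForm (n : ℕ) (c : Fin n → ℂ) : PolyR n := ∑ i, c i • X i

def colon (n d : ℕ) (U : Submodule ℂ (PolyR n)) (l : PolyR n) : Submodule ℂ (PolyR n) :=
  Submodule.comap (LinearMap.mulLeft ℂ l) U ⊓ formSpace n (d - 1)

end

/-- The inclusion `A(m) ⊆ A(n)` for `m ≤ n`. -/
noncomputable def embed (m n : ℕ) (h : m ≤ n) : PolyR m →ₐ[ℂ] PolyR n :=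
  MvPolynomial.rename (Fin.castLE h)


section Green
variable {m : ℕ}

/-- generic kernel vector from pointwise kernel vectors -/
lemma exists_generic_ker {J : Type} [Fintype J] [DecidableEq J] {k : ℕ}
    (M : Matrix J (Fin k) (MvPolynomial (Fin m) ℂ))
    (h : ∀ v : Fin m → ℂ, ∃ z : Fin k → ℂ, z ≠ 0 ∧ (M.map (eval v)).mulVec z = 0) :
    ∃ c : Fin k → MvPolynomial (Fin m) ℂ, c ≠ 0 ∧ M.mulVec c = 0 := by
  classical
  by_contra hcon
  push Not at hcon
  let S := MvPolynomial (Fin m) ℂ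
  let K := FractionRing S
  let MK : Matrix J (Fin k) K := M.map (algebraMap S K)
  have hinj : LinearMap.ker (Matrix.toLin' MK) = ⊥ := by
    rw [LinearMap.ker_eq_bot']
    intro z hz
    obtain ⟨b, hb⟩ := IsLocalization.exist_integer_multiples_of_finite (nonZeroDivisors S) z
    choose c hc using hb
    have hb0 : algebraMap S K b ≠ 0 := by
      simp
    have hc0 : M.mulVec c = 0 := by
      funext j
      apply IsFractionRing.injective S K
      have := congrFun hz j
      simp only [Matrix.toLin'_apply, Matrix.mulVec, dotProduct, Pi.zero_apply] at this
      simp only [Matrix.mulVec, dotProduct, map_sum, map_mul, hc, Pi.zero_apply, map_zero]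
      calc _ = algebraMap S K b * ∑ x, MK j x * z x := by
            rw [Finset.mul_sum]
            refine Finset.sum_congr rfl fun x _ => ?_
            simp only [MK, Matrix.map_apply]
            erw [Algebra.smul_def]
            ring
        _ = 0 := by rw [this, mul_zero]
    have hc1 : c = 0 := by
      by_contra hne
      exact hcon c hne hc0
    funext a
    have := hc a
    rw [hc1] at this
    simp only [Pi.zero_apply, map_zero] at this
    have h2 : algebraMap S K b * z a = 0 := by
      rw [← Algebra.smul_def]; exact this.symm
    simpa [hb0] using h2
  obtain ⟨g, hg⟩ := LinearMap.exists_leftInverse_of_injective _ hinj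
  let L := LinearMap.toMatrix' g
  have hL : L * MK = 1 := by
    have := congrArg LinearMap.toMatrix' hg
    rwa [LinearMap.toMatrix'_comp, LinearMap.toMatrix'_toLin', LinearMap.toMatrix'_id] at this
  obtain ⟨b, hb⟩ := IsLocalization.exist_integer_multiples_of_finite (nonZeroDivisors S)
    (fun p : Fin k × J => L p.1 p.2)
  choose l hl using hb
  have hb0 : (b : S) ≠ 0 := nonZeroDivisors.ne_zero b.2
  have hLM : (Matrix.of fun i j => l (i, j)) * M = (b : S) • (1 : Matrix (Fin k) (Fin k) S) := by
    ext1 i a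
    apply IsFractionRing.injective S K
    have h1 := congrFun (congrFun hL i) a
    simp only [Matrix.mul_apply] at h1
    simp only [Matrix.mul_apply, map_sum, map_mul, Matrix.of_apply, hl, Matrix.smul_apply,
      smul_eq_mul]
    have h3 : algebraMap S K ((1 : Matrix (Fin k) (Fin k) S) i a)
        = (1 : Matrix (Fin k) (Fin k) K) i a := by
      by_cases hia : i = a <;> simp [Matrix.one_apply, hia]
    rw [h3, ← h1, Finset.mul_sum]
    refine Finset.sum_congr rfl fun x _ => ?_
    simp only [MK, Matrix.map_apply]
    erw [Algebra.smul_def]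
    ring
  obtain ⟨v, hv⟩ : ∃ v : Fin m → ℂ, eval v (b : S) ≠ 0 := by
    by_contra hh
    push Not at hh
    exact hb0 (MvPolynomial.funext (fun x => by simpa using hh x))
  obtain ⟨z, hz, hMz⟩ := h v
  apply hz
  have h4 := congrArg (fun N : Matrix (Fin k) (Fin k) S => N.map (eval v)) hLM
  simp only [Matrix.map_mul] at h4
  have h5 := congrArg (fun N => Matrix.mulVec N z) h4
  simp only [← Matrix.mulVec_mulVec, hMz, Matrix.mulVec_zero] at h5
  funext a
  have h6 := congrFun h5 a
  simp only [Matrix.mulVec, dotProduct, Matrix.map_apply, Matrix.smul_apply, smul_eq_mul,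
    Matrix.one_apply, Pi.zero_apply] at h6
  rw [Finset.sum_eq_single a] at h6
  · simpa [hv] using h6.symm
  · intro x _ hx
    simp [hx.symm]
  · simp

noncomputable def opT (m : ℕ) : ((Fin m →₀ ℕ) → MvPolynomial (Fin m) ℂ)
    →ₗ[MvPolynomial (Fin m) ℂ] ((Fin m →₀ ℕ) → MvPolynomial (Fin m) ℂ) where
  toFun H α := ∑ i, X i * H (α + Finsupp.single i 1)
  map_add' H G := by
    funext α
    simp [mul_add, Finset.sum_add_distrib]
  map_smul' r H := by
    funext α
    simp only [Pi.smul_apply, smul_eq_mul, RingHom.id_apply, Finset.mul_sum]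
    exact Finset.sum_congr rfl fun i _ => by ring

lemma opT_apply (H : (Fin m →₀ ℕ) → MvPolynomial (Fin m) ℂ) (α) :
    opT m H α = ∑ i, X i * H (α + Finsupp.single i 1) := rfl

lemma opT_shift (H : (Fin m →₀ ℕ) → MvPolynomial (Fin m) ℂ) (γ) :
    opT m (fun α => H (α + γ)) = fun α => opT m H (α + γ) := by
  funext α
  simp only [opT_apply]
  refine Finset.sum_congr rfl fun i _ => ?_
  rw [add_right_comm]

lemma opT_comm (H : (Fin m →₀ ℕ) → MvPolynomial (Fin m) ℂ) (i : Fin m) :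
    opT m (fun α => pderiv i (H α)) =
      (fun α => pderiv i (opT m H α)) - fun α => H (α + Finsupp.single i 1) := by
  classical
  funext α
  simp only [opT_apply, Pi.sub_apply, map_sum, Derivation.leibniz, smul_eq_mul, pderiv_X,
    Finset.sum_add_distrib]
  simp [Pi.single_apply]

lemma opT_pow_comm (H : (Fin m →₀ ℕ) → MvPolynomial (Fin m) ℂ) (i : Fin m) (n : ℕ) :
    ((opT m) ^ (n + 1)) (fun α => pderiv i (H α)) =
      (fun α => pderiv i (((opT m) ^ (n + 1)) H α)) -
        ((n : ℂ) + 1) • fun α => ((opT m) ^ n) H (α + Finsupp.single i 1) := by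
  induction n with
  | zero => simpa using opT_comm H i
  | succ n ih =>
    rw [pow_succ', Module.End.mul_apply, ih, map_sub, opT_comm, LinearMap.map_smul_of_tower, opT_shift]
    have e1 : opT m ((opT m ^ n) H) = (opT m ^ (n+1)) H := by
      rw [pow_succ' (opT m) n, Module.End.mul_apply]
    rw [Module.End.mul_apply, e1]
    push_cast
    funext α
    simp only [Pi.sub_apply, Pi.smul_apply, Pi.add_apply, add_smul, one_smul]
    ring

/-- the span argument: a generic kernel vector forces dimension at least `d + 1` -/
lemma generic_bound {k d : ℕ} (B : Fin k → (Fin m →₀ ℕ) → ℂ)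
    (hB : ∀ a α, α.degree ≠ d → B a α = 0)
    (c : Fin k → MvPolynomial (Fin m) ℂ)
    (hc : (fun α => ∑ a, c a * C (B a α)) ≠ (0 : (Fin m →₀ ℕ) → MvPolynomial (Fin m) ℂ))
    (hT : opT m (fun α => ∑ a, c a * C (B a α)) = 0) : d + 1 ≤ k := by
  classical
  let Ψ : (Fin k → PolyR m) →ₗ[PolyR m] ((Fin m →₀ ℕ) → PolyR m) :=
    { toFun := fun c α => ∑ a, c a * C (B a α)
      map_add' := by
        intro x y; funext α; simp [add_mul, Finset.sum_add_distrib]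
      map_smul' := by
        intro r x; funext α; simp only [Pi.smul_apply, smul_eq_mul, RingHom.id_apply, Finset.mul_sum, mul_assoc] }
  have hΨD : ∀ (c : Fin k → PolyR m) (i : Fin m),
      Ψ (fun a => pderiv i (c a)) = fun α => pderiv i (Ψ c α) := by
    intro c i; funext α
    simp [Ψ, mul_comm]
  set F := Ψ c with hF
  have hF0 : F ≠ 0 := hc
  have hTF : opT m F = 0 := hT
  obtain ⟨α0, hα0⟩ : ∃ α, F α ≠ 0 := by
    by_contra hh; push Not at hh; exact hF0 (funext hh)
  have hdeg : α0.degree = d := by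
    by_contra hne
    apply hα0
    simp [hF, Ψ, hB _ _ hne]
  have key : ∀ j, j ≤ d → ∃ cj : Fin k → PolyR m, ∃ γ : Fin m →₀ ℕ, ∃ r : ℂ, γ.degree = j ∧ γ ≤ α0 ∧
      r ≠ 0 ∧ (opT m ^ (j+1)) (Ψ cj) = 0 ∧ (opT m ^ j) (Ψ cj) = r • fun α => F (α + γ) := by
    intro j
    induction j with
    | zero =>
      intro _
      exact ⟨c, 0, 1, by simp, by simp, one_ne_zero, by simpa using hTF, by simp [hF]⟩
    | succ j ih =>
      intro hj
      obtain ⟨cj, γ, r, hγ, hle, hr, h0, h1⟩ := ih (by omega)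
      obtain ⟨i, hi⟩ : ∃ i, γ i < α0 i := by
        by_contra hh; push Not at hh
        have : γ = α0 := le_antisymm hle hh
        rw [this] at hγ; omega
      refine ⟨fun a => pderiv i (cj a), γ + Finsupp.single i 1, -((j:ℂ)+1) * r, ?_, ?_, ?_, ?_, ?_⟩
      · simp [hγ]
      · intro t
        have := hle t
        by_cases hti : i = t
        · subst hti; simp; omega
        · simp [hti, this]
      · have : (j:ℂ) + 1 ≠ 0 := by exact_mod_cast Nat.succ_ne_zero j
        simp [hr]
        intro h; apply this; linear_combination -h
      · rw [hΨD, opT_pow_comm, pow_succ', Module.End.mul_apply, h0]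
        funext α; simp
      · rw [hΨD, opT_pow_comm, h0, h1]
        funext α
        simp only [Pi.sub_apply, Pi.zero_apply, map_zero, Pi.smul_apply, smul_smul, zero_sub,
          neg_mul, neg_smul]
        rw [add_assoc, add_comm γ]
  choose! cj γ r h1 h2 h3 h4 h5 using key
  have hne : ∀ j, j ≤ d → (opT m ^ j) (Ψ (cj j)) ≠ 0 := by
    intro j hj h
    rw [h5 j hj] at h
    have := congrFun h (α0 - γ j)
    simp only [Pi.smul_apply, tsub_add_cancel_of_le (h2 j hj), Pi.zero_apply, smul_eq_zero] at this
    rcases this with h | h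
    · exact h3 j hj h
    · exact hα0 h
  have hz : ∀ j, j ≤ d → ∀ n, j < n → (opT m ^ n) (Ψ (cj j)) = 0 := by
    intro j hj n hn
    obtain ⟨t, rfl⟩ := Nat.exists_eq_add_of_lt hn
    rw [show j + t + 1 = t + (j+1) by ring, pow_add, Module.End.mul_apply, h4 j hj, map_zero]
  have hli : LinearIndependent (PolyR m) (fun j : Fin (d+1) => cj j) := by
    rw [Fintype.linearIndependent_iff]
    intro g hg
    by_contra hcon
    push Not at hcon
    let s := Finset.univ.filter fun j => g j ≠ 0
    have hs : s.Nonempty := by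
      obtain ⟨i, hi⟩ := hcon; exact ⟨i, by simp [s, hi]⟩
    let J := s.max' hs
    have hJ : g J ≠ 0 := by
      have := s.max'_mem hs
      simp only [s, Finset.mem_filter] at this
      exact this.2
    have h := congrArg (fun x => (opT m ^ (J:ℕ)) (Ψ x)) hg
    simp only [map_sum, map_smul, map_zero] at h
    rw [Finset.sum_eq_single J] at h
    · rcases smul_eq_zero.1 h with h | h
      · exact hJ h
      · exact hne _ (by omega) h
    · intro b _ hb
      by_cases hgb : g b = 0
      · simp [hgb]
      · have : b ≤ J := s.le_max' _ (by simp [s, hgb])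
        rw [hz b (by omega) J (Fin.lt_def.1 (lt_of_le_of_ne this hb)), smul_zero]
    · simp
  have := hli.fintype_card_le_finrank
  simpa using this

end Green

section BPF
variable {m : ℕ}

lemma dual_ext {m : ℕ} {f g : Dual ℂ (PolyR m)}
    (h : ∀ α : Fin m →₀ ℕ, f (monomial α 1) = g (monomial α 1)) : f = g := by
  refine LinearMap.ext fun p => ?_
  have h2 : ∀ α, monomial α (coeff α p) = (coeff α p) • monomial α (1:ℂ) := by
    intro α; rw [smul_monomial]; simp
  rw [p.as_sum, map_sum, map_sum]
  refine Finset.sum_congr rfl fun α _ => ?_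
  rw [h2, map_smul, map_smul, h]

lemma formSpace_ext {m D : ℕ} {f : Dual ℂ (PolyR m)}
    (hf : ∀ j ≠ D, ∀ p ∈ formSpace m j, f p = 0)
    (h : ∀ α : Fin m →₀ ℕ, α.degree = D → f (monomial α 1) = 0) : f = 0 := by
  refine dual_ext fun α => ?_
  simp only [LinearMap.zero_apply]
  by_cases hα : α.degree = D
  · exact h α hα
  · exact hf _ hα _ (isHomogeneous_monomial _ rfl)

lemma green {d : ℕ} (W : Submodule ℂ (Dual ℂ (PolyR m))) [FiniteDimensional ℂ W]
    (hW : ∀ ψ ∈ W, ∀ j ≠ d, ∀ p ∈ formSpace m j, ψ p = 0) (hk : finrank ℂ W ≤ d) :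
    ∃ v : Fin m → ℂ, ∀ ψ ∈ W, (∀ p, ψ (linForm m v * p) = 0) → ψ = 0 := by
  classical
  by_contra hcon
  push Not at hcon
  let b := finBasis ℂ W
  let B : Fin (finrank ℂ W) → (Fin m →₀ ℕ) → ℂ := fun a α => (b a : Dual ℂ (PolyR m)) (monomial α 1)
  have hB : ∀ a α, α.degree ≠ d → B a α = 0 := by
    intro a α hα
    exact hW _ (b a).2 _ hα _ (isHomogeneous_monomial _ rfl)
  let J := (Finset.finsuppAntidiag (Finset.univ : Finset (Fin m)) (d-1))
  let M : Matrix J (Fin (finrank ℂ W)) (PolyR m) := Matrix.of fun j a =>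
    ∑ i, X i * C (B a (j.1 + Finsupp.single i 1))
  obtain ⟨c, hc0, hc⟩ := exists_generic_ker M (by
    intro v
    obtain ⟨ψ, hψ, h0, hne⟩ := hcon v
    refine ⟨b.repr ⟨ψ, hψ⟩, ?_, ?_⟩
    · intro h
      apply hne
      have h' : b.repr ⟨ψ, hψ⟩ = 0 := by ext a; exact congrFun h a
      rw [LinearEquiv.map_eq_zero_iff] at h'
      exact congrArg Subtype.val h'
    · funext j
      have h1 := h0 (monomial j.1 1)
      have h2 : ψ = ∑ a, b.repr ⟨ψ, hψ⟩ a • (b a : Dual ℂ (PolyR m)) := by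
        have := congrArg W.subtype (b.sum_repr ⟨ψ, hψ⟩)
        rw [map_sum] at this
        exact this.symm
      rw [h2] at h1
      simp only [Matrix.mulVec, dotProduct, Matrix.map_apply, M, Matrix.of_apply, map_sum, map_mul,
        eval_X, eval_C, Pi.zero_apply, B]
      rw [← h1]
      rw [LinearMap.sum_apply]
      simp only [LinearMap.smul_apply, linForm, Finset.sum_mul, map_sum,
        smul_eq_mul, smul_mul_assoc, map_smul]
      refine Finset.sum_congr rfl fun a _ => ?_
      refine Finset.sum_congr rfl fun i _ => ?_
      have : (X i * monomial j.1 1 : PolyR m) = monomial (j.1 + Finsupp.single i 1) 1 := by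
        rw [X, monomial_mul, add_comm]; simp
      rw [this]; ring)
  have := generic_bound B hB c (by
    intro h
    apply hc0
    have hli : LinearIndependent ℂ (fun a => (b a : Dual ℂ (PolyR m))) :=
      b.linearIndependent.map' W.subtype (by simp)
    rw [Fintype.linearIndependent_iff] at hli
    funext a
    ext β
    have h3 := hli (fun a => coeff β (c a)) (by
      refine dual_ext fun α => ?_
      have := congrArg (coeff β) (congrFun h α)
      simp only [coeff_sum, mul_comm _ (C _), coeff_C_mul] at this
      simpa [mul_comm, B] using this) a
    simpa using h3) (by
    funext α
    rw [opT_apply]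
    by_cases hα : α.degree + 1 = d
    · have hJ : α ∈ J := by
        simp only [J, Finset.mem_finsuppAntidiag, Finset.subset_univ, and_true]
        rw [← Finsupp.degree_eq_sum]; omega
      have := congrFun hc ⟨α, hJ⟩
      simp only [Matrix.mulVec, dotProduct, M, Matrix.of_apply, Pi.zero_apply] at this
      rw [Pi.zero_apply, ← this]
      simp only [Finset.mul_sum, Finset.sum_mul]
      rw [Finset.sum_comm]
      refine Finset.sum_congr rfl fun i _ => Finset.sum_congr rfl fun a _ => by ring
    · simp only [Pi.zero_apply]
      apply Finset.sum_eq_zero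
      intro i _
      have : ∀ a, B a (α + Finsupp.single i 1) = 0 := fun a => hB _ _ (by simpa using hα)
      simp [this])
  omega

/-- functionals of degree `d + e` killing `A_e U` -/
def annN (m d : ℕ) (U : Submodule ℂ (PolyR m)) (e : ℕ) : Submodule ℂ (Dual ℂ (PolyR m)) where
  carrier := {ψ | (∀ j ≠ d + e, ∀ p ∈ formSpace m j, ψ p = 0) ∧ ∀ p ∈ formSpace m e * U, ψ p = 0}
  zero_mem' := by simp
  add_mem' := by
    intro a b ha hb
    exact ⟨fun j hj p hp => by simp [ha.1 j hj p hp, hb.1 j hj p hp],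
      fun p hp => by simp [ha.2 p hp, hb.2 p hp]⟩
  smul_mem' := by
    intro c a ha
    exact ⟨fun j hj p hp => by simp [ha.1 j hj p hp], fun p hp => by simp [ha.2 p hp]⟩

instance formSpace_fd (n d : ℕ) : FiniteDimensional ℂ (formSpace n d) :=
  Module.Finite.iff_fg.2 (homogeneousSubmodule_fg _ _ d)

lemma restr_inj (d : ℕ) (U : Submodule ℂ (PolyR m)) (e : ℕ) :
    Function.Injective ((LinearMap.lcomp ℂ ℂ (formSpace m (d+e)).subtype).comp (annN m d U e).subtype
      : annN m d U e →ₗ[ℂ] Dual ℂ (formSpace m (d+e))) := by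
  rw [injective_iff_map_eq_zero]
  intro ψ hψ
  ext1
  refine formSpace_ext ψ.2.1 fun α hα => ?_
  have := LinearMap.congr_fun hψ ⟨monomial α 1, isHomogeneous_monomial _ hα⟩
  exact this

instance annN_fd (d : ℕ) (U : Submodule ℂ (PolyR m)) (e : ℕ) : FiniteDimensional ℂ (annN m d U e) :=
  FiniteDimensional.of_injective _ (restr_inj d U e)

lemma finrank_annN_zero (d : ℕ) (U : Submodule ℂ (PolyR m)) (hU : U ≤ formSpace m d) :
    finrank ℂ (annN m d U 0) ≤ vcodim m d U := by
  let U1 : Submodule ℂ (formSpace m d) := U.comap (formSpace m d).subtype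
  have h1 : finrank ℂ U1 = finrank ℂ U := (Submodule.comapSubtypeEquivOfLe hU).finrank_eq
  have h2 := Subspace.finrank_add_finrank_dualAnnihilator_eq U1
  let f := ((LinearMap.lcomp ℂ ℂ (formSpace m (d+0)).subtype).comp (annN m d U 0).subtype
      : annN m d U 0 →ₗ[ℂ] Dual ℂ (formSpace m (d+0)))
  let g : annN m d U 0 →ₗ[ℂ] U1.dualAnnihilator := f.codRestrict U1.dualAnnihilator (by
    intro ψ
    rw [Submodule.mem_dualAnnihilator]
    intro w hw
    refine ψ.2.2 _ ?_
    have : (1 : PolyR m) * (w : PolyR m) ∈ formSpace m 0 * U :=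
      Submodule.mul_mem_mul (isHomogeneous_one _ _) hw
    simpa using this)
  have hg : Function.Injective g := by
    intro a b hab
    exact restr_inj d U 0 (congrArg Subtype.val hab)
  have := LinearMap.finrank_le_finrank_of_injective hg
  unfold vcodim
  omega

/-- contraction by a linear form -/
noncomputable def contr (q : PolyR m) : Dual ℂ (PolyR m) →ₗ[ℂ] Dual ℂ (PolyR m) :=
  LinearMap.lcomp ℂ ℂ (LinearMap.mulLeft ℂ q)

lemma contr_apply (q : PolyR m) (ψ) (p) : contr q ψ p = ψ (q * p) := rfl

lemma contr_comm (q r : PolyR m) (ψ) : contr q (contr r ψ) = contr r (contr q ψ) := by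
  refine LinearMap.ext fun p => ?_
  rw [contr_apply, contr_apply, contr_apply, contr_apply]; congr 1; ring

lemma linForm_hom (v : Fin m → ℂ) : linForm m v ∈ formSpace m 1 := by
  unfold linForm
  exact Submodule.sum_mem _ fun i _ => Submodule.smul_mem _ _ (isHomogeneous_X _ _)

lemma contr_mem {d e : ℕ} {U : Submodule ℂ (PolyR m)} {q : PolyR m} (hq : q ∈ formSpace m 1)
    {ψ} (hψ : ψ ∈ annN m d U (e+1)) : contr q ψ ∈ annN m d U e := by
  constructor
  · intro j hj p hp
    exact hψ.1 (1 + j) (by omega) _ (IsHomogeneous.mul hq hp)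
  · intro p hp
    refine hψ.2 _ ?_
    have h1 : q * p ∈ formSpace m 1 * (formSpace m e * U) := Submodule.mul_mem_mul hq hp
    rw [← mul_assoc] at h1
    have h2 : formSpace m 1 * formSpace m e ≤ formSpace m (e + 1) := by
      rw [add_comm]
      exact homogeneousSubmodule_mul 1 e
    exact (mul_le_mul' h2 (le_refl U) : formSpace m 1 * formSpace m e * U ≤ _) h1

lemma contr_X_zero {D : ℕ} {ψ : Dual ℂ (PolyR m)}
    (hψ : ∀ j ≠ D + 1, ∀ p ∈ formSpace m j, ψ p = 0)
    (h : ∀ i, contr (X i) ψ = 0) : ψ = 0 := by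
  refine formSpace_ext hψ fun α hα => ?_
  have : α ≠ 0 := by rintro rfl; simp at hα
  obtain ⟨i, hi⟩ := Finsupp.ne_iff.1 this
  have h1 := LinearMap.congr_fun (h i) (monomial (α - Finsupp.single i 1) 1)
  rw [contr_apply, X, monomial_mul, add_tsub_cancel_of_le] at h1
  · simpa using h1
  · simp at hi ⊢; omega

lemma inj_all {d : ℕ} {U : Submodule ℂ (PolyR m)} {v : Fin m → ℂ}
    (h : ∀ ψ ∈ annN m d U 0, contr (linForm m v) ψ = 0 → ψ = 0) (e : ℕ) :
    ∀ ψ ∈ annN m d U e, contr (linForm m v) ψ = 0 → ψ = 0 := by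
  induction e with
  | zero => exact h
  | succ e ih =>
    intro ψ hψ h0
    refine contr_X_zero hψ.1 fun i => ?_
    refine ih _ (contr_mem (isHomogeneous_X _ _) hψ) ?_
    rw [contr_comm, h0, map_zero]

lemma common_eigen {V : Type*} [AddCommGroup V] [Module ℂ V] [FiniteDimensional ℂ V]
    [Nontrivial V] {m : ℕ} (f : Fin m → End ℂ V) (hf : ∀ i j x, f i (f j x) = f j (f i x)) :
    ∃ c : Fin m → ℂ, ∃ x : V, x ≠ 0 ∧ ∀ i, f i x = c i • x := by
  classical
  suffices h : ∀ s : Finset (Fin m), ∃ c : Fin m → ℂ, ∃ x : V, x ≠ 0 ∧ ∀ i ∈ s, f i x = c i • x by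
    obtain ⟨c, x, h0, h⟩ := h Finset.univ
    exact ⟨c, x, h0, fun i => h i (Finset.mem_univ _)⟩
  intro s
  induction s using Finset.induction_on with
  | empty =>
    obtain ⟨x, hx⟩ := exists_ne (0 : V)
    exact ⟨0, x, hx, by simp⟩
  | insert j s hj ih =>
    obtain ⟨c, x, h0, h⟩ := ih
    let E : Submodule ℂ V :=
      { carrier := {y | ∀ i ∈ s, f i y = c i • y}
        zero_mem' := by simp
        add_mem' := by
          intro a b ha hb i hi
          simp [ha i hi, hb i hi]
        smul_mem' := by
          intro r a ha i hi
          simp [ha i hi, smul_comm r] }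
    have : Nontrivial E := ⟨⟨⟨x, h⟩, 0, fun hh => h0 (congrArg Subtype.val hh)⟩⟩
    let g : End ℂ E := (f j).restrict (p := E) (q := E) (by
      intro y hy i hi
      rw [hf, hy i hi, map_smul])
    obtain ⟨μ, hμ⟩ := Module.End.exists_eigenvalue g
    obtain ⟨y, hy⟩ := hμ.exists_hasEigenvector
    refine ⟨Function.update c j μ, y, fun h => hy.2 (Subtype.ext h), ?_⟩
    intro i hi
    rcases Finset.mem_insert.1 hi with rfl | his
    · simpa [g] using congrArg Subtype.val hy.apply_eq_smul
    · have : i ≠ j := by rintro rfl; exact hj his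
      simpa [this] using y.2 i his

lemma eval_formula {θ : Dual ℂ (PolyR m)} {c : Fin m → ℂ} {l : PolyR m}
    (h : ∀ i p, θ (X i * p) = c i * θ (l * p)) (D : ℕ) :
    ∀ α : Fin m →₀ ℕ, α.degree = D → ∀ q,
      θ (monomial α 1 * q) = eval c (monomial α (1:ℂ)) * θ (l ^ D * q) := by
  induction D with
  | zero =>
    intro α hα q
    have : α = 0 := (Finsupp.degree_eq_zero_iff α).1 hα
    subst this; simp
  | succ D ih =>
    intro α hα q
    have : α ≠ 0 := by rintro rfl; simp at hα
    obtain ⟨i, hi⟩ := Finsupp.ne_iff.1 this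
    have hs : monomial α (1:ℂ) = X i * monomial (α - Finsupp.single i 1) 1 := by
      rw [X, monomial_mul, add_tsub_cancel_of_le, one_mul]
      simp at hi ⊢; omega
    have hd : (α - Finsupp.single i 1).degree = D := by
      have : α = (α - Finsupp.single i 1) + Finsupp.single i 1 := by
        rw [tsub_add_cancel_of_le]; simp at hi ⊢; omega
      rw [this, map_add] at hα
      simpa using hα
    rw [hs, mul_assoc, h, ← mul_assoc, mul_comm l, mul_assoc (monomial _ _), ih _ hd, map_mul (eval c), eval_X, pow_succ, mul_assoc (l ^ D), mul_assoc]

lemma step {d e : ℕ} {U : Submodule ℂ (PolyR m)} (hU : U ≤ formSpace m d) (hb : IsBPF m U)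
    {v : Fin m → ℂ} (h : ∀ ψ ∈ annN m d U 0, contr (linForm m v) ψ = 0 → ψ = 0) :
    finrank ℂ (annN m d U (e+1)) ≤ finrank ℂ (annN m d U e) - 1 := by
  set l := linForm m v with hl
  let T : annN m d U (e+1) →ₗ[ℂ] annN m d U e :=
    (contr l).restrict (fun ψ hψ => contr_mem (linForm_hom v) hψ)
  have hT : Function.Injective T := by
    rw [injective_iff_map_eq_zero]
    intro ψ hψ
    exact Subtype.ext (inj_all h (e+1) ψ ψ.2 (congrArg Subtype.val hψ))
  have hle := LinearMap.finrank_le_finrank_of_injective hT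
  by_contra hcon
  have heq : finrank ℂ (annN m d U (e+1)) = finrank ℂ (annN m d U e) := by omega
  have hpos : 0 < finrank ℂ (annN m d U e) := by omega
  have : Nontrivial (annN m d U e) := Module.nontrivial_of_finrank_pos hpos
  let σ := (LinearEquiv.ofInjectiveOfFinrankEq T hT heq).symm
  have hσ : ∀ ψ, contr l (σ ψ : Dual ℂ (PolyR m)) = ψ := by
    intro ψ
    have := (LinearEquiv.ofInjectiveOfFinrankEq T hT heq).apply_symm_apply ψ
    exact congrArg Subtype.val this
  let Y : Fin m → End ℂ (annN m d U e) := fun i =>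
    ((contr (X i)).restrict (fun ψ hψ => contr_mem (isHomogeneous_X _ _) hψ)
      : annN m d U (e+1) →ₗ[ℂ] annN m d U e).comp σ.toLinearMap
  have hY : ∀ i ψ, (Y i ψ : Dual ℂ (PolyR m)) = contr (X i) (σ ψ : Dual ℂ (PolyR m)) :=
    fun i ψ => rfl
  obtain ⟨c, ψ, hψ0, hc⟩ := common_eigen Y (by
    intro i j ψ
    rw [← sub_eq_zero]
    apply Subtype.ext
    refine inj_all h e _ (Submodule.coe_mem _) ?_
    rw [Submodule.coe_sub, map_sub, hY, hY, contr_comm, hσ, contr_comm _ (X j), hσ, hY, hY,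
      contr_comm, sub_self])
  set θ : Dual ℂ (PolyR m) := (σ ψ : Dual ℂ (PolyR m)) with hθ
  have hθm : θ ∈ annN m d U (e+1) := (σ ψ).2
  have hθ0 : θ ≠ 0 := by
    intro h0
    apply hψ0
    have := hσ ψ
    rw [← hθ, h0, map_zero] at this
    exact Subtype.ext this.symm
  have hrel : ∀ i p, θ (X i * p) = c i * θ (l * p) := by
    intro i p
    have h1 := congrArg Subtype.val (hc i)
    rw [hY, Submodule.coe_smul, ← hσ ψ] at h1
    exact LinearMap.congr_fun h1 p
  have hform : ∀ p ∈ formSpace m (d + (e+1)), θ p = eval c p * θ (l ^ (d+(e+1))) := by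
    intro p hp
    rw [p.as_sum, map_sum, map_sum, Finset.sum_mul]
    refine Finset.sum_congr rfl fun α hα => ?_
    have hdα : α.degree = d + (e+1) := by
      by_contra hne
      exact (mem_support_iff.1 hα) (IsHomogeneous.coeff_eq_zero hp hne)
    have h1 := eval_formula hrel _ α hdα 1
    rw [mul_one, mul_one] at h1
    have h2 : monomial α (coeff α p) = (coeff α p) • monomial α (1:ℂ) := by
      rw [smul_monomial]; simp
    rw [h2, map_smul, h1, smul_eval, smul_eq_mul]; ring
  have hl0 : θ (l ^ (d+(e+1))) ≠ 0 := by
    intro h0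
    apply hθ0
    refine formSpace_ext hθm.1 fun α hα => ?_
    rw [hform _ (isHomogeneous_monomial _ hα), h0, mul_zero]
  have hc0 : c ≠ 0 := by
    intro h0
    apply hθ0
    refine contr_X_zero (D := d + e) hθm.1 fun i => ?_
    refine LinearMap.ext fun p => ?_
    rw [contr_apply, hrel, h0]; simp
  apply hc0
  apply hb
  intro u hu
  obtain ⟨i, hi⟩ := Function.ne_iff.1 hc0
  have hxu : X i ^ (e+1) * u ∈ formSpace m (e+1) * U :=
    Submodule.mul_mem_mul (isHomogeneous_X_pow i (e+1)) hu
  have hxu' : X i ^ (e+1) * u ∈ formSpace m (d + (e+1)) := by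
    rw [add_comm]
    exact IsHomogeneous.mul (isHomogeneous_X_pow i (e+1)) (hU hu)
  have h1 := hθm.2 _ hxu
  rw [hform _ hxu', map_mul, map_pow, eval_X] at h1
  have hi' : c i ≠ 0 := hi
  simpa [hl0, hi'] using h1

lemma key_full {d k : ℕ} {U : Submodule ℂ (PolyR m)} (hd : 1 ≤ d) (hk : k ≤ d - 1)
    (hU : U ≤ formSpace m d) (hb : IsBPF m U) (hc : vcodim m d U = k) :
    formSpace m (d + (d - 1)) ≤ formSpace m (d-1) * U := by
  have h0 := finrank_annN_zero d U hU
  obtain ⟨v, hv⟩ := green (d := d) (annN m d U 0) (fun ψ hψ => hψ.1) (by omega)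
  have hv' : ∀ ψ ∈ annN m d U 0, contr (linForm m v) ψ = 0 → ψ = 0 := fun ψ hψ h1 =>
    hv ψ hψ fun p => LinearMap.congr_fun h1 p
  have hdim : ∀ e, finrank ℂ (annN m d U e) ≤ k - e := by
    intro e
    induction e with
    | zero => omega
    | succ e ih =>
      have := step (e := e) hU hb hv'
      omega
  have hbot : annN m d U (d-1) = ⊥ := by
    apply Submodule.finrank_eq_zero.1
    have := hdim (d-1)
    omega
  intro p hp
  by_contra hnp
  obtain ⟨f, hf1, hf2⟩ := Submodule.exists_le_ker_of_notMem hnp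
  let ψ : Dual ℂ (PolyR m) := f.comp (homogeneousComponent (d + (d-1)))
  have hψ : ψ ∈ annN m d U (d-1) := by
    constructor
    · intro j hj q hq
      simp only [ψ, LinearMap.comp_apply]
      rw [homogeneousComponent_of_mem hq, if_neg hj.symm, map_zero]
    · intro q hq
      have hq' : q ∈ formSpace m (d + (d-1)) := by
        rw [add_comm]
        exact homogeneousSubmodule_mul _ _ (mul_le_mul' le_rfl hU hq)
      simp only [ψ, LinearMap.comp_apply]
      rw [homogeneousComponent_of_mem hq', if_pos rfl]
      exact hf2 hq
  rw [hbot, Submodule.mem_bot] at hψ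
  apply hf1
  have := LinearMap.congr_fun hψ p
  simp only [ψ, LinearMap.comp_apply] at this
  rwa [homogeneousComponent_of_mem hp, if_pos rfl] at this

end BPF

section Main

lemma embed_inj {m n : ℕ} (h : m ≤ n) : Function.Injective (embed m n h) :=
  rename_injective _ (Fin.castLE_injective h)

lemma embed_mem {m n j : ℕ} (h : m ≤ n) {p : PolyR m} (hp : p ∈ formSpace m j) :
    embed m n h p ∈ formSpace n j :=
  IsHomogeneous.rename_isHomogeneous hp

lemma finrank_map_embed {m n : ℕ} (h : m ≤ n) (P : Submodule ℂ (PolyR m)) :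
    finrank ℂ (P.map (embed m n h).toLinearMap) = finrank ℂ P :=
  (Submodule.equivMapOfInjective _ (embed_inj h) P).finrank_eq.symm

lemma cover {n m d k : ℕ} (hmn : m ≤ n)
    (U : Submodule ℂ (PolyR n)) (hU : U ≤ formSpace n d)
    (hcodim : vcodim n d U = k)
    (U' : Submodule ℂ (PolyR m))
    (hU' : U' = Submodule.comap (embed m n hmn).toLinearMap U ⊓ formSpace m d)
    (hcodim' : vcodim m d U' = k) :
    formSpace n d ≤ U ⊔ (formSpace m d).map (embed m n hmn).toLinearMap := by
  set P := (formSpace m d).map (embed m n hmn).toLinearMap with hP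
  have hPn : P ≤ formSpace n d := by
    rintro _ ⟨p, hp, rfl⟩
    exact embed_mem hmn hp
  have : FiniteDimensional ℂ U := Submodule.finiteDimensional_of_le hU
  have : FiniteDimensional ℂ P := Submodule.finiteDimensional_of_le hPn
  have hU'le : U' ≤ formSpace m d := by rw [hU']; exact inf_le_right
  have : FiniteDimensional ℂ U' := Submodule.finiteDimensional_of_le hU'le
  have h1 : U ⊓ P ≤ U'.map (embed m n hmn).toLinearMap := by
    rintro _ ⟨hx, p, hp, rfl⟩
    exact ⟨p, by rw [hU']; exact ⟨hx, hp⟩, rfl⟩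
  have h2 := Submodule.finrank_mono h1
  rw [finrank_map_embed] at h2
  have h3 := Submodule.finrank_sup_add_finrank_inf_eq U P
  have h4 : finrank ℂ P = finrank ℂ (formSpace m d) := finrank_map_embed _ _
  have h5 := Submodule.finrank_mono hU
  have h6 := Submodule.finrank_mono hU'le
  unfold vcodim at hcodim hcodim'
  refine (Submodule.eq_of_le_of_finrank_le (sup_le hU hPn) ?_).ge
  omega

/-- degree in the variables of index at least `m` -/
def ydeg (m : ℕ) {n : ℕ} (α : Fin n →₀ ℕ) : ℕ := ∑ i : Fin n, if m ≤ (i : ℕ) then α i else 0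

lemma ydeg_add (m : ℕ) {n : ℕ} (α β : Fin n →₀ ℕ) : ydeg m (α + β) = ydeg m α + ydeg m β := by
  unfold ydeg
  rw [← Finset.sum_add_distrib]
  refine Finset.sum_congr rfl fun i _ => ?_
  split_ifs <;> simp

lemma ydeg_single (m : ℕ) {n : ℕ} (i : Fin n) (h : m ≤ (i : ℕ)) :
    ydeg m (Finsupp.single i 1) = 1 := by
  classical
  unfold ydeg
  rw [Finset.sum_eq_single i]
  · simp [h]
  · intro b _ hb; simp [hb]
  · simp

lemma ydeg_pos (m : ℕ) {n : ℕ} (α : Fin n →₀ ℕ) (h : ydeg m α ≠ 0) :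
    ∃ i : Fin n, ∃ β, m ≤ (i : ℕ) ∧ α = Finsupp.single i 1 + β := by
  obtain ⟨i, -, hi⟩ := Finset.exists_ne_zero_of_sum_ne_zero h
  have h1 : m ≤ (i : ℕ) := by by_contra hh; simp [hh] at hi
  refine ⟨i, α - Finsupp.single i 1, h1, ?_⟩
  rw [add_tsub_cancel_of_le]
  simp [h1] at hi ⊢; omega

lemma ydeg_zero {m n : ℕ} (hmn : m ≤ n) (α : Fin n →₀ ℕ) (h : ydeg m α = 0) :
    ∃ β : Fin m →₀ ℕ, α = β.mapDomain (Fin.castLE hmn) := by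
  have hr : ↑α.support ⊆ Set.range (Fin.castLE hmn) := by
    intro i hi
    have h1 : (i : ℕ) < m := by
      by_contra hh
      have := Finset.sum_eq_zero_iff.1 h i (Finset.mem_univ _)
      rw [if_pos (by omega)] at this
      simp at hi; exact hi this
    exact ⟨⟨i, h1⟩, rfl⟩
  exact ⟨α.comapDomain _ (Fin.castLE_injective hmn).injOn,
    (Finsupp.mapDomain_comapDomain _ (Fin.castLE_injective hmn) _ hr).symm⟩

lemma ydeg_mapDomain {m n : ℕ} (hmn : m ≤ n) (β : Fin m →₀ ℕ) :
    ydeg m (β.mapDomain (Fin.castLE hmn)) = 0 := by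
  unfold ydeg
  refine Finset.sum_eq_zero fun i _ => ?_
  split_ifs with h
  · refine Finsupp.mapDomain_of_notMem_range _ _ ?_
    rintro ⟨j, rfl⟩
    have := j.2
    simp at h; omega
  · rfl

lemma exists_split {n : ℕ} (j : ℕ) : ∀ α : Fin n →₀ ℕ, j ≤ α.degree →
    ∃ β γ, α = β + γ ∧ β.degree = j := by
  induction j with
  | zero => intro α _; exact ⟨0, α, by simp, by simp⟩
  | succ j ih =>
    intro α hα
    obtain ⟨β, γ, h1, h2⟩ := ih α (by omega)
    have hγ : γ ≠ 0 := by
      rintro rfl; rw [h1] at hα; simp at hα; omega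
    obtain ⟨i, hi⟩ := Finsupp.ne_iff.1 hγ
    refine ⟨β + Finsupp.single i 1, γ - Finsupp.single i 1, ?_, by simp [h2]⟩
    rw [add_assoc, add_tsub_cancel_of_le, h1]
    simp at hi ⊢; omega

lemma mapDomain_degree {m n : ℕ} (hmn : m ≤ n) (β : Fin m →₀ ℕ) :
    (β.mapDomain (Fin.castLE hmn)).degree = β.degree := by
  induction β using Finsupp.induction_linear with
  | zero => simp
  | add f g hf hg => rw [Finsupp.mapDomain_add, map_add, map_add, hf, hg]
  | single i a => simp

lemma embed_monomial {m n : ℕ} (hmn : m ≤ n) (β : Fin m →₀ ℕ) (r : ℂ) :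
    embed m n hmn (monomial β r) = monomial (β.mapDomain (Fin.castLE hmn)) r :=
  rename_monomial _ _ _

lemma cover2 {n m d : ℕ} (hd : 1 ≤ d) (hmn : m ≤ n)
    (U : Submodule ℂ (PolyR n))
    (U' : Submodule ℂ (PolyR m))
    (hU' : U' = Submodule.comap (embed m n hmn).toLinearMap U ⊓ formSpace m d)
    (hcov : formSpace n d ≤ U ⊔ (formSpace m d).map (embed m n hmn).toLinearMap)
    (hfull : formSpace m (d + (d - 1)) ≤ formSpace m (d-1) * U') :
    formSpace n (2 * d) ≤ U * U ⊔ (formSpace m (2 * d)).map (embed m n hmn).toLinearMap := by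
  set V := U * U ⊔ (formSpace m (2 * d)).map (embed m n hmn).toLinearMap with hV
  have hsplit : ∀ g ∈ formSpace n d, ∃ u ∈ U, ∃ a ∈ formSpace m d, g = u + embed m n hmn a := by
    intro g hg
    obtain ⟨u, hu, _, ⟨a, ha, rfl⟩, h⟩ := Submodule.mem_sup.1 (hcov hg)
    exact ⟨u, hu, a, ha, h.symm⟩
  have hUU : ∀ u ∈ U, ∀ w ∈ U, u * w ∈ V := fun u hu w hw =>
    Submodule.mem_sup_left (Submodule.mul_mem_mul hu hw)
  have hAA : ∀ a ∈ formSpace m d, ∀ b ∈ formSpace m d, embed m n hmn a * embed m n hmn b ∈ V := by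
    intro a ha b hb
    refine Submodule.mem_sup_right ⟨a * b, ?_, map_mul (embed m n hmn) _ _⟩
    rw [two_mul]
    exact IsHomogeneous.mul ha hb
  have hB : ∀ w ∈ U', ∀ g ∈ formSpace n d, g * embed m n hmn w ∈ V := by
    intro w hw g hg
    rw [hU'] at hw
    obtain ⟨u, hu, a, ha, rfl⟩ := hsplit g hg
    rw [add_mul]
    exact V.add_mem (hUU _ hu _ hw.1) (hAA _ ha _ hw.2)
  have hmono : ∀ s, ∀ α : Fin n →₀ ℕ, α.degree = 2 * d → ydeg m α = s →
      (monomial α 1 : PolyR n) ∈ V := by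
    intro s
    induction s using Nat.strong_induction_on with
    | _ s ih =>
    intro α hα hs
    -- monomials of smaller degree times forms in the first variables
    have hlow : ∀ β : Fin n →₀ ℕ, β.degree = d → ydeg m β < s → ∀ b ∈ formSpace m d,
        monomial β 1 * embed m n hmn b ∈ V := by
      intro β hβ hlt b hb
      rw [b.as_sum, map_sum, Finset.mul_sum]
      refine Submodule.sum_mem _ fun γ hγ => ?_
      have hdγ : γ.degree = d := by
        by_contra hne
        exact (mem_support_iff.1 hγ) (IsHomogeneous.coeff_eq_zero hb hne)
      rw [embed_monomial, monomial_mul, one_mul]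
      have h2 : ∀ (δ : Fin n →₀ ℕ) (r : ℂ), monomial δ r = r • monomial δ (1:ℂ) := by
        intro δ r; rw [smul_monomial]; simp
      rw [h2]
      refine V.smul_mem _ (ih (ydeg m β) hlt _ ?_ ?_)
      · rw [map_add, mapDomain_degree]; omega
      · rw [ydeg_add, ydeg_mapDomain, add_zero]
    by_cases h0 : ydeg m α = 0
    · obtain ⟨β, rfl⟩ := ydeg_zero hmn α h0
      rw [mapDomain_degree] at hα
      exact Submodule.mem_sup_right ⟨monomial β 1, isHomogeneous_monomial _ hα, embed_monomial _ _ _⟩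
    obtain ⟨i, β, hi, rfl⟩ := ydeg_pos m α h0
    rw [ydeg_add, ydeg_single m i hi] at hs
    rw [map_add, Finsupp.degree_single] at hα
    by_cases h1 : ydeg m β = 0
    · obtain ⟨γ, rfl⟩ := ydeg_zero hmn β h1
      rw [mapDomain_degree] at hα
      have hq : (monomial γ 1 : PolyR m) ∈ formSpace m (d-1) * U' :=
        hfull (isHomogeneous_monomial _ (by omega))
      have : (monomial (Finsupp.single i 1 + γ.mapDomain (Fin.castLE hmn)) 1 : PolyR n)
          = X i * embed m n hmn (monomial γ 1) := by
        rw [embed_monomial, X, monomial_mul, one_mul]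
      rw [this]
      refine Submodule.mul_induction_on hq ?_ ?_
      · intro a ha w hw
        rw [map_mul, ← mul_assoc]
        refine hB w hw _ ?_
        have := IsHomogeneous.mul (isHomogeneous_X ℂ i) (embed_mem hmn ha)
        rwa [show 1 + (d-1) = d by omega] at this
      · intro x y hx hy
        rw [map_add, mul_add]
        exact V.add_mem hx hy
    obtain ⟨j, δ, hj, rfl⟩ := ydeg_pos m β h1
    rw [ydeg_add, ydeg_single m j hj] at hs
    rw [map_add, Finsupp.degree_single] at hα
    obtain ⟨β', γ', rfl, hβ'⟩ := exists_split (d-1) δ (by omega)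
    rw [map_add] at hα
    rw [ydeg_add] at hs
    have hg1 : (Finsupp.single i 1 + β').degree = d := by
      rw [map_add, Finsupp.degree_single]; omega
    have hh1 : (Finsupp.single j 1 + γ').degree = d := by
      rw [map_add, Finsupp.degree_single]; omega
    have hgy : ydeg m (Finsupp.single i 1 + β') < s := by
      rw [ydeg_add, ydeg_single m i hi]; omega
    have hhy : ydeg m (Finsupp.single j 1 + γ') < s := by
      rw [ydeg_add, ydeg_single m j hj]; omega
    have hprod : (monomial (Finsupp.single i 1 + (Finsupp.single j 1 + (β' + γ'))) 1 : PolyR n)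
        = monomial (Finsupp.single i 1 + β') 1 * monomial (Finsupp.single j 1 + γ') 1 := by
      rw [monomial_mul, one_mul]
      congr 1
      rw [add_add_add_comm, add_assoc]
    obtain ⟨u, hu, a, ha, hga⟩ := hsplit _ (isHomogeneous_monomial (1:ℂ) hg1)
    obtain ⟨w, hw, b, hb, hhb⟩ := hsplit _ (isHomogeneous_monomial (1:ℂ) hh1)
    have hid : (monomial (Finsupp.single i 1 + β') 1 * monomial (Finsupp.single j 1 + γ') 1 : PolyR n)
        = u * w + monomial (Finsupp.single i 1 + β') 1 * embed m n hmn b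
          + monomial (Finsupp.single j 1 + γ') 1 * embed m n hmn a
          - embed m n hmn a * embed m n hmn b := by
      rw [hga, hhb]; ring
    rw [hprod, hid]
    exact V.sub_mem (V.add_mem (V.add_mem (hUU _ hu _ hw) (hlow _ hg1 hgy _ hb))
      (hlow _ hh1 hhy _ ha)) (hAA _ ha _ hb)
  intro p hp
  rw [p.as_sum]
  refine Submodule.sum_mem _ fun γ hγ => ?_
  have hdγ : γ.degree = 2 * d := by
    by_contra hne
    exact (mem_support_iff.1 hγ) (IsHomogeneous.coeff_eq_zero hp hne)
  have h2 : monomial γ (coeff γ p) = (coeff γ p) • monomial γ (1:ℂ) := by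
    rw [smul_monomial]; simp
  rw [h2]
  exact V.smul_mem _ (hmono _ γ hdγ rfl)

end Main

theorem stmt9 (n m d k : ℕ) (hd : 2 ≤ d) (hm : 2 ≤ m) (hmn : m ≤ n)
    (hkd : k ≤ d - 1)
    (U : Submodule ℂ (PolyR n)) (hU : U ≤ formSpace n d)
    (hcodim : vcodim n d U = k)
    (U' : Submodule ℂ (PolyR m))
    (hU' : U' = Submodule.comap (embed m n hmn).toLinearMap U ⊓ formSpace m d)
    (hcodim' : vcodim m d U' = k)
    (hbpf : IsBPF n U) (hbpf' : IsBPF m U') :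
    vcodim n (2 * d) (U * U) ≤ vcodim m (2 * d) (U' * U') := by
  have hU'le : U' ≤ formSpace m d := by rw [hU']; exact inf_le_right
  have hfull := key_full (by omega) hkd hU'le hbpf' hcodim'
  have hcov := cover hmn U hU hcodim U' hU' hcodim'
  have hcov2 := cover2 (by omega) hmn U U' hU' hcov hfull
  set P := (formSpace m (2 * d)).map (embed m n hmn).toLinearMap with hP
  have hUU : U * U ≤ formSpace n (2 * d) := by
    rw [two_mul]
    exact (mul_le_mul' hU hU).trans (homogeneousSubmodule_mul d d)
  have hPn : P ≤ formSpace n (2 * d) := by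
    rintro _ ⟨p, hp, rfl⟩
    exact embed_mem hmn hp
  have : FiniteDimensional ℂ ↥(U * U) := Submodule.finiteDimensional_of_le hUU
  have : FiniteDimensional ℂ P := Submodule.finiteDimensional_of_le hPn
  have hle : (U' * U').map (embed m n hmn).toLinearMap ≤ U * U ⊓ P := by
    rw [Submodule.map_le_iff_le_comap, Submodule.mul_le]
    intro x hx y hy
    rw [hU'] at hx hy
    refine ⟨?_, x * y, ?_, rfl⟩
    · change embed m n hmn (x * y) ∈ U * U
      rw [map_mul]
      exact Submodule.mul_mem_mul hx.1 hy.1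
    · rw [two_mul]
      exact IsHomogeneous.mul hx.2 hy.2
  have h2 := Submodule.finrank_mono hle
  rw [finrank_map_embed] at h2
  have h3 := Submodule.finrank_sup_add_finrank_inf_eq (U * U) P
  have h4 : finrank ℂ P = finrank ℂ (formSpace m (2 * d)) := finrank_map_embed _ _
  have h5 := Submodule.finrank_mono hcov2
  unfold vcodim
  omega
end

section
/- Let U ⊆ A_d be a base-point-free linear subspace of codimension 2. Then: (i) if d = 2, codim U² ≤ 6; (ii) if d ≥ 3, codim U² ≤ 4. Moreover, for d ≤ 4 these bounds are tight: for d = 2 there exist n and a base-point-free codimension-2 subspace U ⊆ A(n)_2 with codim U² = 6, and for d ∈ {3,4} there exist n and a base-point-free codimension-2 subspace U ⊆ A(n)_d with codim U² = 4. -/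
open MvPolynomial Module

namespace Aux

/-! ### Common zeros of few polynomials -/

lemma height_chain (n : ℕ) (k : ℕ) (hk : k ≤ n) : ∀ (P : Ideal (PolyR n)),
    P = RingHom.ker (aeval (R := ℂ) (fun i : Fin n => if i.val < k then (0 : PolyR n) else X i)) →
    (k : ℕ∞) ≤ P.height := by
  induction k with
  | zero => intro P _; simp
  | succ k ih =>
    intro P hP
    have h1 := ih (by omega) _ rfl
    set Q := RingHom.ker (aeval (R := ℂ)
      (fun i : Fin n => if i.val < k then (0 : PolyR n) else X i)) with hQ
    have : Q.IsPrime := RingHom.ker_isPrime _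
    have : P.IsPrime := by rw [hP]; exact RingHom.ker_isPrime _
    have hlt : Q < P := by
      rw [SetLike.lt_iff_le_and_exists]
      constructor
      · intro p hp
        rw [hP, RingHom.mem_ker]
        rw [hQ, RingHom.mem_ker] at hp
        have : (aeval (R := ℂ) (fun i : Fin n => if i.val < k + 1 then (0 : PolyR n) else X i)) p
          = (aeval (R := ℂ) (fun i : Fin n => if i.val < k + 1 then (0 : PolyR n) else X i))
            ((aeval (R := ℂ) (fun i : Fin n => if i.val < k then (0 : PolyR n) else X i)) p) := by
          rw [← AlgHom.comp_apply]
          congr 1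
          apply MvPolynomial.algHom_ext
          intro i
          simp only [AlgHom.comp_apply, aeval_X]
          by_cases h : i.val < k
          · simp [h, show i.val < k + 1 by omega]
          · simp [h]
        rw [this]
        erw [hp]
        simp
      · refine ⟨X ⟨k, by omega⟩, ?_, ?_⟩
        · rw [hP, RingHom.mem_ker]; simp
        · rw [hQ, RingHom.mem_ker]; simp
    have h2 := Ideal.height_add_one_le_of_lt_of_isPrime hlt
    push_cast
    exact le_trans (by gcongr) h2

lemma exists_zero {n r : ℕ} (hr : r < n) (F : Fin r → PolyR n) (h0 : ∀ i, eval 0 (F i) = 0) :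
    ∃ x : Fin n → ℂ, x ≠ 0 ∧ ∀ i, eval x (F i) = 0 := by
  by_contra hcon
  push Not at hcon
  set I : Ideal (PolyR n) := Ideal.span (Set.range F) with hI
  set P : Ideal (PolyR n) := RingHom.ker (aeval (R := ℂ)
    (fun i : Fin n => if i.val < n then (0 : PolyR n) else X i)) with hP
  have hPp : P.IsPrime := RingHom.ker_isPrime _
  have hheight := height_chain n n le_rfl P hP
  have hfun : (fun i : Fin n => if i.val < n then (0 : PolyR n) else X i) = fun _ => 0 := by
    ext i; simp
  have hPmem : ∀ p : PolyR n, p ∈ P ↔ eval 0 p = 0 := by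
    intro p
    rw [hP, RingHom.mem_ker, hfun]
    have : (aeval (R := ℂ) (fun _ : Fin n => (0 : PolyR n))) p = C (eval 0 p) := by
      have := MvPolynomial.aeval_zero (R := ℂ) (S₁ := PolyR n) p
      simp only [Pi.zero_def] at this
      simpa [constantCoeff_eq, eval_zero'] using this
    erw [this]
    simp
  have hIP : I ≤ P := by
    rw [hI, Ideal.span_le]
    rintro _ ⟨i, rfl⟩
    exact (hPmem _).2 (h0 i)
  have hPrad : P ≤ I.radical := by
    rw [← vanishingIdeal_zeroLocus_eq_radical (K := ℂ)]
    intro p hp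
    rw [mem_vanishingIdeal_iff]
    intro x hx
    have hx0 : x = 0 := by
      by_contra hne
      obtain ⟨i, hi⟩ := hcon x hne
      apply hi
      have := hx (F i) (Ideal.subset_span ⟨i, rfl⟩)
      simpa [aeval_eq_eval] using this
    subst hx0
    simpa [aeval_eq_eval] using (hPmem p).1 hp
  have hmin : P ∈ I.minimalPrimes := by
    refine ⟨⟨hPp, hIP⟩, ?_⟩
    rintro Q ⟨hQ, hIQ⟩ hQP
    exact hPrad.trans ((Ideal.IsPrime.radical_le_iff hQ).2 hIQ)
  have h3 := Ideal.height_le_card_of_mem_minimalPrimes_span (Set.finite_range F) hmin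
  have h4 : (Set.range F).ncard ≤ r := by
    rw [← Set.image_univ]
    refine (Set.ncard_image_le).trans ?_
    simp [Set.ncard_univ]
  have h5 : (n : ℕ∞) ≤ (r : ℕ∞) := hheight.trans (h3.trans (by exact_mod_cast h4))
  have : n ≤ r := by exact_mod_cast h5
  omega

/-- restriction of a functional to `d`-th powers of linear combinations, common zeros. -/
lemma exists_pow_zero {A : Type*} [CommRing A] [Algebra ℂ A] {k r : ℕ} (hr : r < k) {d : ℕ}
    (hd : 1 ≤ d) (f : Fin r → A →ₗ[ℂ] ℂ) (t : Fin k → A) :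
    ∃ c : Fin k → ℂ, c ≠ 0 ∧ ∀ i, f i ((∑ j, c j • t j) ^ d) = 0 := by
  obtain ⟨c, hc, h⟩ := exists_zero hr
    (fun i => ∑ s : Fin d → Fin k, C (f i (∏ a, t (s a))) * ∏ a, X (s a)) (by
      intro i
      rw [map_sum]
      apply Finset.sum_eq_zero
      intro s _
      have : NeZero d := ⟨by omega⟩
      simp only [map_mul, map_prod, eval_X]
      have hz : ∏ x, (0 : Fin k → ℂ) (s x) = 0 :=
        Finset.prod_eq_zero (Finset.mem_univ (0 : Fin d)) rfl
      rw [hz, mul_zero])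
  refine ⟨c, hc, fun i => ?_⟩
  rw [Fintype.sum_pow, map_sum, ← h i, map_sum]
  apply Finset.sum_congr rfl
  intro s _
  rw [Finset.prod_smul, map_smul]
  simp [mul_comm]


/-! ### Leading monomials -/

/-- Exponents of degree `d`. -/
def Mon (n d : ℕ) : Set (Fin n →₀ ℕ) := {m | m.degree = d}

lemma finite_Mon (n d : ℕ) : (Mon n d).Finite := by
  have : Mon n d ⊆ ((Finset.univ : Finset (Fin n)).finsuppAntidiag d : Set (Fin n →₀ ℕ)) := by
    intro m hm
    simp only [Mon, Set.mem_ofPred_eq] at hm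
    simp [Finset.mem_finsuppAntidiag, ← hm, Finsupp.degree_eq_sum]
  exact (Finset.finite_toSet _).subset this

lemma mem_form {n d : ℕ} {p : PolyR n} :
    p ∈ formSpace n d ↔ ∀ m, coeff m p ≠ 0 → m.degree = d := by
  rw [formSpace, mem_homogeneousSubmodule]
  constructor
  · intro h m hm
    have := h hm
    rwa [show (1 : Fin n → ℕ) = fun _ => 1 from rfl, ← Finsupp.degree_eq_weight_one] at this
  · intro h m hm
    have := h m hm
    rwa [Finsupp.degree_eq_weight_one] at this

/-- `m` is the lexicographically smallest monomial of `p`. -/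
def Ld {n : ℕ} (p : PolyR n) (m : Fin n →₀ ℕ) : Prop :=
  coeff m p ≠ 0 ∧ ∀ m', coeff m' p ≠ 0 → toLex m ≤ toLex m'

/-- the set of leading exponents -/
def inn {n : ℕ} (U : Submodule ℂ (PolyR n)) : Set (Fin n →₀ ℕ) := {m | ∃ p ∈ U, Ld p m}

lemma exists_Ld {n : ℕ} {p : PolyR n} (hp : p ≠ 0) : ∃ m, Ld p m := by
  have hs : p.support.Nonempty := by
    rwa [Finset.nonempty_iff_ne_empty, Ne, MvPolynomial.support_eq_empty]
  obtain ⟨m, hm, hmin⟩ := Finset.exists_min_image p.support (fun m => toLex m) hs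
  exact ⟨m, mem_support_iff.1 hm, fun m' hm' => hmin m' (mem_support_iff.2 hm')⟩

lemma Ld_mul {n : ℕ} {p q : PolyR n} {a b : Fin n →₀ ℕ} (hp : Ld p a) (hq : Ld q b) :
    Ld (p * q) (a + b) := by
  constructor
  · rw [coeff_mul, Finset.sum_eq_single (a, b)]
    · exact mul_ne_zero hp.1 hq.1
    · rintro ⟨x, y⟩ hxy hne
      by_contra hc
      have hx := hp.2 x (left_ne_zero_of_mul hc)
      have hy := hq.2 y (right_ne_zero_of_mul hc)
      rw [Finset.HasAntidiagonal.mem_antidiagonal] at hxy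
      simp only at hxy
      apply hne
      have h1 : toLex x + toLex y = toLex a + toLex b := by
        rw [← toLex_add, ← toLex_add, hxy]
      have hxa : toLex a = toLex x := by
        by_contra hh
        have := add_lt_add_of_lt_of_le (lt_of_le_of_ne hx hh) hy
        rw [h1] at this
        exact lt_irrefl _ this
      have hxa' : a = x := toLex.injective hxa
      subst hxa'
      rw [add_left_cancel hxy]
    · intro h; simp at h
  · intro m hm
    rw [coeff_mul] at hm
    obtain ⟨⟨x, y⟩, hxy, hne⟩ := Finset.exists_ne_zero_of_sum_ne_zero hm
    rw [Finset.HasAntidiagonal.mem_antidiagonal] at hxy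
    rw [← hxy, toLex_add, toLex_add]
    exact add_le_add (hp.2 x (left_ne_zero_of_mul hne)) (hq.2 y (right_ne_zero_of_mul hne))

lemma inn_add {n : ℕ} {U V : Submodule ℂ (PolyR n)} {a b : Fin n →₀ ℕ} (ha : a ∈ inn U)
    (hb : b ∈ inn V) : a + b ∈ inn (U * V) := by
  obtain ⟨p, hp, hpa⟩ := ha
  obtain ⟨q, hq, hqb⟩ := hb
  exact ⟨p * q, Submodule.mul_mem_mul hp hq, Ld_mul hpa hqb⟩

lemma Ld_monomial {n : ℕ} (m : Fin n →₀ ℕ) : Ld (monomial m (1 : ℂ)) m := by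
  constructor
  · simp
  · intro m' h
    rw [coeff_monomial] at h
    have : m = m' := by by_contra hh; simp [hh] at h
    rw [this]

lemma inn_of_monomial {n : ℕ} {U : Submodule ℂ (PolyR n)} {m : Fin n →₀ ℕ}
    (h : monomial m (1 : ℂ) ∈ U) : m ∈ inn U := ⟨_, h, Ld_monomial m⟩

lemma inn_subset {n d : ℕ} {U : Submodule ℂ (PolyR n)} (hU : U ≤ formSpace n d) :
    inn U ⊆ Mon n d := by
  rintro m ⟨p, hp, hm⟩
  exact mem_form.1 (hU hp) m hm.1

lemma inn_form (n d : ℕ) : inn (formSpace n d) = Mon n d := by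
  apply Set.Subset.antisymm (inn_subset le_rfl)
  intro m hm
  apply inn_of_monomial
  rw [mem_form]
  intro m' h
  rw [coeff_monomial] at h
  have : m = m' := by by_contra hh; simp [hh] at h
  rw [← this]; exact hm

lemma finite_form (n d : ℕ) : FiniteDimensional ℂ (formSpace n d) := by
  have := homogeneousSubmodule_fg (σ := Fin n) (R := ℂ) d
  exact Module.Finite.iff_fg.2 this

lemma finite_sub {n d : ℕ} {U : Submodule ℂ (PolyR n)} (hU : U ≤ formSpace n d) :
    FiniteDimensional ℂ U := by
  have := finite_form n d
  exact Submodule.finiteDimensional_of_le hU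

lemma finrank_eq {n d : ℕ} {U : Submodule ℂ (PolyR n)} (hU : U ≤ formSpace n d) :
    finrank ℂ U = (inn U).ncard := by
  have hfd := finite_sub hU
  have hfin : (inn U).Finite := (finite_Mon n d).subset (inn_subset hU)
  have : Fintype (inn U) := hfin.fintype
  have hcard : (inn U).ncard = Fintype.card (inn U) := by
    rw [← Nat.card_coe_set_eq, Nat.card_eq_fintype_card]
  rw [hcard]
  apply le_antisymm
  · let φ : U →ₗ[ℂ] (inn U → ℂ) :=
      { toFun := fun p m => coeff m.1 p.1
        map_add' := by intro p q; ext m; simp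
        map_smul' := by intro c q; ext m; simp }
    have hinj : Function.Injective φ := by
      rw [injective_iff_map_eq_zero]
      intro p hp
      by_contra hne
      have hne' : p.1 ≠ 0 := fun h => hne (Subtype.ext h)
      obtain ⟨m, hm⟩ := exists_Ld hne'
      exact hm.1 (congrFun hp ⟨m, ⟨p.1, p.2, hm⟩⟩)
    have := LinearMap.finrank_le_finrank_of_injective hinj
    simpa using this
  · choose u hu hl using fun m : inn U => m.2
    have hli : LinearIndependent ℂ (fun m : inn U => (⟨u m, hu m⟩ : U)) := by
      rw [linearIndependent_iff']
      intro s g hg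
      by_contra hcon
      push Not at hcon
      obtain ⟨i0, hi0, hgi0⟩ := hcon
      obtain ⟨i, hi, hmin⟩ := Finset.exists_min_image (s.filter (fun i => g i ≠ 0))
        (fun m => toLex m.1) ⟨i0, by simp [hi0, hgi0]⟩
      rw [Finset.mem_filter] at hi
      have hg' : ∑ j ∈ s, g j • u j = 0 := by
        have := congrArg (Submodule.subtype U) hg
        simpa [map_sum] using this
      have hc := congrArg (coeff i.1) hg'
      rw [coeff_sum, Finset.sum_eq_single i] at hc
      · simp only [coeff_smul, coeff_zero, smul_eq_mul] at hc
        exact mul_ne_zero hi.2 (hl i).1 hc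
      · intro j hj hji
        by_contra hne
        rw [coeff_smul, smul_eq_mul] at hne
        have h1 := (hl j).2 i.1 (right_ne_zero_of_mul hne)
        have h2 := hmin j (by simp [hj, left_ne_zero_of_mul hne])
        apply hji
        exact Subtype.ext (toLex.injective (le_antisymm h1 h2))
      · intro h; exact absurd hi.1 h
    have := hli.fintype_card_le_finrank
    simpa using this

lemma vcodim_eq {n d : ℕ} {U : Submodule ℂ (PolyR n)} (hU : U ≤ formSpace n d) :
    vcodim n d U = (Mon n d \ inn U).ncard := by
  rw [vcodim, finrank_eq hU, finrank_eq le_rfl, inn_form,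
    Set.ncard_sdiff (inn_subset hU) ((finite_Mon n d).subset (inn_subset hU))]

lemma sq_le {n d : ℕ} {U : Submodule ℂ (PolyR n)} (hU : U ≤ formSpace n d) :
    U * U ≤ formSpace n (2 * d) := by
  refine (mul_le_mul' hU hU).trans ?_
  rw [two_mul]
  exact homogeneousSubmodule_mul d d

lemma form_mul {n a b : ℕ} {p q : PolyR n} (hp : p ∈ formSpace n a) (hq : q ∈ formSpace n b) :
    p * q ∈ formSpace n (a + b) :=
  homogeneousSubmodule_mul a b (Submodule.mul_mem_mul hp hq)

lemma monomial_form {n d : ℕ} {m : Fin n →₀ ℕ} (hm : m.degree = d) (c : ℂ) :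
    monomial m c ∈ formSpace n d := by
  rw [mem_form]
  intro m' h
  rw [coeff_monomial] at h
  have : m = m' := by by_contra hh; simp [hh] at h
  rw [← this]; exact hm


/-! ### Combinatorics of pairs of monomials -/

lemma exists_sub {n : ℕ} (R : Fin n →₀ ℕ) (k : ℕ) (hk : k ≤ R.degree) :
    ∃ Q C : Fin n →₀ ℕ, Q + C = R ∧ Q.degree = k := by
  induction k with
  | zero => exact ⟨0, R, by simp, by simp⟩
  | succ k ih =>
    obtain ⟨Q, C, h, hQ⟩ := ih (by omega)
    have hC : C ≠ 0 := by
      rintro rfl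
      have := congrArg Finsupp.degree h
      simp at this
      omega
    obtain ⟨i, hi⟩ := Finsupp.ne_iff.1 hC
    have hle : Finsupp.single i 1 ≤ C := by
      rw [Finsupp.single_le_iff]
      simp at hi
      omega
    refine ⟨Q + Finsupp.single i 1, C - Finsupp.single i 1, ?_, ?_⟩
    · rw [add_assoc, add_tsub_cancel_of_le hle, h]
    · simp [hQ]

lemma deg3 {n : ℕ} (N : Fin n →₀ ℕ) {i j k : Fin n} (hij : i ≠ j) (hik : i ≠ k) (hjk : j ≠ k) :
    N i + N j + N k ≤ N.degree := by
  rw [Finsupp.degree_eq_sum]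
  have : ∑ a ∈ ({i, j, k} : Finset (Fin n)), N a ≤ ∑ a, N a :=
    Finset.sum_le_sum_of_subset (Finset.subset_univ _)
  rw [Finset.sum_insert (by simp [hij, hik]), Finset.sum_insert (by simp [hjk]),
    Finset.sum_singleton] at this
  omega

lemma deg2 {n : ℕ} (N : Fin n →₀ ℕ) {i j : Fin n} (hij : i ≠ j) :
    N i + N j ≤ N.degree := by
  rw [Finsupp.degree_eq_sum]
  have : ∑ a ∈ ({i, j} : Finset (Fin n)), N a ≤ ∑ a, N a :=
    Finset.sum_le_sum_of_subset (Finset.subset_univ _)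
  rw [Finset.sum_insert (by simp [hij]), Finset.sum_singleton] at this
  omega

lemma two_supp {n d : ℕ} (hd : 1 ≤ d) {M : Fin n →₀ ℕ} (hM : M.degree = d)
    (hp : ∀ i, M ≠ Finsupp.single i d) : ∃ j k, j ≠ k ∧ 1 ≤ M j ∧ 1 ≤ M k := by
  have h0 : M ≠ 0 := by
    rintro rfl
    simp at hM
    omega
  obtain ⟨j, hj⟩ := Finsupp.ne_iff.1 h0
  by_contra hcon
  push Not at hcon
  have hj' : 1 ≤ M j := by simp at hj; omega
  have hM' : M = Finsupp.single j (M j) := by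
    ext k
    by_cases h : j = k
    · subst h; simp
    · have := hcon j k h hj'
      simp [Finsupp.single_apply, h]
      omega
  have : M j = d := by
    rw [hM', Finsupp.degree_single] at hM
    exact hM
  rw [this] at hM'
  exact hp j hM'

/-- `P` is not a product of two monomials of degree `d` different from `M, N`. -/
def Bad {n : ℕ} (d : ℕ) (M N P : Fin n →₀ ℕ) : Prop :=
  ∀ Q R : Fin n →₀ ℕ, Q.degree = d → R.degree = d → Q + R = P →
    (Q = M ∨ Q = N) ∨ (R = M ∨ R = N)

lemma Bad.symm {n d : ℕ} {M N P : Fin n →₀ ℕ} (h : Bad d M N P) : Bad d N M P := by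
  intro Q R hQ hR h'
  have := h Q R hQ hR h'
  tauto

lemma pigeon {α : Type*} {a a' b b' c c' M N : α}
    (h1 : a ≠ b) (h2 : a ≠ b') (h3 : a' ≠ b) (h4 : a' ≠ b')
    (h5 : a ≠ c) (h6 : a ≠ c') (h7 : a' ≠ c) (h8 : a' ≠ c')
    (h9 : b ≠ c) (h10 : b ≠ c') (h11 : b' ≠ c) (h12 : b' ≠ c')
    (ha : (a = M ∨ a = N) ∨ (a' = M ∨ a' = N)) (hb : (b = M ∨ b = N) ∨ (b' = M ∨ b' = N))
    (hc : (c = M ∨ c = N) ∨ (c' = M ∨ c' = N)) : False := by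
  grind

lemma single_inj {n : ℕ} {i j : Fin n} (hij : i ≠ j) (h : Finsupp.single i 1 = Finsupp.single j 1) :
    False := by
  have := DFunLike.congr_fun h i
  simp [Finsupp.single_apply, hij.symm] at this

lemma bad_core {n d : ℕ} {M N P B C : Fin n →₀ ℕ} (hbad : Bad d M N P)
    {i j k : Fin n} (hij : i ≠ j) (hik : i ≠ k) (hjk : j ≠ k)
    (hP : B + C + Finsupp.single i 1 + Finsupp.single j 1 + Finsupp.single k 1 = P)
    (hB : B.degree + 1 = d) (hC : C.degree + 2 = d)
    (hi : B ≠ C + Finsupp.single i 1) (hj : B ≠ C + Finsupp.single j 1)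
    (hk : B ≠ C + Finsupp.single k 1) : False := by
  set ei := Finsupp.single i 1 with hei
  set ej := Finsupp.single j 1 with hej
  set ek := Finsupp.single k 1 with hek
  have dei : ei.degree = 1 := by simp [hei]
  have dej : ej.degree = 1 := by simp [hej]
  have dek : ek.degree = 1 := by simp [hek]
  have nij : ei ≠ ej := single_inj hij
  have nik : ei ≠ ek := single_inj hik
  have njk : ej ≠ ek := single_inj hjk
  have p1 := hbad (B + ei) (C + ej + ek) (by simp [dei, hB]) (by simp [dej, dek]; omega)
    (by rw [← hP]; abel)
  have p2 := hbad (B + ej) (C + ei + ek) (by simp [dej, hB]) (by simp [dei, dek]; omega)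
    (by rw [← hP]; abel)
  have p3 := hbad (B + ek) (C + ei + ej) (by simp [dek, hB]) (by simp [dei, dej]; omega)
    (by rw [← hP]; abel)
  refine pigeon ?_ ?_ ?_ ?_ ?_ ?_ ?_ ?_ ?_ ?_ ?_ ?_ p1 p2 p3
  · intro h; exact nij (add_left_cancel h)
  · intro h; exact hk (add_right_cancel (b := ei) (by rw [h]; abel))
  · intro h; exact hk (add_right_cancel (b := ej) (by rw [← h]; abel))
  · intro h; exact nij.symm (add_left_cancel (a := C + ek) (by
      rw [show C + ek + ej = C + ej + ek by abel, h]; abel))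
  · intro h; exact nik (add_left_cancel h)
  · intro h; exact hj (add_right_cancel (b := ei) (by rw [h]; abel))
  · intro h; exact hj (add_right_cancel (b := ek) (by rw [← h]; try abel))
  · intro h; exact nik.symm (add_left_cancel (a := C + ej) (by
      rw [show C + ej + ek = C + ej + ek by abel, h]; abel))
  · intro h; exact njk (add_left_cancel h)
  · intro h; exact hi (add_right_cancel (b := ej) (by rw [h]; try abel))
  · intro h; exact hi (add_right_cancel (b := ek) (by rw [← h]; try abel))
  · intro h; exact njk.symm (add_left_cancel (a := C + ei) (by rw [h]))

lemma not_bad_of_lt {n d : ℕ} (hd : 2 ≤ d) {M N P : Fin n →₀ ℕ} (hP : P.degree = 2 * d)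
    (hlt : ∀ i, P i < d) (hbad : Bad d M N P) : False := by
  have hsupp : 2 < P.support.card := by
    by_contra hcon
    have h1 : P.degree ≤ P.support.card * (d - 1) := by
      rw [Finsupp.degree_apply, ← smul_eq_mul]
      apply Finset.sum_le_card_nsmul
      intro i _
      have := hlt i
      omega
    have h2 : P.support.card * (d - 1) ≤ 2 * (d - 1) := Nat.mul_le_mul_right _ (by omega)
    omega
  obtain ⟨i, hi, j, hj, k, hk, hij, hik, hjk⟩ := Finset.two_lt_card.1 hsupp
  rw [Finsupp.mem_support_iff] at hi hj hk
  set ei := Finsupp.single i 1 with hei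
  set ej := Finsupp.single j 1 with hej
  set ek := Finsupp.single k 1 with hek
  have hle : ei + ej + ek ≤ P := by
    intro a
    simp only [hei, hej, hek, Finsupp.add_apply, Finsupp.single_apply]
    split_ifs <;> first | omega | (subst_vars; omega) | (subst_vars; contradiction)
  obtain ⟨T, hT⟩ := le_iff_exists_add.1 hle
  have hTd : T.degree + 3 = 2 * d := by
    rw [← hP, hT]; simp [hei, hej, hek]; omega
  obtain ⟨B, C, hBC, hB⟩ := exists_sub T (d - 1) (by omega)
  have hCd : C.degree + 2 = d := by
    have := congrArg Finsupp.degree hBC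
    simp only [map_add] at this
    omega
  have hPe : B + C + ei + ej + ek = P := by rw [hT, ← hBC]; abel
  by_cases hex : ∃ s, (s = i ∨ s = j ∨ s = k) ∧ B = C + Finsupp.single s 1
  · obtain ⟨s, hs, hBs⟩ := hex
    have hPs : B s + C s + 1 ≤ P s := by
      rw [← hPe]
      simp only [hei, hej, hek, Finsupp.add_apply]
      rcases hs with rfl | rfl | rfl <;> simp <;> omega
    have hBs1 : B s = C s + 1 := by rw [hBs]; simp
    have hPs' := hlt s
    have hC0 : C ≠ 0 := by
      rintro rfl
      simp at hCd hBs1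
      omega
    obtain ⟨l, hl⟩ := Finsupp.ne_iff.1 hC0
    simp only [Finsupp.coe_zero, Pi.zero_apply] at hl
    have hl' : ∃ l', l' ≠ l ∧ B l' ≠ 0 := by
      by_contra hcon
      push Not at hcon
      have hsl : s = l := by
        by_contra hne
        have := hcon s hne
        omega
      subst hsl
      have hBeq : B = Finsupp.single s (B s) := by
        ext a
        by_cases h : s = a
        · subst h; simp
        · simp [Finsupp.single_apply, h, hcon a (Ne.symm h)]
      rw [hBeq, Finsupp.degree_single] at hB
      omega
    obtain ⟨l', hne, hl'⟩ := hl'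
    obtain ⟨B0, hB0⟩ := le_iff_exists_add.1
      (Finsupp.single_le_iff.2 (Nat.one_le_iff_ne_zero.2 hl') : Finsupp.single l' 1 ≤ B)
    obtain ⟨C0, hC0⟩ := le_iff_exists_add.1
      (Finsupp.single_le_iff.2 (Nat.one_le_iff_ne_zero.2 hl) : Finsupp.single l 1 ≤ C)
    have key : ∀ t, B0 + Finsupp.single l 1 ≠ C0 + Finsupp.single l' 1 + Finsupp.single t 1 := by
      intro t ht
      have h1 := DFunLike.congr_fun ht l
      have h2 := DFunLike.congr_fun hBs l
      rw [hB0, hC0] at h2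
      simp [Finsupp.single_apply, hne] at h1 h2
      split_ifs at h1 h2 <;> omega
    have hBd : B0.degree + 1 = B.degree := by rw [hB0]; simp; omega
    have hCd' : C0.degree + 1 = C.degree := by rw [hC0]; simp; omega
    exact bad_core (B := B0 + Finsupp.single l 1) (C := C0 + Finsupp.single l' 1) hbad hij hik hjk
      (by rw [← hPe, hB0, hC0]; abel) (by simp; omega) (by simp; omega) (key i) (key j) (key k)
  · push Not at hex
    exact bad_core hbad hij hik hjk hPe (by omega) hCd (hex i (by simp)) (hex j (by simp))
      (hex k (by simp))

lemma bad_form {n d : ℕ} (hd : 2 ≤ d) {M N P : Fin n →₀ ℕ}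
    (hMp : ∀ i, M ≠ Finsupp.single i d) (hNp : ∀ i, N ≠ Finsupp.single i d)
    (hP : P.degree = 2 * d) (hbad : Bad d M N P) :
    ∃ i, P = M + Finsupp.single i d ∨ P = N + Finsupp.single i d := by
  have : ∃ i, d ≤ P i := by
    by_contra hcon
    push Not at hcon
    exact not_bad_of_lt hd hP hcon hbad
  obtain ⟨i, hi⟩ := this
  obtain ⟨R, hR⟩ := le_iff_exists_add.1 (Finsupp.single_le_iff.2 hi : Finsupp.single i d ≤ P)
  have hRd : R.degree = d := by
    have := congrArg Finsupp.degree hR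
    simp at this
    omega
  refine ⟨i, ?_⟩
  rcases hbad _ R (by simp) hRd hR.symm with (h | h) | (h | h)
  · exact absurd h.symm (hMp i)
  · exact absurd h.symm (hNp i)
  · left; rw [hR, h, add_comm]
  · right; rw [hR, h, add_comm]

lemma swap {n d : ℕ} {M N : Fin n →₀ ℕ} (hM : M.degree = d) {i j : Fin n}
    (hbad : Bad d M N (M + Finsupp.single i d)) (hij : i ≠ j) (hj : 1 ≤ M j)
    (hi : M i + 2 ≤ d) :
    N = Finsupp.single i (d - 1) + Finsupp.single j 1 ∨
      N + Finsupp.single j 1 = M + Finsupp.single i 1 := by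
  obtain ⟨R, hR⟩ := le_iff_exists_add.1 (Finsupp.single_le_iff.2 hj : Finsupp.single j 1 ≤ M)
  have hRd : R.degree + 1 = d := by
    rw [← hM, hR]; simp; omega
  have hsd : Finsupp.single i d = Finsupp.single i (d - 1) + Finsupp.single i 1 := by
    rw [← Finsupp.single_add]; congr 1; omega
  rcases hbad (Finsupp.single i (d - 1) + Finsupp.single j 1) (R + Finsupp.single i 1)
    (by rw [map_add, Finsupp.degree_single, Finsupp.degree_single]; omega) (by simp; omega) (by rw [hsd, hR]; abel) with (h | h) | (h | h)
  · have := DFunLike.congr_fun h i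
    simp [Finsupp.single_apply, hij.symm] at this
    omega
  · left; exact h.symm
  · have h1 := DFunLike.congr_fun h i
    have h2 := DFunLike.congr_fun hR i
    simp [Finsupp.single_apply, hij.symm] at h1 h2
    omega
  · right; rw [← h, hR]; abel

open Classical in
/-- indices `i` such that `x_i^d * M` is bad -/
noncomputable def badIdx {n : ℕ} (d : ℕ) (M N : Fin n →₀ ℕ) : Finset (Fin n) :=
  Finset.univ.filter (fun i => Bad d M N (M + Finsupp.single i d))

lemma mem_badIdx {n d : ℕ} {M N : Fin n →₀ ℕ} {i : Fin n} :
    i ∈ badIdx d M N ↔ Bad d M N (M + Finsupp.single i d) := by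
  simp [badIdx]

lemma badIdx_le_two {n d : ℕ} (hd : 3 ≤ d) {M N : Fin n →₀ ℕ} (hM : M.degree = d)
    (hMp : ∀ i, M ≠ Finsupp.single i d) : (badIdx d M N).card ≤ 2 := by
  have claim : ∀ i ∈ badIdx d M N, 1 ≤ M i := by
    intro i hi
    rw [mem_badIdx] at hi
    by_contra h0
    obtain ⟨j, k, hjk, hj, hk⟩ := two_supp (by omega) hM hMp
    have hij : i ≠ j := by rintro rfl; omega
    have hik : i ≠ k := by rintro rfl; omega
    have sj := swap hM hi hij hj (by omega)
    have sk := swap hM hi hik hk (by omega)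
    rcases sj with sj | sj <;> rcases sk with sk | sk
    · have a1 := DFunLike.congr_fun sj j
      have a2 := DFunLike.congr_fun sk j
      simp [Finsupp.single_apply, hij, hjk.symm] at a1 a2
      omega
    · have a1 := DFunLike.congr_fun sj i
      have a2 := DFunLike.congr_fun sk i
      simp [Finsupp.single_apply, hij.symm, hik.symm] at a1 a2
      omega
    · have a1 := DFunLike.congr_fun sj i
      have a2 := DFunLike.congr_fun sk i
      simp [Finsupp.single_apply, hij.symm, hik.symm] at a1 a2
      omega
    · have a1 := DFunLike.congr_fun sj j
      have a2 := DFunLike.congr_fun sk j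
      simp [Finsupp.single_apply, hij, hjk.symm] at a1 a2
      omega
  by_contra hcon
  obtain ⟨i, hi, j, hj, k, hk, hij, hik, hjk⟩ := Finset.two_lt_card.1 (not_le.1 hcon)
  have ci := claim i hi
  have cj := claim j hj
  have ck := claim k hk
  rw [mem_badIdx] at hi hj hk
  have hdeg := deg3 M hij hik hjk
  have s1 := swap hM hi hij cj (by omega)
  have s2 := swap hM hj hij.symm ci (by omega)
  have s3 := swap hM hk hik.symm ci (by omega)
  have hNj : M j < N j := by
    rcases s2 with s | s
    · have a := DFunLike.congr_fun s j
      simp [Finsupp.single_apply, hij] at a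
      omega
    · have a := DFunLike.congr_fun s j
      simp [Finsupp.single_apply, hij] at a
      omega
  have hNk : M k < N k := by
    rcases s3 with s | s
    · have a := DFunLike.congr_fun s k
      simp [Finsupp.single_apply, hik] at a
      omega
    · have a := DFunLike.congr_fun s k
      simp [Finsupp.single_apply, hik] at a
      omega
  rcases s1 with s | s
  · have a := DFunLike.congr_fun s k
    simp [Finsupp.single_apply, hik, hjk] at a
    omega
  · have a := DFunLike.congr_fun s j
    simp [Finsupp.single_apply, hij] at a
    omega

lemma badIdx_le_three {n : ℕ} {M N : Fin n →₀ ℕ} (hM : M.degree = 2) (hN : N.degree = 2)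
    (hMp : ∀ i, M ≠ Finsupp.single i 2) : (badIdx 2 M N).card ≤ 3 := by
  have h1 : M.support.card ≤ 2 := by
    rw [← hM, Finsupp.degree_apply, Finset.card_eq_sum_ones]
    apply Finset.sum_le_sum
    intro i hi
    rw [Finsupp.mem_support_iff] at hi
    omega
  have h2 : (badIdx 2 M N \ M.support).card ≤ 1 := by
    rw [Finset.card_le_one]
    intro a ha b hb
    rw [Finset.mem_sdiff, mem_badIdx, Finsupp.mem_support_iff, not_not] at ha hb
    by_contra hab
    obtain ⟨j, k, hjk, hj, hk⟩ := two_supp (by omega) hM hMp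
    have haj : a ≠ j := by rintro rfl; omega
    have hak : a ≠ k := by rintro rfl; omega
    have hbj : b ≠ j := by rintro rfl; omega
    have hbk : b ≠ k := by rintro rfl; omega
    have sa := swap hM ha.1 haj hj (by omega)
    have sb := swap hM hb.1 hbj hj (by omega)
    have d1 := deg3 N hab haj hbj
    have d2 := deg3 N hab hak hbk
    have hNa : 1 ≤ N a := by
      rcases sa with s | s <;>
      · have x := DFunLike.congr_fun s a
        simp [Finsupp.single_apply, haj.symm] at x
        omega
    have hNb : 1 ≤ N b := by
      rcases sb with s | s <;>
      · have x := DFunLike.congr_fun s b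
        simp [Finsupp.single_apply, hbj.symm] at x
        omega
    rcases sa with s | s
    · have x := DFunLike.congr_fun s j
      simp [Finsupp.single_apply, haj] at x
      omega
    · have x := DFunLike.congr_fun s k
      simp [Finsupp.single_apply, hak, hjk] at x
      omega
  have h3 : (badIdx 2 M N).card ≤ (M.support ∪ (badIdx 2 M N \ M.support)).card := by
    apply Finset.card_le_card
    intro x hx
    by_cases h : x ∈ M.support
    · exact Finset.mem_union_left _ h
    · exact Finset.mem_union_right _ (Finset.mem_sdiff.2 ⟨hx, h⟩)
  have h4 := Finset.card_union_le M.support (badIdx 2 M N \ M.support)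
  omega

lemma bad_ncard {n d : ℕ} (hd : 2 ≤ d) {M N : Fin n →₀ ℕ}
    (hMp : ∀ i, M ≠ Finsupp.single i d) (hNp : ∀ i, N ≠ Finsupp.single i d) (S : Set (Fin n →₀ ℕ))
    (hS : ∀ P ∈ S, P.degree = 2 * d ∧ Bad d M N P) :
    S.ncard ≤ (badIdx d M N).card + (badIdx d N M).card := by
  classical
  have hsub : S ⊆ (((badIdx d M N).image (fun i => M + Finsupp.single i d) ∪
      (badIdx d N M).image (fun i => N + Finsupp.single i d) : Finset (Fin n →₀ ℕ)) :
      Set (Fin n →₀ ℕ)) := by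
    intro P hP
    obtain ⟨hPd, hb⟩ := hS P hP
    obtain ⟨i, rfl | rfl⟩ := bad_form hd hMp hNp hPd hb
    · simp only [Finset.coe_union, Finset.coe_image]
      left
      exact ⟨i, mem_badIdx.2 hb, rfl⟩
    · simp only [Finset.coe_union, Finset.coe_image]
      right
      exact ⟨i, mem_badIdx.2 hb.symm, rfl⟩
  have h1 := Set.ncard_le_ncard hsub (Finset.finite_toSet _)
  rw [Set.ncard_coe_finset] at h1
  refine h1.trans ((Finset.card_union_le _ _).trans ?_)
  exact Nat.add_le_add Finset.card_image_le Finset.card_image_le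


/-! ### Coordinate changes -/

/-- `linForm` as a linear map -/
noncomputable def lin (n : ℕ) : (Fin n → ℂ) →ₗ[ℂ] PolyR n :=
  Fintype.linearCombination ℂ (fun i => (X i : PolyR n))

lemma lin_eq (n : ℕ) (c : Fin n → ℂ) : linForm n c = lin n c := by
  simp [linForm, lin, Fintype.linearCombination_apply]

lemma lin_single {n : ℕ} (i : Fin n) : lin n (Pi.single i 1) = X i := by
  simp [lin]

lemma lin_form {n : ℕ} (c : Fin n → ℂ) : lin n c ∈ formSpace n 1 := by
  rw [lin, Fintype.linearCombination_apply]
  apply Submodule.sum_mem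
  intro i _
  apply Submodule.smul_mem
  exact isHomogeneous_X ℂ i

lemma lin_ext {n : ℕ} {f : PolyR n →ₐ[ℂ] PolyR n} {e : (Fin n → ℂ) →ₗ[ℂ] (Fin n → ℂ)}
    (h : ∀ i, f (X i) = lin n (e (Pi.single i 1))) (c : Fin n → ℂ) : f (lin n c) = lin n (e c) := by
  have : f.toLinearMap ∘ₗ lin n = lin n ∘ₗ e := by
    apply LinearMap.pi_ext'
    intro i
    ext
    simp [lin_single, h]
  exact LinearMap.congr_fun this c

lemma form_aeval {n d : ℕ} {f : PolyR n →ₐ[ℂ] PolyR n} (h : ∀ i, f (X i) ∈ formSpace n 1)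
    {p : PolyR n} (hp : p ∈ formSpace n d) : f p ∈ formSpace n d := by
  have hf : f = aeval (fun i => f (X i)) := by
    ext i; simp
  rw [hf]
  have := IsHomogeneous.aeval (φ := p) (m := d) (n := 1) hp (fun i => f (X i)) h
  rw [one_mul] at this
  exact this

/-- the substitution `X i ↦ lin (e e_i)` -/
noncomputable def subs {n : ℕ} (e : (Fin n → ℂ) →ₗ[ℂ] (Fin n → ℂ)) : PolyR n →ₐ[ℂ] PolyR n :=
  aeval (fun i => lin n (e (Pi.single i 1)))

lemma subs_X {n : ℕ} (e : (Fin n → ℂ) →ₗ[ℂ] (Fin n → ℂ)) (i : Fin n) :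
    subs e (X i) = lin n (e (Pi.single i 1)) := by simp [subs]

lemma subs_lin {n : ℕ} (e : (Fin n → ℂ) →ₗ[ℂ] (Fin n → ℂ)) (c) :
    subs e (lin n c) = lin n (e c) := lin_ext (subs_X e) c

/-- the coordinate change attached to a basis -/
noncomputable def coord {n : ℕ} (b : Basis (Fin n) ℂ (Fin n → ℂ)) : PolyR n ≃ₐ[ℂ] PolyR n :=
  AlgEquiv.ofAlgHom (subs (b.equivFun.symm : (Fin n → ℂ) →ₗ[ℂ] (Fin n → ℂ)))
    (subs (b.equivFun : (Fin n → ℂ) →ₗ[ℂ] (Fin n → ℂ)))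
    (by ext1 i
        rw [AlgHom.comp_apply, subs_X, subs_lin, AlgHom.id_apply, LinearEquiv.coe_coe,
          LinearEquiv.coe_coe, LinearEquiv.symm_apply_apply, lin_single])
    (by ext1 i
        rw [AlgHom.comp_apply, subs_X, subs_lin, AlgHom.id_apply, LinearEquiv.coe_coe,
          LinearEquiv.coe_coe, LinearEquiv.apply_symm_apply, lin_single])

lemma coord_lin {n : ℕ} (b : Basis (Fin n) ℂ (Fin n → ℂ)) (c) :
    coord b (lin n c) = lin n (b.equivFun.symm c) := subs_lin _ c

lemma coord_X {n : ℕ} (b : Basis (Fin n) ℂ (Fin n → ℂ)) (i) :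
    coord b (X i) = lin n (b i) := by
  rw [← lin_single, coord_lin]; simp

lemma coord_symm_lin {n : ℕ} (b : Basis (Fin n) ℂ (Fin n → ℂ)) (c) :
    (coord b).symm (lin n c) = lin n (b.equivFun c) := subs_lin _ c

lemma coord_form {n d : ℕ} (b : Basis (Fin n) ℂ (Fin n → ℂ)) {p : PolyR n} :
    coord b p ∈ formSpace n d ↔ p ∈ formSpace n d := by
  constructor
  · intro h
    have := form_aeval (f := (coord b).symm.toAlgHom) (d := d) (fun i => by
      have := coord_symm_lin b (Pi.single i 1)
      rw [lin_single] at this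
      change (coord b).symm (X i) ∈ _
      rw [this]
      exact lin_form _) h
    simpa using this
  · intro h
    refine form_aeval (f := (coord b).toAlgHom) (d := d) (fun i => ?_) h
    change coord b (X i) ∈ _
    rw [coord_X]
    exact lin_form _

/-- the subspace in new coordinates -/
noncomputable def pull {n : ℕ} (b : Basis (Fin n) ℂ (Fin n → ℂ)) (U : Submodule ℂ (PolyR n)) :
    Submodule ℂ (PolyR n) := U.comap (coord b).toLinearMap

lemma mem_pull {n : ℕ} {b : Basis (Fin n) ℂ (Fin n → ℂ)} {U : Submodule ℂ (PolyR n)} {p : PolyR n} :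
    p ∈ pull b U ↔ coord b p ∈ U := Iff.rfl

lemma pull_eq_map {n : ℕ} (b : Basis (Fin n) ℂ (Fin n → ℂ)) (U : Submodule ℂ (PolyR n)) :
    pull b U = U.map (coord b).symm.toLinearMap := by
  ext p
  rw [mem_pull, Submodule.mem_map]
  constructor
  · intro h; exact ⟨_, h, by simp⟩
  · rintro ⟨q, hq, rfl⟩; simpa using hq

lemma pull_le {n d : ℕ} (b : Basis (Fin n) ℂ (Fin n → ℂ)) {U : Submodule ℂ (PolyR n)}
    (h : U ≤ formSpace n d) : pull b U ≤ formSpace n d := by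
  intro p hp
  exact (coord_form b).1 (h hp)

lemma pull_finrank {n : ℕ} (b : Basis (Fin n) ℂ (Fin n → ℂ)) (U : Submodule ℂ (PolyR n)) :
    finrank ℂ (pull b U) = finrank ℂ U := by
  rw [pull_eq_map]
  exact LinearEquiv.finrank_map_eq (coord b).symm.toLinearEquiv U

lemma pull_vcodim {n : ℕ} (d : ℕ) (b : Basis (Fin n) ℂ (Fin n → ℂ)) (U : Submodule ℂ (PolyR n)) :
    vcodim n d (pull b U) = vcodim n d U := by
  rw [vcodim, vcodim, pull_finrank]

lemma pull_mul {n : ℕ} (b : Basis (Fin n) ℂ (Fin n → ℂ)) (U : Submodule ℂ (PolyR n)) :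
    pull b U * pull b U = pull b (U * U) := by
  rw [pull_eq_map, pull_eq_map]
  exact (Submodule.map_mul U U (coord b).symm.toAlgHom).symm

lemma pull_bpf {n : ℕ} (b : Basis (Fin n) ℂ (Fin n → ℂ)) {U : Submodule ℂ (PolyR n)}
    (h : IsBPF n U) : IsBPF n (pull b U) := by
  intro x hx
  have h3 : ∀ p, eval x ((coord b).symm p) = eval (fun i => eval x ((coord b).symm (X i))) p := by
    intro p
    have h3 : (aeval x : PolyR n →ₐ[ℂ] ℂ).comp (coord b).symm.toAlgHom =
        aeval (fun i => eval x ((coord b).symm (X i))) := by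
      ext i
      simp [aeval_eq_eval]
    exact DFunLike.congr_fun h3 p
  have h1 := h (fun i => eval x ((coord b).symm (X i))) (by
    intro p hp
    rw [← h3]
    exact hx ((coord b).symm p) (by rw [mem_pull]; simpa using hp))
  rw [h1] at h3
  ext i
  have h5 := h3 (coord b (X i))
  rw [coord_X, lin, Fintype.linearCombination_apply, map_sum, map_sum] at h5
  have h6 := h3 (coord b (X i))
  rw [AlgEquiv.symm_apply_apply, eval_X, coord_X, lin, Fintype.linearCombination_apply] at h6
  rw [h6]
  simp [smul_eval]

lemma exists_basis {k n : ℕ} (v : Fin k → (Fin n → ℂ)) (hv : LinearIndependent ℂ v) :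
    ∃ b : Basis (Fin n) ℂ (Fin n → ℂ), ∀ (i : Fin k) (j : Fin n), j.val = i.val → b j = v i := by
  classical
  let B := Basis.sumExtend hv
  have : Fintype (Fin k ⊕ Basis.sumExtendIndex hv) := FiniteDimensional.fintypeBasisIndex B
  have : Fintype (Basis.sumExtendIndex hv) := Fintype.ofInjective (Sum.inr : _ → Fin k ⊕ Basis.sumExtendIndex hv) Sum.inr_injective
  have hc : k + Fintype.card (Basis.sumExtendIndex hv) = n := by
    have := Module.finrank_eq_card_basis B
    rw [Module.finrank_fin_fun, Fintype.card_eq_nat_card, Nat.card_sum, Nat.card_fin,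
      Nat.card_eq_fintype_card] at this
    omega
  let E : (Fin k ⊕ Basis.sumExtendIndex hv) ≃ Fin n :=
    ((Equiv.sumCongr (Equiv.refl _) (Fintype.equivFin _)).trans finSumFinEquiv).trans (finCongr hc)
  refine ⟨B.reindex E, ?_⟩
  intro i j hij
  have : E (Sum.inl i) = j := by
    apply Fin.ext
    simp [E, hij]
  rw [← this]
  simp [B, Basis.sumExtend]
  rfl

/-! ### The radical of a subspace -/

lemma mem_of_monomials {n : ℕ} {V : Submodule ℂ (PolyR n)} {p : PolyR n}
    (h : ∀ m, coeff m p ≠ 0 → monomial m (1 : ℂ) ∈ V) : p ∈ V := by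
  rw [← support_sum_monomial_coeff p]
  apply Submodule.sum_mem
  intro m hm
  have := V.smul_mem (coeff m p) (h m (mem_support_iff.1 hm))
  rwa [smul_monomial, smul_eq_mul, mul_one] at this

/-- the linear forms `l` with `l A_{d-1} ⊆ V` -/
noncomputable def Rad {n : ℕ} (d : ℕ) (V : Submodule ℂ (PolyR n)) : Submodule ℂ (Fin n → ℂ) where
  carrier := {c | ∀ q ∈ formSpace n (d - 1), lin n c * q ∈ V}
  add_mem' := by
    intro a b ha hb q hq
    rw [map_add, add_mul]
    exact V.add_mem (ha q hq) (hb q hq)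
  zero_mem' := by
    intro q _
    simp
  smul_mem' := by
    intro c a ha q hq
    rw [map_smul, smul_mul_assoc]
    exact V.smul_mem _ (ha q hq)

lemma mem_Rad {n d : ℕ} {V : Submodule ℂ (PolyR n)} {c : Fin n → ℂ} :
    c ∈ Rad d V ↔ ∀ q ∈ formSpace n (d - 1), lin n c * q ∈ V := Iff.rfl

lemma X_mul_mem {n d : ℕ} {V : Submodule ℂ (PolyR n)} {b : Basis (Fin n) ℂ (Fin n → ℂ)} {i : Fin n}
    (h : b i ∈ Rad d V) {q : PolyR n} (hq : q ∈ formSpace n (d - 1)) : X i * q ∈ pull b V := by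
  rw [mem_pull, map_mul, coord_X]
  exact h _ ((coord_form b).2 hq)

lemma monomial_mem {n d : ℕ} {V : Submodule ℂ (PolyR n)} {i : Fin n}
    (h : ∀ q ∈ formSpace n (d - 1), X i * q ∈ V) {m : Fin n →₀ ℕ} (hm : m.degree = d)
    (hi : m i ≠ 0) : monomial m (1 : ℂ) ∈ V := by
  obtain ⟨m', rfl⟩ := le_iff_exists_add.1
    (Finsupp.single_le_iff.2 (Nat.one_le_iff_ne_zero.2 hi) : Finsupp.single i 1 ≤ m)
  have := h (monomial m' 1) (monomial_form (by simp at hm; omega) 1)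
  rwa [X, monomial_mul, one_mul] at this

/-- a basis whose first vectors lie in a given subspace of dimension at least `k` -/
lemma basis_first {n k : ℕ} (W : Submodule ℂ (Fin n → ℂ)) (hk : k ≤ finrank ℂ W) :
    ∃ b : Basis (Fin n) ℂ (Fin n → ℂ), ∀ j : Fin n, j.val < k → b j ∈ W := by
  let B := Module.finBasis ℂ W
  have h1 : LinearIndependent ℂ (fun i : Fin k => ((B (Fin.castLE hk i) : W) : Fin n → ℂ)) :=
    (B.linearIndependent.comp _ (Fin.castLE_injective hk)).map' W.subtype (by simp)
  obtain ⟨b, hb⟩ := exists_basis _ h1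
  refine ⟨b, fun j hj => ?_⟩
  rw [hb ⟨j, hj⟩ j rfl]
  exact Subtype.coe_prop _

lemma rad_le {n d : ℕ} (hn : 1 ≤ n) {U V : Submodule ℂ (PolyR n)}
    (hU : U ≤ formSpace n d) (hb : IsBPF n U) (hUV : U ≤ V) (hV : ¬ formSpace n d ≤ V) :
    finrank ℂ (Rad d V) + 2 ≤ n := by
  by_contra hcon
  obtain ⟨b, hbV⟩ := basis_first (k := n - 1) (Rad d V) (by omega)
  let l : Fin n := ⟨n - 1, by omega⟩
  have hlt : ∀ i : Fin n, i ≠ l → i.val < n - 1 := by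
    intro i hi
    have : i.val ≠ n - 1 := fun h => hi (Fin.ext h)
    omega
  have hmon : ∀ m : Fin n →₀ ℕ, m.degree = d → (∃ i, i ≠ l ∧ m i ≠ 0) →
      monomial m (1 : ℂ) ∈ pull b V := by
    rintro m hm ⟨i, hi, hmi⟩
    exact monomial_mem (fun q hq => X_mul_mem (hbV i (hlt i hi)) hq) hm hmi
  have hsing : ∀ m : Fin n →₀ ℕ, m.degree = d → (¬ ∃ i, i ≠ l ∧ m i ≠ 0) →
      m = Finsupp.single l d := by
    intro m hm h
    push Not at h
    have : m = Finsupp.single l (m l) := by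
      ext i
      by_cases hi : i = l
      · subst hi; simp
      · simp [Finsupp.single_apply, Ne.symm hi, h i hi]
    rw [this, Finsupp.degree_single] at hm
    rw [this, hm]
  have hbp := pull_bpf b hb
  have : ∃ u ∈ pull b U, eval (Pi.single l (1 : ℂ)) u ≠ 0 := by
    by_contra h
    push Not at h
    have := congrFun (hbp _ h) l
    simp at this
  obtain ⟨u, hu, hev⟩ := this
  have huf := pull_le b hU hu
  have hc : coeff (Finsupp.single l d) u ≠ 0 := by
    intro hc
    apply hev
    rw [eval_eq]
    apply Finset.sum_eq_zero
    intro m hm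
    rw [MvPolynomial.mem_support_iff] at hm
    have hmd := mem_form.1 huf m hm
    have : ∃ i, i ≠ l ∧ m i ≠ 0 := by
      by_contra h
      rw [hsing m hmd h] at hm
      exact hm hc
    obtain ⟨i, hi, hmi⟩ := this
    rw [Finset.prod_eq_zero (Finsupp.mem_support_iff.2 hmi), mul_zero]
    simp [hi, hmi]
  have hlast : monomial (Finsupp.single l d) (1 : ℂ) ∈ pull b V := by
    have h1 : u - monomial (Finsupp.single l d) (coeff (Finsupp.single l d) u) ∈ pull b V := by
      apply mem_of_monomials
      intro m hm
      rw [coeff_sub, coeff_monomial] at hm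
      split_ifs at hm with h
      · subst h; simp at hm
      · rw [sub_zero] at hm
        have hmd := mem_form.1 huf m hm
        apply hmon m hmd
        by_contra h'
        exact h (hsing m hmd h').symm
    have h2 : u ∈ pull b V := hUV hu
    have h3 := (pull b V).smul_mem (coeff (Finsupp.single l d) u)⁻¹ ((pull b V).sub_mem h2 h1)
    rwa [sub_sub_cancel, smul_monomial, smul_eq_mul, inv_mul_cancel₀ hc] at h3
  apply hV
  intro p hp
  have : (coord b).symm p ∈ pull b V := by
    apply mem_of_monomials
    intro m hm
    have hmd := mem_form.1 ((coord_form b (d := d)).1 (by simpa using hp)) m hm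
    by_cases h : ∃ i, i ≠ l ∧ m i ≠ 0
    · exact hmon m hmd h
    · rw [hsing m hmd h]; exact hlast
  rw [mem_pull] at this
  simpa using this

/-! ### Case A -/

/-- the asserted bounds -/
def Good (n d : ℕ) (U : Submodule ℂ (PolyR n)) : Prop :=
  (d = 2 → vcodim n (2 * d) (U * U) ≤ 6) ∧ (3 ≤ d → vcodim n (2 * d) (U * U) ≤ 4)

lemma good_pull {n d : ℕ} {b : Basis (Fin n) ℂ (Fin n → ℂ)} {U : Submodule ℂ (PolyR n)}
    (h : Good n d (pull b U)) : Good n d U := by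
  rw [Good, pull_mul, pull_vcodim] at h
  exact h

lemma good_of_pure {n d : ℕ} (hd : 2 ≤ d) {U : Submodule ℂ (PolyR n)} (hU : U ≤ formSpace n d)
    (hc : vcodim n d U = 2) (hp : ∀ i, Finsupp.single i d ∈ inn U) : Good n d U := by
  rw [vcodim_eq hU, Set.ncard_eq_two] at hc
  obtain ⟨M, N, hMN, hS⟩ := hc
  have hM : M ∈ Mon n d \ inn U := by rw [hS]; simp
  have hN : N ∈ Mon n d \ inn U := by rw [hS]; simp
  have hMp : ∀ i, M ≠ Finsupp.single i d := by
    rintro i rfl; exact hM.2 (hp i)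
  have hNp : ∀ i, N ≠ Finsupp.single i d := by
    rintro i rfl; exact hN.2 (hp i)
  have hin : ∀ Q : Fin n →₀ ℕ, Q.degree = d → ¬ (Q = M ∨ Q = N) → Q ∈ inn U := by
    intro Q hQ hne
    by_contra hcon
    have : Q ∈ Mon n d \ inn U := ⟨hQ, hcon⟩
    rw [hS] at this
    exact hne (by simpa using this)
  have hb := bad_ncard hd hMp hNp (Mon n (2 * d) \ inn (U * U)) (by
    rintro P ⟨hP, hPn⟩
    refine ⟨hP, ?_⟩
    intro Q R hQ hR hQR
    by_contra hcon
    rw [not_or] at hcon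
    apply hPn
    rw [← hQR]
    exact inn_add (hin Q hQ hcon.1) (hin R hR hcon.2))
  rw [← vcodim_eq (sq_le hU)] at hb
  constructor
  · intro h2
    subst h2
    have h1 := badIdx_le_three (N := N) hM.1 hN.1 hMp
    have h2 := badIdx_le_three (N := M) hN.1 hM.1 hNp
    omega
  · intro h3
    have h1 := badIdx_le_two (N := N) h3 hM.1 hMp
    have h2 := badIdx_le_two (N := M) h3 hN.1 hNp
    omega

lemma pure_inn {n d k : ℕ} {U : Submodule ℂ (PolyR n)} {i : Fin n} (hi : k ≤ i.val)
    {p : PolyR n} (hp : p ∈ U)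
    (h : ∀ m, coeff m (p - X i ^ d) ≠ 0 → ∃ j : Fin n, j.val < k ∧ m j ≠ 0) :
    Finsupp.single i d ∈ inn U := by
  classical
  have hX : ∀ m, coeff m (X i ^ d : PolyR n) = if Finsupp.single i d = m then 1 else 0 := by
    intro m; rw [coeff_X_pow]
  refine ⟨p, hp, ?_, ?_⟩
  · by_contra h0
    obtain ⟨j, hj, hne⟩ := h (Finsupp.single i d) (by
      rw [coeff_sub, h0, hX, if_pos rfl]; simp)
    apply hne
    rw [Finsupp.single_apply, if_neg]
    rintro rfl; omega
  · intro m hm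
    by_cases hmi : Finsupp.single i d = m
    · rw [hmi]
    · have hex := h m (by rw [coeff_sub, hX, if_neg hmi, sub_zero]; exact hm)
      apply le_of_lt
      have hne : (Finset.univ.filter (fun j : Fin n => m j ≠ 0)).Nonempty := by
        obtain ⟨j, hj, hne⟩ := hex
        exact ⟨j, by simp [hne]⟩
      obtain ⟨j0, hj0, hmin⟩ := Finset.exists_min_image _ (fun j => j) hne
      have hj0k : j0.val < k := by
        obtain ⟨j, hj, hne⟩ := hex
        have : j0 ≤ j := hmin j (by simp [hne])
        have : j0.val ≤ j.val := this
        omega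
      rw [Finsupp.Lex.lt_iff]
      refine ⟨j0, ?_, ?_⟩
      · intro j hj
        have h1 : m j = 0 := by
          by_contra hne
          exact absurd (hmin j (by simp [hne])) (not_le.2 hj)
        have h2 : (Finsupp.single i d : Fin n →₀ ℕ) j = 0 := by
          rw [Finsupp.single_apply, if_neg]
          rintro rfl
          have : i.val < j0.val := hj
          omega
        exact h2.trans h1.symm
      · have h2 : (Finsupp.single i d : Fin n →₀ ℕ) j0 = 0 := by
          rw [Finsupp.single_apply, if_neg]
          rintro rfl
          omega
        change (Finsupp.single i d : Fin n →₀ ℕ) j0 < m j0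
        rw [h2]
        simp at hj0
        omega

/-- `l A_{d-1}` -/
noncomputable def LA {n : ℕ} (d : ℕ) (c : Fin n → ℂ) : Submodule ℂ (PolyR n) :=
  (formSpace n (d - 1)).map (LinearMap.mulLeft ℂ (lin n c))

lemma mem_LA {n d : ℕ} {c : Fin n → ℂ} {p : PolyR n} :
    p ∈ LA d c ↔ ∃ q ∈ formSpace n (d - 1), lin n c * q = p := by
  simp [LA]

lemma LA_le {n d : ℕ} (hd : 1 ≤ d) (c : Fin n → ℂ) : LA d c ≤ formSpace n d := by
  intro p hp
  obtain ⟨q, hq, rfl⟩ := mem_LA.1 hp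
  have := form_mul (lin_form c) hq
  rwa [show 1 + (d - 1) = d by omega] at this

lemma coord_symm_LA {n d : ℕ} {b : Basis (Fin n) ℂ (Fin n → ℂ)} {i : Fin n} {p : PolyR n}
    (hp : p ∈ LA d (b i)) {m : Fin n →₀ ℕ} (hm : coeff m ((coord b).symm p) ≠ 0) : m i ≠ 0 := by
  classical
  obtain ⟨q, hq, rfl⟩ := mem_LA.1 hp
  rw [map_mul, ← coord_X, AlgEquiv.symm_apply_apply, coeff_X_mul'] at hm
  by_contra h
  apply hm
  rw [if_neg]
  simpa using h

lemma criterion {n d : ℕ} (hn : 2 ≤ n) (hd : 2 ≤ d) {U : Submodule ℂ (PolyR n)}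
    (hU : U ≤ formSpace n d) (hc : vcodim n d U = 2) {c1 c2 : Fin n → ℂ}
    (hli : LinearIndependent ℂ ![c1, c2]) (h1 : lin n c1 ^ d ∈ U) (h2 : lin n c2 ^ d ∈ U ⊔ LA d c1)
    (h3 : formSpace n d ≤ U ⊔ LA d c1 ⊔ LA d c2) : Good n d U := by
  obtain ⟨b, hb⟩ := exists_basis _ hli
  let i0 : Fin n := ⟨0, by omega⟩
  let i1 : Fin n := ⟨1, by omega⟩
  have hb0 : b i0 = c1 := hb 0 i0 rfl
  have hb1 : b i1 = c2 := hb 1 i1 rfl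
  apply good_pull (b := b)
  apply good_of_pure hd (pull_le b hU) (by rw [pull_vcodim, hc])
  intro i
  have hXi : X i ^ d = (coord b).symm (lin n (b i) ^ d) := by
    rw [← coord_X, ← map_pow, AlgEquiv.symm_apply_apply]
  by_cases hi0 : i = i0
  · apply pure_inn (k := 0) (p := X i ^ d) (by omega)
    · rw [mem_pull, map_pow, coord_X, hi0, hb0]; exact h1
    · intro m hm; simp at hm
  by_cases hi1 : i = i1
  · obtain ⟨u, hu, a, ha, hua⟩ := Submodule.mem_sup.1 h2
    apply pure_inn (k := 1) (p := (coord b).symm u)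
    · rw [hi1]
    · rw [mem_pull]; simpa using hu
    · intro m hm
      refine ⟨i0, by simp [i0], ?_⟩
      rw [hXi, hi1, hb1, ← hua, map_add, sub_add_cancel_left, coeff_neg, neg_ne_zero] at hm
      rw [← hb0] at ha
      exact coord_symm_LA ha hm
  · have hmem : lin n (b i) ^ d ∈ formSpace n d := by
      rw [← coord_X, ← map_pow, coord_form]
      have := isHomogeneous_X_pow (R := ℂ) i d
      exact this
    obtain ⟨u', hu', a2, ha2, hua2⟩ := Submodule.mem_sup.1 (h3 hmem)
    obtain ⟨u, hu, a, ha, hua⟩ := Submodule.mem_sup.1 hu'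
    have hi2 : 2 ≤ i.val := by
      have e0 : i.val ≠ 0 := fun h => hi0 (Fin.ext h)
      have e1 : i.val ≠ 1 := fun h => hi1 (Fin.ext h)
      omega
    apply pure_inn (k := 2) (p := (coord b).symm u) hi2
    · rw [mem_pull]; simpa using hu
    · intro m hm
      rw [hXi, ← hua2, ← hua, map_add, map_add, add_assoc, sub_add_cancel_left, coeff_neg,
        neg_ne_zero, coeff_add] at hm
      rw [← hb0] at ha
      rw [← hb1] at ha2
      by_cases hz : coeff m ((coord b).symm a) = 0
      · rw [hz, zero_add] at hm
        exact ⟨i1, by simp [i1], coord_symm_LA ha2 hm⟩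
      · exact ⟨i0, by simp [i0], coord_symm_LA ha hz⟩

lemma exists_functional {n d k : ℕ} {U : Submodule ℂ (PolyR n)} (hU : U ≤ formSpace n d)
    (hk : vcodim n d U = k) :
    ∃ F : PolyR n →ₗ[ℂ] (Fin k → ℂ), ∀ p ∈ formSpace n d, F p = 0 → p ∈ U := by
  have hfd := finite_form n d
  let U' := U.submoduleOf (formSpace n d)
  have h1 : finrank ℂ U' = finrank ℂ U := LinearEquiv.finrank_eq (Submodule.submoduleOfEquivOfLe hU)
  have h2 := Submodule.finrank_quotient_add_finrank U'
  have h3 : finrank ℂ ((formSpace n d) ⧸ U') = finrank ℂ (Fin k → ℂ) := by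
    rw [Module.finrank_fin_fun, ← hk, vcodim]; omega
  let e := LinearEquiv.ofFinrankEq _ _ h3
  obtain ⟨F, hF⟩ := LinearMap.exists_extend (e.toLinearMap ∘ₗ U'.mkQ)
  refine ⟨F, fun p hp h0 => ?_⟩
  have := LinearMap.congr_fun hF ⟨p, hp⟩
  simp only [LinearMap.comp_apply, Submodule.subtype_apply, h0] at this
  have h4 := this.symm
  rw [LinearEquiv.coe_coe, LinearEquiv.map_eq_zero_iff, Submodule.mkQ_apply,
    Submodule.Quotient.mk_eq_zero] at h4
  exact h4

lemma complement_family {n k : ℕ} (W : Submodule ℂ (Fin n → ℂ)) (hk : k + finrank ℂ W ≤ n) :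
    ∃ t : Fin k → (Fin n → ℂ), ∀ c : Fin k → ℂ, ∑ j, c j • t j ∈ W → c = 0 := by
  have h2 := Submodule.finrank_quotient_add_finrank W
  rw [Module.finrank_fin_fun] at h2
  let B := Module.finBasis ℂ ((Fin n → ℂ) ⧸ W)
  have hk' : k ≤ finrank ℂ ((Fin n → ℂ) ⧸ W) := by omega
  have hli := B.linearIndependent.comp _ (Fin.castLE_injective hk')
  choose t ht using fun j : Fin k => W.mkQ_surjective (B (Fin.castLE hk' j))
  refine ⟨t, fun c hc => ?_⟩
  have h0 : W.mkQ (∑ j, c j • t j) = 0 := by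
    rw [Submodule.mkQ_apply, Submodule.Quotient.mk_eq_zero]; exact hc
  rw [map_sum] at h0
  simp only [map_smul, ht] at h0
  funext j
  exact Fintype.linearIndependent_iff.1 hli c h0 j

/-- a linear form outside the radical whose power is in the subspace -/
lemma exists_form {n d k : ℕ} (hd : 1 ≤ d) {V : Submodule ℂ (PolyR n)} (hV : V ≤ formSpace n d)
    (hk : vcodim n d V = k) (hr : k + 1 + finrank ℂ (Rad d V) ≤ n) :
    ∃ c, c ∉ Rad d V ∧ lin n c ^ d ∈ V := by
  obtain ⟨F, hF⟩ := exists_functional hV hk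
  obtain ⟨t, ht⟩ := complement_family _ hr
  obtain ⟨c, hc0, hc⟩ := exists_pow_zero (Nat.lt_succ_self k) hd
    (fun i => LinearMap.proj i ∘ₗ F) (fun j => lin n (t j))
  refine ⟨∑ j, c j • t j, fun h => hc0 (ht c h), ?_⟩
  apply hF
  · have := (lin_form (∑ j, c j • t j) : IsHomogeneous _ _).pow d
    rw [one_mul] at this
    exact this
  · funext i
    rw [map_sum]
    simp only [map_smul]
    exact hc i

lemma LA_not_le {n d : ℕ} {V : Submodule ℂ (PolyR n)} {c : Fin n → ℂ} (h : c ∉ Rad d V) :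
    ¬ LA d c ≤ V := by
  intro hle
  apply h
  intro q hq
  exact hle (mem_LA.2 ⟨q, hq, rfl⟩)

lemma vcodim_sup_lt {n d : ℕ} (hd : 1 ≤ d) {V : Submodule ℂ (PolyR n)} (hV : V ≤ formSpace n d)
    {c : Fin n → ℂ} (h : c ∉ Rad d V) : vcodim n d (V ⊔ LA d c) < vcodim n d V := by
  have hfd := finite_form n d
  have hle : V ⊔ LA d c ≤ formSpace n d := sup_le hV (LA_le hd c)
  have := finite_sub hle
  have hlt : V < V ⊔ LA d c := by
    refine lt_of_le_of_ne le_sup_left ?_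
    intro he
    exact LA_not_le h (by rw [he]; exact le_sup_right)
  have h1 := Submodule.finrank_lt_finrank_of_lt hlt
  have h2 := Submodule.finrank_mono hle
  rw [vcodim, vcodim]
  omega

lemma eq_form_of_vcodim {n d : ℕ} {V : Submodule ℂ (PolyR n)} (hV : V ≤ formSpace n d)
    (h : vcodim n d V = 0) : V = formSpace n d := by
  have hfd := finite_form n d
  apply Submodule.eq_of_le_of_finrank_le hV
  rw [vcodim] at h
  omega

lemma caseA {n d : ℕ} (hd : 2 ≤ d) {U : Submodule ℂ (PolyR n)} (hU : U ≤ formSpace n d)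
    (hb : IsBPF n U) (hc : vcodim n d U = 2) (hr : 3 + finrank ℂ (Rad d U) ≤ n) : Good n d U := by
  obtain ⟨c1, hc1, hp1⟩ := exists_form (by omega) hU hc hr
  have hlt := vcodim_sup_lt (by omega) hU hc1
  have hWle : U ⊔ LA d c1 ≤ formSpace n d := sup_le hU (LA_le (by omega) c1)
  have hc10 : c1 ≠ 0 := by rintro rfl; exact hc1 (Submodule.zero_mem _)
  have hc1W : c1 ∈ Rad d (U ⊔ LA d c1) := by
    intro q hq
    exact Submodule.mem_sup_right (mem_LA.2 ⟨q, hq, rfl⟩)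
  obtain hv | hv : vcodim n d (U ⊔ LA d c1) = 0 ∨ vcodim n d (U ⊔ LA d c1) = 1 := by omega
  · have heq := eq_form_of_vcodim hWle hv
    have : ∃ c2, c2 ∉ Submodule.span ℂ {c1} := by
      by_contra hcon
      push Not at hcon
      have htop : Submodule.span ℂ {c1} = ⊤ := by
        rw [eq_top_iff]; intro x _; exact hcon x
      have h1 := finrank_span_singleton (K := ℂ) hc10
      rw [htop, finrank_top, Module.finrank_fin_fun] at h1
      omega
    obtain ⟨c2, hc2⟩ := this
    refine criterion (by omega) hd hU hc (c1 := c1) (c2 := c2) ?_ hp1 ?_ ?_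
    · rw [LinearIndependent.pair_iff' hc10]
      intro a ha
      exact hc2 (Submodule.mem_span_singleton.2 ⟨a, ha⟩)
    · rw [heq]
      have := (lin_form c2 : IsHomogeneous _ _).pow d
      rw [one_mul] at this
      exact this
    · rw [heq]; exact le_sup_left
  · have hB := rad_le (by omega) hU hb (le_sup_left : U ≤ U ⊔ LA d c1) (by
      intro hle
      have heq := le_antisymm hWle hle
      rw [heq, vcodim, Nat.sub_self] at hv
      omega)
    obtain ⟨c2, hc2, hp2⟩ := exists_form (by omega) hWle hv (by omega)
    have hlt2 := vcodim_sup_lt (by omega) hWle hc2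
    refine criterion (by omega) hd hU hc (c1 := c1) (c2 := c2) ?_ hp1 hp2 ?_
    · rw [LinearIndependent.pair_iff' hc10]
      intro a ha
      apply hc2
      rw [← ha]
      exact Submodule.smul_mem _ _ hc1W
    · rw [eq_form_of_vcodim (sup_le hWle (LA_le (by omega) c2)) (by omega)]

/-! ### Case B -/

/-- dehomogenization -/
noncomputable def rho {n : ℕ} (y z : Fin n) : PolyR n →ₐ[ℂ] Polynomial ℂ :=
  aeval (fun i => if i = y then Polynomial.X else if i = z then 1 else 0)

/-- binary monomial exponents -/
noncomputable def bin {n : ℕ} (y z : Fin n) (k j : ℕ) : Fin n →₀ ℕ :=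
  Finsupp.single y j + Finsupp.single z (k - j)

lemma bin_degree {n : ℕ} (y z : Fin n) {k j : ℕ} (h : j ≤ k) : (bin y z k j).degree = k := by
  rw [bin, map_add, Finsupp.degree_single, Finsupp.degree_single]; omega

lemma bin_y {n : ℕ} {y z : Fin n} (hyz : y ≠ z) (k j : ℕ) : bin y z k j y = j := by
  rw [bin, Finsupp.add_apply, Finsupp.single_apply, Finsupp.single_apply, if_pos rfl,
    if_neg hyz.symm, add_zero]

lemma bin_other {n : ℕ} {y z : Fin n} (k j : ℕ) {i : Fin n} (hy : i ≠ y) (hz : i ≠ z) :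
    bin y z k j i = 0 := by
  rw [bin, Finsupp.add_apply, Finsupp.single_apply, Finsupp.single_apply, if_neg hy.symm,
    if_neg hz.symm, add_zero]

lemma bin_add {n : ℕ} (y z : Fin n) {k j j' : ℕ} (h : j ≤ k) (h' : j' ≤ k) :
    bin y z k j + bin y z k j' = bin y z (2 * k) (j + j') := by
  rw [bin, bin, bin, show 2 * k - (j + j') = (k - j) + (k - j') by omega, Finsupp.single_add,
    Finsupp.single_add]
  abel

lemma eq_bin {n k : ℕ} {y z : Fin n} (hyz : y ≠ z) {m : Fin n →₀ ℕ} (hm : m.degree = k)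
    (h : ¬ ∃ i, i ≠ y ∧ i ≠ z ∧ m i ≠ 0) : m y ≤ k ∧ m = bin y z k (m y) := by
  push Not at h
  have h1 : m = Finsupp.single y (m y) + Finsupp.single z (m z) := by
    ext i
    rw [Finsupp.add_apply, Finsupp.single_apply, Finsupp.single_apply]
    by_cases hy : y = i
    · subst hy; simp [hyz.symm]
    by_cases hz : z = i
    · subst hz; simp [hyz]
    · simp [hy, hz, h i (Ne.symm hy) (Ne.symm hz)]
  have h2 : m y + m z = k := by
    rw [← hm]
    conv_rhs => rw [h1]
    rw [map_add, Finsupp.degree_single, Finsupp.degree_single]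
  refine ⟨by omega, ?_⟩
  rw [bin, show k - m y = m z by omega]
  exact h1

lemma rho_y {n : ℕ} (y z : Fin n) : rho y z (X y) = Polynomial.X := by simp [rho]

lemma rho_z {n : ℕ} {y z : Fin n} (hyz : y ≠ z) : rho y z (X z) = 1 := by
  simp [rho, hyz.symm]

lemma rho_i {n : ℕ} {y z i : Fin n} (hy : i ≠ y) (hz : i ≠ z) : rho y z (X i) = 0 := by
  simp [rho, hy, hz]

lemma monomial_bin {n : ℕ} (y z : Fin n) (k j : ℕ) :
    monomial (bin y z k j) (1 : ℂ) = X y ^ j * X z ^ (k - j) := by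
  rw [bin, X_pow_eq_monomial, X_pow_eq_monomial, monomial_mul, one_mul]

lemma rho_bin {n : ℕ} {y z : Fin n} (hyz : y ≠ z) (k j : ℕ) :
    rho y z (monomial (bin y z k j) (1 : ℂ)) = Polynomial.X ^ j := by
  rw [monomial_bin, map_mul, map_pow, map_pow, rho_y, rho_z hyz, one_pow, mul_one]

lemma rho_other {n : ℕ} {y z i : Fin n} (hy : i ≠ y) (hz : i ≠ z) {m : Fin n →₀ ℕ} (h : m i ≠ 0) :
    rho y z (monomial m (1 : ℂ)) = 0 := by
  obtain ⟨m', rfl⟩ := le_iff_exists_add.1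
    (Finsupp.single_le_iff.2 (Nat.one_le_iff_ne_zero.2 h) : Finsupp.single i 1 ≤ m)
  have : monomial (Finsupp.single i 1 + m') (1 : ℂ) = X i * monomial m' 1 := by
    rw [X, monomial_mul, one_mul]
  rw [this, map_mul, rho_i hy hz, zero_mul]

lemma rho_form {n k : ℕ} {y z : Fin n} (hyz : y ≠ z) {p : PolyR n} (hp : p ∈ formSpace n k) :
    rho y z p = ∑ j ∈ Finset.range (k + 1), coeff (bin y z k j) p • Polynomial.X ^ j := by
  let L : PolyR n →ₗ[ℂ] Polynomial ℂ := ∑ j ∈ Finset.range (k + 1),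
    (LinearMap.toSpanSingleton ℂ (Polynomial ℂ) (Polynomial.X ^ j)) ∘ₗ lcoeff ℂ (bin y z k j)
  have hL : ∀ q, L q = ∑ j ∈ Finset.range (k + 1), coeff (bin y z k j) q • Polynomial.X ^ j := by
    intro q
    simp [L, LinearMap.sum_apply, lcoeff]
  rw [← hL]
  have : p ∈ LinearMap.eqLocus (rho y z).toLinearMap L := by
    apply mem_of_monomials
    intro m hm
    have hmd := mem_form.1 hp m hm
    rw [LinearMap.mem_eqLocus, hL, AlgHom.toLinearMap_apply]
    by_cases h : ∃ i, i ≠ y ∧ i ≠ z ∧ m i ≠ 0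
    · obtain ⟨i, hy, hz, hi⟩ := h
      rw [rho_other hy hz hi]
      symm
      apply Finset.sum_eq_zero
      intro j _
      rw [coeff_monomial, if_neg, zero_smul]
      rintro rfl
      exact hi (bin_other k j hy hz)
    · obtain ⟨hle, hmb⟩ := eq_bin hyz hmd h
      rw [Finset.sum_eq_single (m y)]
      · rw [← hmb, coeff_monomial, if_pos rfl, one_smul]
        conv_lhs => rw [hmb]
        rw [rho_bin hyz]
      · intro j _ hj
        rw [coeff_monomial, if_neg, zero_smul]
        intro h
        apply hj
        rw [h, bin_y hyz]
      · intro hn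
        exact absurd (Finset.mem_range.2 (by omega)) hn
  exact this

lemma rho_coeff {n k : ℕ} {y z : Fin n} (hyz : y ≠ z) {p : PolyR n} (hp : p ∈ formSpace n k)
    {j : ℕ} (hj : j ≤ k) : (rho y z p).coeff j = coeff (bin y z k j) p := by
  rw [rho_form hyz hp, Polynomial.finsetSum_coeff, Finset.sum_eq_single j]
  · simp
  · intro i _ hij
    simp [Polynomial.coeff_X_pow, hij.symm]
  · intro hn
    exact absurd (Finset.mem_range.2 (by omega)) hn

lemma rho_natDegree {n k : ℕ} {y z : Fin n} (hyz : y ≠ z) {p : PolyR n} (hp : p ∈ formSpace n k) :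
    (rho y z p).natDegree ≤ k := by
  rw [rho_form hyz hp]
  apply Polynomial.natDegree_sum_le_of_forall_le
  intro j hj
  rw [Finset.mem_range] at hj
  refine (Polynomial.natDegree_smul_le _ _).trans ?_
  rw [Polynomial.natDegree_X_pow]
  omega

/-- homogenization -/
noncomputable def hom {n : ℕ} (y z : Fin n) (k : ℕ) (P : Polynomial ℂ) : PolyR n :=
  ∑ j ∈ Finset.range (k + 1), P.coeff j • monomial (bin y z k j) (1 : ℂ)

lemma hom_form {n : ℕ} (y z : Fin n) (k : ℕ) (P : Polynomial ℂ) : hom y z k P ∈ formSpace n k := by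
  apply Submodule.sum_mem
  intro j hj
  rw [Finset.mem_range] at hj
  exact Submodule.smul_mem _ _ (monomial_form (bin_degree y z (by omega)) 1)

lemma rho_hom {n : ℕ} {y z : Fin n} (hyz : y ≠ z) {k : ℕ} {P : Polynomial ℂ}
    (hP : P.natDegree ≤ k) : rho y z (hom y z k P) = P := by
  rw [hom, map_sum]
  simp only [map_smul, rho_bin hyz]
  conv_rhs => rw [P.as_sum_range' (k + 1) (by omega)]
  apply Finset.sum_congr rfl
  intro j _
  rw [← Polynomial.smul_X_eq_monomial]

lemma eval_rho {n : ℕ} (y z : Fin n) (t : ℂ) (p : PolyR n) :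
    (rho y z p).eval t = eval (fun i => if i = y then t else if i = z then 1 else 0) p := by
  have : (Polynomial.aeval t).comp (rho y z) =
      (aeval (fun i => if i = y then t else if i = z then 1 else 0) : PolyR n →ₐ[ℂ] ℂ) := by
    ext i
    simp only [AlgHom.comp_apply, rho, aeval_X]
    split_ifs <;> simp
  have h := DFunLike.congr_fun this p
  rw [AlgHom.comp_apply, Polynomial.coe_aeval_eq_eval] at h
  exact h

lemma coeff_pure {n d : ℕ} {l : Fin n} {u : PolyR n} (hu : u ∈ formSpace n d)
    (hev : eval (Pi.single l (1 : ℂ)) u ≠ 0) : coeff (Finsupp.single l d) u ≠ 0 := by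
  intro hc
  apply hev
  rw [eval_eq]
  apply Finset.sum_eq_zero
  intro m hm
  rw [MvPolynomial.mem_support_iff] at hm
  have hmd := mem_form.1 hu m hm
  have : ∃ i, i ≠ l ∧ m i ≠ 0 := by
    by_contra h
    push Not at h
    have h1 : m = Finsupp.single l (m l) := by
      ext i
      by_cases hi : i = l
      · subst hi; simp
      · rw [Finsupp.single_apply, if_neg (Ne.symm hi), h i hi]
    rw [h1, Finsupp.degree_single] at hmd
    rw [h1, hmd] at hm
    exact hm hc
  obtain ⟨i, hi, hmi⟩ := this
  rw [Finset.prod_eq_zero (Finsupp.mem_support_iff.2 hmi), mul_zero]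
  simp [hi, hmi]

lemma exists_coprime {n d : ℕ} {y z : Fin n} (hyz : y ≠ z) {U : Submodule ℂ (PolyR n)}
    (hU : U ≤ formSpace n d) (hb : IsBPF n U) :
    ∃ p ∈ U, ∃ q ∈ U, (rho y z p).natDegree = d ∧ rho y z p ≠ 0 ∧
      IsCoprime (rho y z p) (rho y z q) := by
  have h1 : ∃ u ∈ U, eval (Pi.single y (1 : ℂ)) u ≠ 0 := by
    by_contra h
    push Not at h
    have := congrFun (hb _ h) y
    simp at this
  obtain ⟨p, hp, hev⟩ := h1
  have hc := coeff_pure (hU hp) hev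
  have hc' : (rho y z p).coeff d ≠ 0 := by
    rw [rho_coeff hyz (hU hp) le_rfl, bin, Nat.sub_self, Finsupp.single_zero, add_zero]
    exact hc
  have hp0 : rho y z p ≠ 0 := by
    intro h; rw [h] at hc'; simp at hc'
  have hdeg : (rho y z p).natDegree = d :=
    le_antisymm (rho_natDegree hyz (hU hp)) (Polynomial.le_natDegree_of_ne_zero hc')
  let S : (rho y z p).roots.toFinset → Submodule ℂ U := fun t =>
    LinearMap.ker ((Polynomial.leval t.1) ∘ₗ (rho y z).toLinearMap ∘ₗ U.subtype)
  have hS : (⋃ i, (S i : Set U)) ≠ Set.univ := by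
    intro h
    obtain ⟨t, ht⟩ := Subspace.exists_eq_top_of_iUnion_eq_univ h
    have h0 := hb (fun i => if i = y then t.1 else if i = z then 1 else 0) (by
      intro q hq
      rw [← eval_rho]
      have : (⟨q, hq⟩ : U) ∈ S t := by rw [ht]; trivial
      exact this)
    have := congrFun h0 z
    simp [hyz.symm] at this
  rw [Ne, Set.eq_univ_iff_forall] at hS
  push Not at hS
  obtain ⟨⟨q, hq⟩, hqS⟩ := hS
  refine ⟨p, hp, q, hq, hdeg, hp0, ?_⟩
  rw [Polynomial.isCoprime_iff_aeval_ne_zero_of_isAlgClosed ℂ ℂ]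
  intro t
  by_contra hcon
  push Not at hcon
  rw [Polynomial.coe_aeval_eq_eval] at hcon
  apply hqS
  rw [Set.mem_iUnion]
  refine ⟨⟨t, ?_⟩, ?_⟩
  · rw [Multiset.mem_toFinset, Polynomial.mem_roots hp0]
    exact hcon.1
  · exact hcon.2

lemma form_le_mul {n d : ℕ} (hd : 2 ≤ d) {y z : Fin n} (hyz : y ≠ z) {U : Submodule ℂ (PolyR n)}
    (hU : U ≤ formSpace n d) (hb : IsBPF n U)
    (hX : ∀ i, i ≠ y → i ≠ z → ∀ q ∈ formSpace n (d - 1), X i * q ∈ U) :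
    formSpace n (2 * d - 1) ≤ U * formSpace n (d - 1) := by
  have hR : ∀ m : Fin n →₀ ℕ, m.degree = 2 * d - 1 → (∃ i, i ≠ y ∧ i ≠ z ∧ m i ≠ 0) →
      monomial m (1 : ℂ) ∈ U * formSpace n (d - 1) := by
    rintro m hm ⟨i, hy, hz, hi⟩
    obtain ⟨m', rfl⟩ := le_iff_exists_add.1
      (Finsupp.single_le_iff.2 (Nat.one_le_iff_ne_zero.2 hi) : Finsupp.single i 1 ≤ m)
    have hm' : m'.degree = 2 * d - 2 := by
      rw [map_add, Finsupp.degree_single] at hm; omega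
    obtain ⟨Q, C, hQC, hQ⟩ := exists_sub m' (d - 1) (by omega)
    have hC : C.degree = d - 1 := by
      rw [← hQC, map_add] at hm'; omega
    have : monomial (Finsupp.single i 1 + m') (1 : ℂ) = (X i * monomial Q 1) * monomial C 1 := by
      rw [X, monomial_mul, monomial_mul, one_mul, one_mul, ← hQC, add_assoc]
    rw [this]
    exact Submodule.mul_mem_mul (hX i hy hz _ (monomial_form hQ 1)) (monomial_form hC 1)
  obtain ⟨p, hp, q, hq, hdeg, hp0, a, b, hab⟩ := exists_coprime hyz hU hb
  intro m hm
  set P := rho y z p with hPdef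
  set Q := rho y z q with hQdef
  set R := rho y z m with hRdef
  set b' := (b * R) % P with hb'
  set a' := a * R + (b * R) / P * Q with ha'
  have hsum : a' * P + b' * Q = R := by
    have h1 : P * (b * R / P) + b * R % P = b * R := EuclideanDomain.div_add_mod (b * R) P
    have h2 : a' * P + b' * Q = (a * P) * R + (P * (b * R / P) + b * R % P) * Q := by
      rw [ha', hb']; ring
    rw [h2, h1]
    linear_combination R * hab
  have hb'd : b'.natDegree ≤ d - 1 := by
    by_cases h0 : b' = 0
    · rw [h0]; simp
    · have h1 : b'.degree < P.degree := Polynomial.degree_mod_lt _ hp0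
      have := Polynomial.natDegree_lt_natDegree h0 h1
      omega
  have hQd : Q.natDegree ≤ d := rho_natDegree hyz (hU hq)
  have hRd : R.natDegree ≤ 2 * d - 1 := rho_natDegree hyz hm
  have ha'd : a'.natDegree ≤ d - 1 := by
    by_cases h0 : a' = 0
    · rw [h0]; simp
    · have h1 : a' * P = R - b' * Q := by rw [← hsum]; ring
      have h2 : (a' * P).natDegree ≤ 2 * d - 1 := by
        rw [h1]
        refine (Polynomial.natDegree_sub_le _ _).trans (max_le hRd ?_)
        refine Polynomial.natDegree_mul_le.trans ?_
        omega
      rw [Polynomial.natDegree_mul h0 hp0] at h2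
      omega
  set A := hom y z (d - 1) a' with hA
  set B := hom y z (d - 1) b' with hB
  have hmem : p * A + q * B ∈ U * formSpace n (d - 1) :=
    Submodule.add_mem _ (Submodule.mul_mem_mul hp (hom_form y z _ _))
      (Submodule.mul_mem_mul hq (hom_form y z _ _))
  have hform : m - (p * A + q * B) ∈ formSpace n (2 * d - 1) := by
    have e : d + (d - 1) = 2 * d - 1 := by omega
    apply Submodule.sub_mem _ hm
    rw [← e]
    exact Submodule.add_mem _ (form_mul (hU hp) (hom_form y z _ _))
      (form_mul (hU hq) (hom_form y z _ _))
  have hzero : rho y z (m - (p * A + q * B)) = 0 := by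
    rw [map_sub, map_add, map_mul, map_mul, hA, hB, rho_hom hyz ha'd, rho_hom hyz hb'd,
      ← hPdef, ← hQdef, ← hRdef, ← hsum]
    ring
  have hrest : m - (p * A + q * B) ∈ U * formSpace n (d - 1) := by
    apply mem_of_monomials
    intro e he
    have hed := mem_form.1 hform e he
    apply hR e hed
    by_contra hcon
    obtain ⟨hle, heb⟩ := eq_bin hyz hed hcon
    apply he
    rw [heb, ← rho_coeff hyz hform hle, hzero, Polynomial.coeff_zero]
  have := Submodule.add_mem _ hrest hmem
  rwa [sub_add_cancel] at this

open scoped Pointwise in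
lemma caseB_core {n d : ℕ} (hd : 2 ≤ d) {y z : Fin n} (hyz : y ≠ z) {U : Submodule ℂ (PolyR n)}
    (hU : U ≤ formSpace n d) (hb : IsBPF n U) (hc : vcodim n d U = 2)
    (hX : ∀ i, i ≠ y → i ≠ z → ∀ q ∈ formSpace n (d - 1), X i * q ∈ U) :
    vcodim n (2 * d) (U * U) ≤ 4 := by
  classical
  have hfl := form_le_mul hd hyz hU hb hX
  have hR : ∀ m : Fin n →₀ ℕ, m.degree = 2 * d → (∃ i, i ≠ y ∧ i ≠ z ∧ m i ≠ 0) →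
      m ∈ inn (U * U) := by
    rintro m hm ⟨i, hy, hz, hi⟩
    apply inn_of_monomial
    refine monomial_mem (d := 2 * d) (i := i) ?_ hm hi
    intro q hq
    have : U * formSpace n (d - 1) ≤ (U * U).comap (LinearMap.mulLeft ℂ (X i)) := by
      rw [Submodule.mul_le]
      intro u hu r hr
      rw [Submodule.mem_comap, LinearMap.mulLeft_apply]
      have e : X i * (u * r) = u * (X i * r) := by ring
      rw [e]
      exact Submodule.mul_mem_mul hu (hX i hy hz r hr)
    exact this (hfl hq)
  obtain ⟨I, hIdef⟩ : ∃ I : Finset ℕ,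
    I = (Finset.range (d + 1)).filter (fun j => bin y z d j ∈ inn U) := ⟨_, rfl⟩
  have memI : ∀ j, j ∈ I ↔ j ∈ Finset.range (d + 1) ∧ bin y z d j ∈ inn U := by
    intro j; rw [hIdef, Finset.mem_filter]
  have hinj : ∀ k, Function.Injective (bin y z k) := by
    intro k a b hab
    have := DFunLike.congr_fun hab y
    rwa [bin_y hyz, bin_y hyz] at this
  have hI : d + 1 ≤ I.card + 2 := by
    have h1 : ((Finset.range (d + 1) \ I).image (bin y z d) : Finset _).card ≤ 2 := by
      rw [← hc, vcodim_eq hU, ← Set.ncard_coe_finset]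
      apply Set.ncard_le_ncard _ ((finite_Mon n d).subset Set.sdiff_subset)
      intro m hm
      rw [Finset.mem_coe, Finset.mem_image] at hm
      obtain ⟨j, hj, rfl⟩ := hm
      rw [Finset.mem_sdiff, Finset.mem_range] at hj
      refine ⟨bin_degree y z (by omega), fun h => hj.2 ?_⟩
      exact (memI j).2 ⟨Finset.mem_range.2 hj.1, h⟩
    rw [Finset.card_image_of_injective _ (hinj d),
      Finset.card_sdiff_of_subset (fun j hj => ((memI j).1 hj).1), Finset.card_range] at h1
    omega
  have hne : I.Nonempty := by
    rw [← Finset.card_pos]; omega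
  have hCD := cauchy_davenport_add_of_linearOrder_isCancelAdd hne hne
  have hsub : I + I ⊆ Finset.range (2 * d + 1) := by
    intro j hj
    obtain ⟨a, ha, b, hb, rfl⟩ := Finset.mem_add.1 hj
    have h1 := Finset.mem_range.1 ((memI _).1 ha).1
    have h2 := Finset.mem_range.1 ((memI _).1 hb).1
    rw [Finset.mem_range]; omega
  have hfin : Mon n (2 * d) \ inn (U * U) ⊆
      ((Finset.range (2 * d + 1) \ (I + I)).image (bin y z (2 * d)) : Finset _) := by
    rintro m ⟨hm, hmn⟩
    obtain ⟨hle, hmb⟩ := eq_bin hyz hm (fun h => hmn (hR m hm h))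
    rw [Finset.mem_coe, Finset.mem_image]
    refine ⟨m y, ?_, hmb.symm⟩
    rw [Finset.mem_sdiff, Finset.mem_range]
    refine ⟨by omega, fun h => hmn ?_⟩
    obtain ⟨a, ha, b, hb, hab⟩ := Finset.mem_add.1 h
    obtain ⟨h1, h1'⟩ := (memI _).1 ha
    obtain ⟨h2, h2'⟩ := (memI _).1 hb
    rw [Finset.mem_range] at h1 h2
    rw [hmb, ← hab, ← bin_add y z (by omega) (by omega)]
    exact inn_add h1' h2'
  have := Set.ncard_le_ncard hfin (Finset.finite_toSet _)
  rw [← vcodim_eq (sq_le hU), Set.ncard_coe_finset, Finset.card_image_of_injective _ (hinj _),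
    Finset.card_sdiff_of_subset hsub, Finset.card_range] at this
  omega

lemma caseB {n d : ℕ} (hn : 2 ≤ n) (hd : 2 ≤ d) {U : Submodule ℂ (PolyR n)}
    (hU : U ≤ formSpace n d) (hb : IsBPF n U) (hc : vcodim n d U = 2)
    (hr : n ≤ finrank ℂ (Rad d U) + 2) : Good n d U := by
  obtain ⟨b, hbR⟩ := basis_first (k := n - 2) (Rad d U) (by omega)
  apply good_pull (b := b)
  have := caseB_core (y := ⟨n - 2, by omega⟩) (z := ⟨n - 1, by omega⟩) hd
    (by intro h; have := congrArg Fin.val h; simp at this; omega) (pull_le b hU) (pull_bpf b hb)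
    (by rw [pull_vcodim, hc]) (by
      intro i hy hz q hq
      apply X_mul_mem (hbR i _) hq
      have e0 : i.val ≠ n - 2 := fun h => hy (Fin.ext h)
      have e1 : i.val ≠ n - 1 := fun h => hz (Fin.ext h)
      omega)
  exact ⟨fun _ => by omega, fun _ => this⟩

lemma main_bound {n d : ℕ} (hn : 2 ≤ n) (hd : 2 ≤ d) {U : Submodule ℂ (PolyR n)}
    (hU : U ≤ formSpace n d) (hb : IsBPF n U) (hc : vcodim n d U = 2) : Good n d U := by
  by_cases h : 3 + finrank ℂ (Rad d U) ≤ n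
  · exact caseA hd hU hb hc h
  · exact caseB hn hd hU hb hc (by omega)

/-! ### Examples -/

/-- monomial with given exponents -/
noncomputable def mono {n : ℕ} (f : Fin n → ℕ) : PolyR n :=
  monomial (Finsupp.equivFunOnFinite.symm f) 1

/-- span of monomials -/
noncomputable def MS {n : ℕ} (s : Finset (Fin n → ℕ)) : Submodule ℂ (PolyR n) :=
  Submodule.span ℂ (mono '' (s : Set (Fin n → ℕ)))

lemma mono_add {n : ℕ} (f g : Fin n → ℕ) : mono (f + g) = mono f * mono g := by
  rw [mono, mono, mono, monomial_mul, one_mul]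
  have he : Finsupp.equivFunOnFinite.symm (f + g) =
      Finsupp.equivFunOnFinite.symm f + Finsupp.equivFunOnFinite.symm g := by
    ext i
    simp
  rw [he]

lemma mono_form {n d : ℕ} {f : Fin n → ℕ} (h : ∑ i, f i = d) : mono f ∈ formSpace n d := by
  apply monomial_form
  rw [Finsupp.degree_eq_sum]
  simpa using h

lemma MS_form {n d : ℕ} {s : Finset (Fin n → ℕ)} (h : ∀ f ∈ s, ∑ i, f i = d) :
    MS s ≤ formSpace n d := by
  rw [MS, Submodule.span_le]
  rintro _ ⟨f, hf, rfl⟩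
  exact mono_form (h f hf)

lemma mono_li (n : ℕ) : LinearIndependent ℂ (mono : (Fin n → ℕ) → PolyR n) := by
  have h := (basisMonomials (Fin n) ℂ).linearIndependent.comp
    (Finsupp.equivFunOnFinite.symm : (Fin n → ℕ) → _) (Equiv.injective _)
  have he : (mono : (Fin n → ℕ) → PolyR n) =
      (basisMonomials (Fin n) ℂ) ∘ (Finsupp.equivFunOnFinite.symm : (Fin n → ℕ) → _) := by
    funext f
    simp [mono]
  rw [he]
  exact h

lemma MS_finrank {n : ℕ} (s : Finset (Fin n → ℕ)) : finrank ℂ (MS s) = s.card := by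
  have h := (mono_li n).comp (fun x : s => x.1) Subtype.val_injective
  have h2 := finrank_span_eq_card h
  rw [Fintype.card_coe] at h2
  rw [← h2, MS]
  have he : Set.range (mono ∘ fun x : s => x.1) = (mono '' (s : Set (Fin n → ℕ)) : Set (PolyR n)) := by
    ext x
    simp
  rw [he]

open scoped Pointwise in
lemma MS_mul {n : ℕ} (s : Finset (Fin n → ℕ)) : MS s * MS s = MS (s + s) := by
  rw [MS, MS, Submodule.span_mul_span]
  congr 1
  ext p
  simp only [Set.mem_mul, Set.mem_image, Finset.coe_add, Set.mem_add, Finset.mem_coe]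
  constructor
  · rintro ⟨_, ⟨f, hf, rfl⟩, _, ⟨g, hg, rfl⟩, rfl⟩
    exact ⟨f + g, ⟨f, hf, g, hg, rfl⟩, mono_add f g⟩
  · rintro ⟨_, ⟨f, hf, g, hg, rfl⟩, rfl⟩
    exact ⟨_, ⟨f, hf, rfl⟩, _, ⟨g, hg, rfl⟩, (mono_add f g).symm⟩

lemma form_finrank (n d : ℕ) : finrank ℂ (formSpace n d) = (n + d - 1).choose d := by
  rw [finrank_eq le_rfl, inn_form]
  have : Mon n d = ((Finset.univ : Finset (Fin n)).finsuppAntidiag d : Set (Fin n →₀ ℕ)) := by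
    ext m
    simp [Mon, Finset.mem_finsuppAntidiag, Finsupp.degree_eq_sum]
  rw [this, Set.ncard_coe_finset, Finset.card_finsuppAntidiag_nat_eq_choose]
  simp

lemma MS_bpf {n d : ℕ} (hd : d ≠ 0) {s : Finset (Fin n → ℕ)} (h : ∀ i, Pi.single i d ∈ s) :
    IsBPF n (MS s) := by
  intro x hx
  funext i
  have h1 := hx (mono (Pi.single i d)) (Submodule.subset_span ⟨_, h i, rfl⟩)
  have h2 : (Finsupp.equivFunOnFinite.symm (Pi.single i d : Fin n → ℕ)) = Finsupp.single i d := by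
    ext j
    simp [Finsupp.single_eq_pi_single]
  rw [mono, h2, ← X_pow_eq_monomial, map_pow, eval_X] at h1
  exact pow_eq_zero_iff hd |>.1 h1

open scoped Pointwise in
lemma ex_general {n d e a : ℕ} (hd : d ≠ 0) (s : Finset (Fin n → ℕ)) (h1 : ∀ f ∈ s, ∑ i, f i = d)
    (h2 : ∀ i, Pi.single i d ∈ s) (h3 : (n + d - 1).choose d - s.card = 2)
    (h4 : (n + e - 1).choose e - (s + s).card = a) :
    ∃ U : Submodule ℂ (PolyR n), U ≤ formSpace n d ∧ IsBPF n U ∧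
      vcodim n d U = 2 ∧ vcodim n e (U * U) = a := by
  refine ⟨MS s, MS_form h1, MS_bpf hd h2, ?_, ?_⟩
  · rw [vcodim, form_finrank, MS_finrank, h3]
  · rw [vcodim, form_finrank, MS_mul, MS_finrank, h4]

lemma ex2 : ∃ U : Submodule ℂ (PolyR 3), U ≤ formSpace 3 2 ∧ IsBPF 3 U ∧
      vcodim 3 2 U = 2 ∧ vcodim 3 4 (U * U) = 6 :=
  ex_general (by decide) {![2, 0, 0], ![1, 1, 0], ![0, 2, 0], ![0, 0, 2]}
    (by decide) (by decide) (by decide) (by decide)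

lemma ex3 : ∃ U : Submodule ℂ (PolyR 2), U ≤ formSpace 2 3 ∧ IsBPF 2 U ∧
      vcodim 2 3 U = 2 ∧ vcodim 2 (2 * 3) (U * U) = 4 :=
  ex_general (by decide) {![3, 0], ![0, 3]} (by decide) (by decide) (by decide) (by decide)

lemma ex4 : ∃ U : Submodule ℂ (PolyR 2), U ≤ formSpace 2 4 ∧ IsBPF 2 U ∧
      vcodim 2 4 U = 2 ∧ vcodim 2 (2 * 4) (U * U) = 4 :=
  ex_general (by decide) {![4, 0], ![2, 2], ![0, 4]} (by decide) (by decide) (by decide) (by decide)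

end Aux

theorem stmt10 :
    (∀ n d : ℕ, 2 ≤ n → 2 ≤ d → ∀ U : Submodule ℂ (PolyR n), U ≤ formSpace n d →
      IsBPF n U → vcodim n d U = 2 →
        (d = 2 → vcodim n (2 * d) (U * U) ≤ 6) ∧
        (3 ≤ d → vcodim n (2 * d) (U * U) ≤ 4)) ∧
    (∃ n : ℕ, 2 ≤ n ∧ ∃ U : Submodule ℂ (PolyR n), U ≤ formSpace n 2 ∧ IsBPF n U ∧
      vcodim n 2 U = 2 ∧ vcodim n 4 (U * U) = 6) ∧
    (∀ d : ℕ, d = 3 ∨ d = 4 →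
      ∃ n : ℕ, 2 ≤ n ∧ ∃ U : Submodule ℂ (PolyR n), U ≤ formSpace n d ∧ IsBPF n U ∧
        vcodim n d U = 2 ∧ vcodim n (2 * d) (U * U) = 4) := by
  refine ⟨?_, ?_, ?_⟩
  · intro n d hn hd U hU hb hc
    exact Aux.main_bound hn hd hU hb hc
  · exact ⟨3, by omega, Aux.ex2⟩
  · rintro d (rfl | rfl)
    · exact ⟨2, by omega, Aux.ex3⟩
    · exact ⟨2, by omega, Aux.ex4⟩
end

section
/- Let U ⊆ A_d be a linear subspace of codimension k with k ≤ d, let l ∈ A₁ be a generic linear form, and set V := (U:l) ⊆ A_{d−1}. Then codim_{A_{2d}} U² ≤ codim_{A_{2d−1}} UV. If moreover k ≤ d − 1, then codim_{A_{2d}} U² ≤ codim_{A_{2d−2}} V². -/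
open MvPolynomial Module

/-! ### One variable: a `k`-dimensional space of polynomials at a general point -/

lemma wr_generic (k : ℕ) : ∀ S : Submodule ℂ (Polynomial ℂ), Module.Finite ℂ S → finrank ℂ S ≤ k →
    ∃ Q : Polynomial ℂ, Q ≠ 0 ∧ ∀ t, Q.eval t ≠ 0 → ∀ F ∈ S,
      (Polynomial.X - Polynomial.C t) ^ k ∣ F → F = 0 := by
  induction k with
  | zero =>
    intro S hS h
    refine ⟨1, one_ne_zero, fun t _ F hF _ => ?_⟩
    have : S = ⊥ := Submodule.finrank_eq_zero.mp (Nat.le_zero.mp h)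
    rw [this] at hF
    simpa using hF
  | succ k ih =>
    intro S hS h
    by_cases hbot : S = ⊥
    · refine ⟨1, one_ne_zero, fun t _ F hF _ => ?_⟩
      rw [hbot] at hF
      simpa using hF
    obtain ⟨F₀, hF₀, hne⟩ := Submodule.exists_mem_ne_zero_of_ne_bot hbot
    let w : S →ₗ[ℂ] Polynomial ℂ := (Polynomial.wronskianBilin ℂ F₀).comp S.subtype
    have hw : ∀ x : S, w x = F₀ * Polynomial.derivative x.1 - Polynomial.derivative F₀ * x.1 := by
      intro x; rfl
    have hker : 0 < finrank ℂ (LinearMap.ker w) := by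
      refine Nat.pos_of_ne_zero fun h0 => hne ?_
      have hb : LinearMap.ker w = ⊥ := Submodule.finrank_eq_zero.mp h0
      have hm : (⟨F₀, hF₀⟩ : S) ∈ LinearMap.ker w := by
        rw [LinearMap.mem_ker, hw]; ring
      rw [hb, Submodule.mem_bot] at hm
      exact congrArg Subtype.val hm
    have hrank := w.finrank_range_add_finrank_ker
    obtain ⟨Q, hQ, hQt⟩ := ih (LinearMap.range w) inferInstance (by omega)
    refine ⟨Q * F₀, mul_ne_zero hQ hne, fun t ht F hF hdvd => ?_⟩
    rw [Polynomial.eval_mul] at ht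
    have ht1 := left_ne_zero_of_mul ht
    have ht2 := right_ne_zero_of_mul ht
    have hder : (Polynomial.X - Polynomial.C t) ^ k ∣ Polynomial.derivative F := by
      obtain ⟨R, rfl⟩ := hdvd
      refine ⟨(k + 1 : ℂ) • R + (Polynomial.X - Polynomial.C t) * Polynomial.derivative R, ?_⟩
      simp [Polynomial.derivative_mul, Polynomial.derivative_pow, Polynomial.smul_eq_C_mul]
      ring
    have hz : w ⟨F, hF⟩ = 0 := by
      apply hQt t ht1 _ (LinearMap.mem_range_self _ _)
      rw [hw]
      exact dvd_sub (hder.mul_left _) (((pow_dvd_pow _ (Nat.le_succ k)).trans hdvd).mul_left _)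
    rw [hw] at hz
    simp only at hz
    by_contra hFne
    have hroot : F.IsRoot t := by
      rw [← Polynomial.dvd_iff_isRoot]
      exact (dvd_pow_self _ (Nat.succ_ne_zero k)).trans hdvd
    obtain ⟨R, hR, hRt⟩ := Polynomial.exists_eq_pow_rootMultiplicity_mul_and_not_dvd F hFne t
    set m := F.rootMultiplicity t with hm
    have hmpos : 0 < m := (Polynomial.rootMultiplicity_pos hFne).2 hroot
    obtain ⟨r, hr⟩ : ∃ r, m = r + 1 := ⟨m - 1, by omega⟩
    rw [hr] at hR
    set Y := (Polynomial.X - Polynomial.C t) with hY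
    have hYne : Y ≠ 0 := Polynomial.X_sub_C_ne_zero t
    have hYd : Polynomial.derivative Y = 1 := by simp [hY]
    have hkey : Y ^ r * (Polynomial.C ((r : ℂ) + 1) * F₀ * R +
        Y * (F₀ * Polynomial.derivative R - Polynomial.derivative F₀ * R)) = 0 := by
      rw [← hz, hR]
      simp [Polynomial.derivative_mul, Polynomial.derivative_pow, hYd]
      ring
    have h2 := (mul_eq_zero.mp hkey).resolve_left (pow_ne_zero _ hYne)
    have h3 := congrArg (Polynomial.eval t) h2
    have hYt : Polynomial.eval t Y = 0 := by simp [hY]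
    have hRt' : Polynomial.eval t R ≠ 0 := by
      intro h; exact hRt (Polynomial.dvd_iff_isRoot.mpr h)
    simp [hYt] at h3
    rcases h3 with (h3 | h3) | h3
    · exact Nat.cast_add_one_ne_zero (R := ℂ) r h3
    · exact ht2 h3
    · exact hRt' h3

/-! ### Evaluating functionals along a family of linear forms -/

noncomputable def curveG {n : ℕ} {R : Type} [CommRing R] [Algebra ℂ R] (γ : Fin n → R) :
    ℕ → PolyR n → ((PolyR n →ₗ[ℂ] ℂ) →ₗ[ℂ] R)
  | 0, g => (Algebra.linearMap ℂ R).comp (LinearMap.applyₗ g)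
  | a + 1, g => ∑ i, (LinearMap.mulLeft ℂ (γ i)).comp (curveG γ a (X i * g))

lemma curveG_zero {n : ℕ} {R : Type} [CommRing R] [Algebra ℂ R] (γ : Fin n → R) (g : PolyR n)
    (ψ : PolyR n →ₗ[ℂ] ℂ) : curveG γ 0 g ψ = algebraMap ℂ R (ψ g) := rfl

lemma curveG_succ {n : ℕ} {R : Type} [CommRing R] [Algebra ℂ R] (γ : Fin n → R) (a : ℕ)
    (g : PolyR n) (ψ : PolyR n →ₗ[ℂ] ℂ) :
    curveG γ (a + 1) g ψ = ∑ i, γ i * curveG γ a (X i * g) ψ := by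
  simp [curveG, LinearMap.sum_apply]

lemma curveG_add {n : ℕ} {R : Type} [CommRing R] [Algebra ℂ R] (γ : Fin n → R) (a : ℕ)
    (g h : PolyR n) (ψ : PolyR n →ₗ[ℂ] ℂ) :
    curveG γ a (g + h) ψ = curveG γ a g ψ + curveG γ a h ψ := by
  induction a generalizing g h with
  | zero => simp [curveG_zero]
  | succ a ih => simp [curveG_succ, mul_add, ih, Finset.sum_add_distrib]

lemma curveG_smul {n : ℕ} {R : Type} [CommRing R] [Algebra ℂ R] (γ : Fin n → R) (a : ℕ)
    (c : ℂ) (g : PolyR n) (ψ : PolyR n →ₗ[ℂ] ℂ) :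
    curveG γ a (c • g) ψ = algebraMap ℂ R c * curveG γ a g ψ := by
  induction a generalizing g with
  | zero => simp [curveG_zero]
  | succ a ih =>
    simp only [curveG_succ, mul_smul_comm, ih, Finset.mul_sum]
    exact Finset.sum_congr rfl fun i _ => by ring

lemma curveG_lin {n : ℕ} {R : Type} [CommRing R] [Algebra ℂ R] (γ : Fin n → R) (a : ℕ)
    (c : Fin n → ℂ) (g : PolyR n) (ψ : PolyR n →ₗ[ℂ] ℂ) :
    curveG γ a (linForm n c * g) ψ = ∑ i, algebraMap ℂ R (c i) * curveG γ a (X i * g) ψ := by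
  have hz : curveG γ a (0 : PolyR n) ψ = 0 := by simpa using curveG_smul γ a 0 0 ψ
  let f : PolyR n →+ R := ⟨⟨fun g => curveG γ a g ψ, hz⟩, fun g h => curveG_add γ a g h ψ⟩
  change f (linForm n c * g) = _
  rw [linForm, Finset.sum_mul, map_sum]
  refine Finset.sum_congr rfl fun i _ => ?_
  change curveG γ a _ ψ = _
  rw [smul_mul_assoc, curveG_smul]

lemma curveG_eval {n : ℕ} {R : Type} [CommRing R] [Algebra ℂ R] (γ : Fin n → R) (f : R →ₐ[ℂ] ℂ)
    (a : ℕ) (g : PolyR n) (ψ : PolyR n →ₗ[ℂ] ℂ) :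
    f (curveG γ a g ψ) = ψ (linForm n (fun i => f (γ i)) ^ a * g) := by
  induction a generalizing g with
  | zero => simp [curveG_zero]
  | succ a ih =>
    simp only [curveG_succ, map_sum, map_mul, ih]
    rw [pow_succ, mul_assoc]
    conv_rhs => rw [linForm, Finset.sum_mul, Finset.mul_sum, map_sum]
    refine Finset.sum_congr rfl fun i _ => ?_
    rw [smul_mul_assoc, mul_smul_comm, map_smul, smul_eq_mul]
    rfl

lemma curveG_dvd {n : ℕ} (γ : Fin n → Polynomial ℂ) (t : ℂ) (j : ℕ)
    (ψ : PolyR n →ₗ[ℂ] ℂ)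
    (hψ : ∀ h, ψ (linForm n (fun i => (γ i).eval t) ^ j * h) = 0) (a s : ℕ) (g : PolyR n) :
    (Polynomial.X - Polynomial.C t) ^ (a + s + 1 - j) ∣
      curveG γ a (linForm n (fun i => (γ i).eval t) ^ s * g) ψ := by
  induction a generalizing s g with
  | zero =>
    rw [curveG_zero]
    rcases le_or_gt j s with h | h
    · obtain ⟨r, rfl⟩ := Nat.exists_eq_add_of_le h
      rw [pow_add, mul_assoc, hψ, map_zero]
      exact dvd_zero _
    · rw [show 0 + s + 1 - j = 0 by omega, pow_zero]
      exact one_dvd _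
  | succ a ih =>
    have hδ : ∀ i, ∃ δ, γ i = Polynomial.C ((γ i).eval t) + (Polynomial.X - Polynomial.C t) * δ := by
      intro i
      obtain ⟨δ, h⟩ := Polynomial.X_sub_C_dvd_sub_C_eval (p := γ i) (a := t)
      exact ⟨δ, by rw [← h]; ring⟩
    choose δ hδ using hδ
    have : curveG γ (a + 1) (linForm n (fun i => (γ i).eval t) ^ s * g) ψ =
        curveG γ a (linForm n (fun i => (γ i).eval t) ^ (s + 1) * g) ψ +
        ∑ i, δ i * ((Polynomial.X - Polynomial.C t) *
          curveG γ a (linForm n (fun i => (γ i).eval t) ^ s * (X i * g)) ψ) := by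
      rw [pow_succ', mul_assoc, curveG_lin, curveG_succ, ← Finset.sum_add_distrib]
      refine Finset.sum_congr rfl fun i _ => ?_
      conv_lhs => rw [hδ i]
      rw [mul_left_comm (X i)]
      simp only [Polynomial.algebraMap_eq]
      ring
    rw [this]
    refine dvd_add ?_ (Finset.dvd_sum fun i _ => Dvd.dvd.mul_left ?_ _)
    · have := ih (s + 1) g
      rwa [show a + 1 + s + 1 - j = a + (s + 1) + 1 - j by omega]
    · refine (pow_dvd_pow _ (show a + 1 + s + 1 - j ≤ (a + s + 1 - j) + 1 by omega)).trans ?_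
      rw [pow_succ']
      exact mul_dvd_mul_left _ (ih s _)

/-! ### Powers of linear forms span -/

lemma linForm_mem (n : ℕ) (c : Fin n → ℂ) : linForm n c ∈ formSpace n 1 :=
  Submodule.sum_mem _ fun i _ => Submodule.smul_mem _ _ (isHomogeneous_X ℂ i)

lemma formSpace_mul (n a b : ℕ) : formSpace n a * formSpace n b = formSpace n (a + b) := by
  unfold formSpace
  rw [← homogeneousSubmodule_one_pow (σ := Fin n) (R := ℂ) (a), ← homogeneousSubmodule_one_pow (σ := Fin n) (R := ℂ) (b),
    ← homogeneousSubmodule_one_pow (σ := Fin n) (R := ℂ) (a + b), pow_add]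

lemma linForm_pow_mul_mem (n : ℕ) (c : Fin n → ℂ) (j a : ℕ) (g : PolyR n)
    (hg : g ∈ formSpace n a) : linForm n c ^ j * g ∈ formSpace n (j + a) := by
  have h := (IsHomogeneous.pow (linForm_mem n c) j).mul hg
  rw [one_mul] at h
  exact h

lemma functional_zero (n d : ℕ) (ψ : PolyR n →ₗ[ℂ] ℂ) (h : ∀ c, ψ (linForm n c ^ d) = 0) :
    ∀ p ∈ formSpace n d, ψ p = 0 := by
  classical
  let p : PolyR n := ∑ k ∈ Finset.piAntidiag Finset.univ d,
    monomial (Finsupp.equivFunOnFinite.symm k)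
      ((Nat.multinomial Finset.univ k : ℂ) * ψ (monomial (Finsupp.equivFunOnFinite.symm k) 1))
  have hmon : ∀ k : Fin n → ℕ, (monomial (Finsupp.equivFunOnFinite.symm k) (1 : ℂ)) =
      ∏ i, (X i : PolyR n) ^ k i := by
    intro k
    rw [monomial_eq, Finsupp.prod_fintype _ _ (by simp)]
    simp
  have hp : p = 0 := by
    apply MvPolynomial.funext
    intro c
    rw [map_zero, ← h c, linForm, Finset.sum_pow_eq_sum_piAntidiag, map_sum, map_sum]
    refine Finset.sum_congr rfl fun k _ => ?_
    simp only [smul_pow, Finset.prod_smul, ← hmon]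
    rw [← nsmul_eq_mul (Nat.multinomial Finset.univ k) ((∏ i, c i ^ k i) • _), map_nsmul ψ,
      map_smul, eval_monomial, nsmul_eq_mul,
      smul_eq_mul, Finsupp.prod_fintype _ _ (by simp)]
    simp only [Finsupp.equivFunOnFinite_symm_apply_apply]
    ring
  have hk : ∀ k : Fin n →₀ ℕ, k.degree = d → ψ (monomial k 1) = 0 := by
    intro k hk
    have h1 := congrArg (coeff k) hp
    simp only [p, coeff_sum, coeff_monomial, coeff_zero] at h1
    rw [Finset.sum_eq_single (k : Fin n → ℕ)] at h1
    · simp only [Finsupp.equivFunOnFinite_symm_coe, if_true] at h1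
      exact (mul_eq_zero.mp h1).resolve_left
        (Nat.cast_ne_zero.mpr (Nat.multinomial_pos _ _).ne')
    · intro b _ hb
      rw [if_neg]
      rintro rfl
      exact hb (by simp)
    · intro hb
      exfalso
      apply hb
      rw [Finset.mem_piAntidiag]
      refine ⟨?_, by simp⟩
      rw [← hk, Finsupp.degree_eq_sum]
  intro q hq
  rw [q.as_sum, map_sum]
  refine Finset.sum_eq_zero fun k hkq => ?_
  have : k.degree = d := by
    by_contra hne
    exact (mem_support_iff.mp hkq) (IsHomogeneous.coeff_eq_zero hq hne)
  rw [← mul_one (coeff k q), ← smul_eq_mul, ← smul_monomial, map_smul, hk k this, smul_zero]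

/-! ### Existence of one good linear form -/

/-- Projection to the degree `d` component, with values in `formSpace n d`. -/
noncomputable def projD (n d : ℕ) : PolyR n →ₗ[ℂ] formSpace n d :=
  (homogeneousComponent d).codRestrict (formSpace n d) (fun p => homogeneousComponent_mem d p)

lemma projD_of_mem (n d : ℕ) (p : PolyR n) (hp : p ∈ formSpace n d) : projD n d p = ⟨p, hp⟩ := by
  apply Subtype.ext
  exact homogeneousComponent_eq_self hp

lemma projD_pow_mul (n d j : ℕ) (hj : j ≤ d) (c : Fin n → ℂ) (h : PolyR n) :
    ∃ g ∈ formSpace n (d - j), (projD n d (linForm n c ^ j * h) : PolyR n) = linForm n c ^ j * g := by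
  refine ⟨homogeneousComponent (d - j) h, homogeneousComponent_mem _ _, ?_⟩
  change homogeneousComponent d (linForm n c ^ j * h) = _
  conv_lhs => rw [← sum_homogeneousComponent h, Finset.mul_sum, map_sum]
  have hmem : ∀ i, homogeneousComponent d (linForm n c ^ j * homogeneousComponent i h) =
      if i = d - j then linForm n c ^ j * homogeneousComponent i h else 0 := by
    intro i
    have := linForm_pow_mul_mem n c j i _ (homogeneousComponent_mem i h)
    rw [homogeneousComponent_of_mem this]
    congr 1
    exact propext ⟨fun _ => by omega, fun _ => by omega⟩
  simp only [hmem]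
  rw [Finset.sum_ite_eq']
  split_ifs with hi
  · rfl
  · rw [homogeneousComponent_eq_zero, mul_zero]
    simp only [Finset.mem_range] at hi
    omega

instance formSpace_finite (n d : ℕ) : Module.Finite ℂ (formSpace n d) :=
  Module.Finite.iff_fg.mpr (homogeneousSubmodule_fg (Fin n) ℂ d)

lemma exists_curve (n d : ℕ) : ∃ γ : Fin n → Polynomial ℂ, ∀ ψ : PolyR n →ₗ[ℂ] ℂ,
    (∀ t, ψ (linForm n (fun i => (γ i).eval t) ^ d) = 0) → ∀ p ∈ formSpace n d, ψ p = 0 := by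
  classical
  have hle : Submodule.span ℂ (Set.range fun c => linForm n c ^ d) ≤ formSpace n d := by
    rw [Submodule.span_le]
    rintro _ ⟨c, rfl⟩
    have := linForm_pow_mul_mem n c d 0 1 (isHomogeneous_one _ _)
    simpa using this
  have hfg : (Submodule.span ℂ (Set.range fun c => linForm n c ^ d)).FG := by
    have : Module.Finite ℂ (Submodule.span ℂ (Set.range fun c => linForm n c ^ d)) :=
      Submodule.finiteDimensional_of_le hle
    exact Module.Finite.iff_fg.mp this
  rw [Submodule.fg_span_iff_fg_span_finset_subset] at hfg
  obtain ⟨s, hs, hspan⟩ := hfg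
  have hpts : ∀ x : s, ∃ c, linForm n c ^ d = x.1 := fun x => hs x.2
  choose c hc using hpts
  let e := s.equivFin
  let node : s → ℂ := fun x => ((e x : ℕ) : ℂ)
  have hnode : Function.Injective node := by
    intro x y h
    exact e.injective (Fin.ext (Nat.cast_injective (R := ℂ) h))
  refine ⟨fun i => Lagrange.interpolate Finset.univ node (fun x => c x i), fun ψ hψ => ?_⟩
  apply functional_zero
  intro c'
  have h0 : Submodule.span ℂ (s : Set (PolyR n)) ≤ LinearMap.ker ψ := by
    rw [Submodule.span_le]
    intro x hx
    have := hψ (node ⟨x, hx⟩)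
    simp only [Lagrange.eval_interpolate_at_node _ hnode.injOn (Finset.mem_univ _)] at this
    rw [hc] at this
    exact this
  rw [← hspan] at h0
  exact h0 (Submodule.subset_span ⟨c', rfl⟩)

lemma exists_good (n d k j : ℕ) (hj : j ≤ d) (hk : k + j ≤ d + 1) (U : Submodule ℂ (PolyR n))
    (hU : U ≤ formSpace n d) (hcodim : vcodim n d U ≤ k) :
    ∃ c, formSpace n d ≤
      U ⊔ (formSpace n (d - j)).map (LinearMap.mulLeft ℂ (linForm n c ^ j)) := by
  obtain ⟨γ, hγ⟩ := exists_curve n d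
  let U' : Submodule ℂ (formSpace n d) := U.comap (formSpace n d).subtype
  have hU' : finrank ℂ U' = finrank ℂ U :=
    (Submodule.comapSubtypeEquivOfLe hU).finrank_eq
  let W : Submodule ℂ (Module.Dual ℂ (formSpace n d)) := U'.dualAnnihilator
  have hW : finrank ℂ W ≤ k := by
    have := Subspace.finrank_add_finrank_dualAnnihilator_eq U'
    unfold vcodim at hcodim
    change finrank ℂ U'.dualAnnihilator ≤ k
    omega
  let G : Module.Dual ℂ (formSpace n d) →ₗ[ℂ] Polynomial ℂ :=
    (curveG γ d 1).comp ((projD n d).dualMap)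
  obtain ⟨Q, hQ, hQt⟩ := wr_generic k (W.map G) inferInstance
    ((Submodule.finrank_map_le G W).trans hW)
  obtain ⟨t, ht⟩ : ∃ t, Q.eval t ≠ 0 := by
    by_contra! hcon
    exact hQ (Polynomial.funext (by simpa using hcon))
  refine ⟨fun i => (γ i).eval t, ?_⟩
  set l := linForm n (fun i => (γ i).eval t) with hl
  set T := U ⊔ (formSpace n (d - j)).map (LinearMap.mulLeft ℂ (l ^ j)) with hT
  let T' : Submodule ℂ (formSpace n d) := T.comap (formSpace n d).subtype
  suffices hT' : T' = ⊤ by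
    intro p hp
    have : (⟨p, hp⟩ : formSpace n d) ∈ T' := by rw [hT']; trivial
    exact this
  suffices hb : T'.dualAnnihilator = ⊥ by
    have := Subspace.dualAnnihilator_dualCoannihilator_eq (W := T')
    rw [← this, hb, Submodule.dualCoannihilator_bot]
  rw [eq_bot_iff]
  intro φ hφ
  rw [Submodule.mem_dualAnnihilator] at hφ
  have hφW : φ ∈ W := by
    change φ ∈ U'.dualAnnihilator
    rw [Submodule.mem_dualAnnihilator]
    intro w hw
    exact hφ w (Submodule.mem_sup_left (show (w : PolyR n) ∈ U from hw))
  have hkill : ∀ h, (φ.comp (projD n d)) (l ^ j * h) = 0 := by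
    intro h
    apply hφ
    obtain ⟨g, hg, hgeq⟩ := projD_pow_mul n d j hj (fun i => (γ i).eval t) h
    change (projD n d (l ^ j * h) : PolyR n) ∈ T
    rw [hl, hgeq]
    exact Submodule.mem_sup_right ⟨g, hg, rfl⟩
  have hdvd := curveG_dvd γ t j (φ.comp (projD n d)) hkill d 0 1
  rw [pow_zero, mul_one] at hdvd
  have hG0 : G φ = 0 :=
    hQt t ht _ (Submodule.mem_map_of_mem hφW)
      ((pow_dvd_pow _ (show k ≤ d + 0 + 1 - j by omega)).trans hdvd)
  have hall := hγ (φ.comp (projD n d)) (by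
    intro s
    have := curveG_eval γ (Polynomial.aeval s) d 1 (φ.comp (projD n d))
    have h2 : curveG γ d 1 (φ.comp (projD n d)) = 0 := hG0
    rw [h2, map_zero, mul_one] at this
    simpa [Polynomial.coe_aeval_eq_eval] using this.symm)
  rw [Submodule.mem_bot]
  ext ⟨p, hp⟩
  have := hall p hp
  rw [LinearMap.comp_apply, projD_of_mem n d p hp] at this
  simpa using this

/-! ### Openness -/

lemma exists_open (n d j : ℕ) (hj : j ≤ d) (U : Submodule ℂ (PolyR n))
    (hU : U ≤ formSpace n d) (c₀ : Fin n → ℂ)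
    (h₀ : formSpace n d ≤
      U ⊔ (formSpace n (d - j)).map (LinearMap.mulLeft ℂ (linForm n c₀ ^ j))) :
    ∃ P : PolyR n, P ≠ 0 ∧ ∀ c, eval c P ≠ 0 → formSpace n d ≤
      U ⊔ (formSpace n (d - j)).map (LinearMap.mulLeft ℂ (linForm n c ^ j)) := by
  classical
  let U' : Submodule ℂ (formSpace n d) := U.comap (formSpace n d).subtype
  let b := Module.finBasis ℂ (formSpace n d ⧸ U')
  have hg : ∀ m, ∃ g ∈ formSpace n (d - j),
      U'.mkQ (projD n d (linForm n c₀ ^ j * g)) = b m := by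
    intro m
    obtain ⟨⟨e, he⟩, hem⟩ := U'.mkQ_surjective (b m)
    obtain ⟨u, hu, w, ⟨g, hg, hgw⟩, huw⟩ := Submodule.mem_sup.mp (h₀ he)
    refine ⟨g, hg, ?_⟩
    rw [← hem]
    have hw : linForm n c₀ ^ j * g = w := hgw
    have hwm : w = e - u := by rw [← huw]; ring
    rw [hw, hwm, projD_of_mem n d _ (Submodule.sub_mem _ he (hU hu)), Submodule.mkQ_apply,
      Submodule.mkQ_apply, Submodule.Quotient.eq]
    change (e - u) - e ∈ U
    rw [show (e - u) - e = -u by ring]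
    exact U.neg_mem hu
  choose g hgm hgb using hg
  let ψ : Fin _ → (PolyR n →ₗ[ℂ] ℂ) := fun i => (b.coord i).comp (U'.mkQ.comp (projD n d))
  let M : Matrix (Fin _) (Fin _) (PolyR n) := fun i m => curveG (fun i => X i) j (g m) (ψ i)
  have hM : ∀ c, (M.map (eval c)) = fun i m => ψ i (linForm n c ^ j * g m) := by
    intro c
    ext i m
    have := curveG_eval (fun i => (X i : PolyR n)) (aeval c) j (g m) (ψ i)
    simp only [aeval_X] at this
    exact (DFunLike.congr_fun (coe_aeval_eq_eval c).symm _).trans this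
  have hdet : ∀ c, eval c M.det = (M.map (eval c)).det := fun c => by
    rw [RingHom.map_det]; rfl
  refine ⟨M.det, ?_, ?_⟩
  · intro h
    have h1 := hdet c₀
    rw [h, map_zero, hM] at h1
    have : (fun i m => ψ i (linForm n c₀ ^ j * g m)) = (1 : Matrix (Fin _) (Fin _) ℂ) := by
      ext i m
      simp only [ψ, LinearMap.comp_apply, hgb]
      rw [Basis.coord_apply, Basis.repr_self, Finsupp.single_apply, Matrix.one_apply]
      simp [eq_comm]
    rw [this, Matrix.det_one] at h1
    exact zero_ne_one h1
  · intro c hc e he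
    rw [hdet] at hc
    set N := M.map (eval c) with hN
    let v : Fin _ → ℂ := fun i => ψ i e
    let w := N⁻¹.mulVec v
    have hw : N.mulVec w = v := by
      simp only [w]
      rw [Matrix.mulVec_mulVec, Matrix.mul_nonsing_inv _ (isUnit_iff_ne_zero.mpr hc),
        Matrix.one_mulVec]
    let r : PolyR n := ∑ m, w m • g m
    have hr : r ∈ formSpace n (d - j) :=
      Submodule.sum_mem _ fun m _ => Submodule.smul_mem _ _ (hgm m)
    have hlr : linForm n c ^ j * r ∈ formSpace n d := by
      have := linForm_pow_mul_mem n c j _ r hr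
      rwa [show j + (d - j) = d by omega] at this
    have hψ : ∀ i, ψ i (e - linForm n c ^ j * r) = 0 := by
      intro i
      have := congrFun hw i
      rw [map_sub, sub_eq_zero]
      change ψ i e = _
      rw [show ψ i e = v i from rfl, ← this, hN, hM]
      simp only [Matrix.mulVec, dotProduct, r, Finset.mul_sum, map_sum, mul_smul_comm, map_smul,
        smul_eq_mul]
      exact Finset.sum_congr rfl fun m _ => mul_comm _ _
    have hsub := Submodule.sub_mem _ he hlr
    have hmem : (⟨_, hsub⟩ : formSpace n d) ∈ U' := by
      rw [← Submodule.Quotient.mk_eq_zero]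
      apply b.ext_elem
      intro i
      have := hψ i
      simp only [ψ, LinearMap.comp_apply] at this
      rw [projD_of_mem n d _ hsub] at this
      simpa using this
    have hmem' : e - linForm n c ^ j * r ∈ U := hmem
    rw [Submodule.mem_sup]
    exact ⟨_, hmem', linForm n c ^ j * r, ⟨r, hr, rfl⟩, by ring⟩

/-! ### Dimension count -/

lemma vcodim_le (n m : ℕ) (l : PolyR n) (hl : l ≠ 0) (A B : Submodule ℂ (PolyR n))
    (hA : A ≤ formSpace n (m + 1)) (hB : B ≤ formSpace n m)
    (hBA : B.map (LinearMap.mulLeft ℂ l) ≤ A)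
    (hsup : formSpace n (m + 1) ≤ A ⊔ (formSpace n m).map (LinearMap.mulLeft ℂ l)) :
    vcodim n (m + 1) A ≤ vcodim n m B := by
  have hinj : Function.Injective (LinearMap.mulLeft ℂ l) := fun a b h => mul_left_cancel₀ hl h
  have e1 : ∀ C : Submodule ℂ (PolyR n), finrank ℂ (C.map (LinearMap.mulLeft ℂ l)) = finrank ℂ C :=
    fun C => (Submodule.equivMapOfInjective _ hinj C).symm.finrank_eq
  have fA : Module.Finite ℂ A := Submodule.finiteDimensional_of_le hA
  have h1 := Submodule.finrank_sup_add_finrank_inf_eq A ((formSpace n m).map (LinearMap.mulLeft ℂ l))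
  have h2 := Submodule.finrank_mono hsup
  have h3 : finrank ℂ (B.map (LinearMap.mulLeft ℂ l)) ≤
      finrank ℂ (A ⊓ (formSpace n m).map (LinearMap.mulLeft ℂ l) : Submodule ℂ (PolyR n)) :=
    Submodule.finrank_mono (le_inf hBA (Submodule.map_mono hB))
  have h4 := Submodule.finrank_mono hB
  rw [e1] at h1 h3
  unfold vcodim
  omega

lemma mul_sup_le (n a b : ℕ) (l : PolyR n) (A B : Submodule ℂ (PolyR n)) (hl : l ∈ formSpace n 1)
    (hA : formSpace n (a + 1) ≤ A ⊔ (formSpace n a).map (LinearMap.mulLeft ℂ l))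
    (hAA : A ≤ formSpace n (a + 1))
    (hB : formSpace n (b + 1) ≤ B ⊔ (formSpace n b).map (LinearMap.mulLeft ℂ l)) :
    formSpace n (a + b + 1 + 1) ≤
      A * B ⊔ (formSpace n (a + b + 1)).map (LinearMap.mulLeft ℂ l) := by
  rw [show a + b + 1 + 1 = (a + 1) + (b + 1) by omega, ← formSpace_mul, Submodule.mul_le]
  intro p hp q hq
  obtain ⟨u, hu, _, ⟨f, hf, rfl⟩, rfl⟩ := Submodule.mem_sup.mp (hA hp)
  obtain ⟨v, hv, _, ⟨g, hg, rfl⟩, rfl⟩ := Submodule.mem_sup.mp (hB hq)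
  rw [Submodule.mem_sup]
  refine ⟨u * v, Submodule.mul_mem_mul hu hv, _,
    ⟨u * g + f * (v + LinearMap.mulLeft ℂ l g), ?_, rfl⟩, ?_⟩
  · refine Submodule.add_mem _ ?_ ?_
    · have := IsHomogeneous.mul (hAA hu) hg
      rw [show a + 1 + b = a + b + 1 by omega] at this
      exact this
    · have := IsHomogeneous.mul hf hq
      rw [show a + (b + 1) = a + b + 1 by omega] at this
      exact this
  · simp only [LinearMap.mulLeft_apply]
    ring

lemma linForm_ne_zero (n : ℕ) (c : Fin n → ℂ) (i : Fin n) (hi : c i ≠ 0) : linForm n c ≠ 0 := by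
  intro h
  have := congrArg (coeff (Finsupp.single i 1)) h
  simp [linForm, coeff_sum, coeff_X, Finsupp.single_left_inj] at this
  exact hi this

theorem stmt12 (n d k : ℕ) (hn : 2 ≤ n) (hd : 2 ≤ d) (hkd : k ≤ d)
    (U : Submodule ℂ (PolyR n)) (hU : U ≤ formSpace n d)
    (hcodim : vcodim n d U = k) :
    ∃ P : MvPolynomial (Fin n) ℂ, P ≠ 0 ∧ ∀ c : Fin n → ℂ, eval c P ≠ 0 →
      vcodim n (2 * d) (U * U) ≤
        vcodim n (2 * d - 1) (U * colon n d U (linForm n c)) ∧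
      (k ≤ d - 1 → vcodim n (2 * d) (U * U) ≤
        vcodim n (2 * d - 2) (colon n d U (linForm n c) * colon n d U (linForm n c))) := by
  have hle : ∀ j, j ≤ d → k + j ≤ d + 1 → ∃ P : PolyR n, P ≠ 0 ∧ ∀ c, eval c P ≠ 0 →
      formSpace n d ≤
        U ⊔ (formSpace n (d - j)).map (LinearMap.mulLeft ℂ (linForm n c ^ j)) := by
    intro j hj hk
    obtain ⟨c₀, h₀⟩ := exists_good n d k j hj hk U hU hcodim.le
    exact exists_open n d j hj U hU c₀ h₀
  obtain ⟨P₁, hP₁, h₁⟩ := hle 1 (by omega) (by omega)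
  obtain ⟨P₂, hP₂, h₂⟩ : ∃ P : PolyR n, P ≠ 0 ∧ ∀ c, eval c P ≠ 0 → k ≤ d - 1 →
      formSpace n d ≤
        U ⊔ (formSpace n (d - 2)).map (LinearMap.mulLeft ℂ (linForm n c ^ 2)) := by
    by_cases hk : k ≤ d - 1
    · obtain ⟨P, hP, h⟩ := hle 2 hd (by omega)
      exact ⟨P, hP, fun c hc _ => h c hc⟩
    · exact ⟨1, one_ne_zero, fun c _ h => absurd h hk⟩
  let i₀ : Fin n := ⟨0, by omega⟩
  refine ⟨X i₀ * (P₁ * P₂), mul_ne_zero (X_ne_zero _) (mul_ne_zero hP₁ hP₂), fun c hc => ?_⟩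
  rw [map_mul, map_mul, eval_X] at hc
  have hc0 := left_ne_zero_of_mul hc
  have hc1 := h₁ c (left_ne_zero_of_mul (right_ne_zero_of_mul hc))
  have hc2 := h₂ c (right_ne_zero_of_mul (right_ne_zero_of_mul hc))
  have hl0 := linForm_ne_zero n c i₀ hc0
  have hl1 := linForm_mem n c
  rw [pow_one] at hc1
  set l := linForm n c with hl
  obtain ⟨e, rfl⟩ : ∃ e, d = e + 2 := ⟨d - 2, by omega⟩
  set V := colon n (e + 2) U l with hV
  have hVle : V ≤ formSpace n (e + 1) := inf_le_right
  have hlV : ∀ v ∈ V, l * v ∈ U := fun v hv => hv.1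
  have hmulle : ∀ (a b : ℕ) (A B : Submodule ℂ (PolyR n)), A ≤ formSpace n a → B ≤ formSpace n b →
      A * B ≤ formSpace n (a + b) := fun a b A B hA hB =>
    (Submodule.mul_le.mpr fun p hp q hq => Submodule.mul_mem_mul (hA hp) (hB hq)).trans (formSpace_mul n a b).le
  have hmapUV : ∀ A : Submodule ℂ (PolyR n),
      (A * V).map (LinearMap.mulLeft ℂ l) ≤ A * U := by
    intro A
    rw [Submodule.map_le_iff_le_comap, Submodule.mul_le]
    intro a ha v hv
    change l * (a * v) ∈ A * U
    rw [mul_left_comm]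
    exact Submodule.mul_mem_mul ha (hlV v hv)
  constructor
  · rw [show 2 * (e + 2) = (2 * e + 3) + 1 by ring, show 2 * e + 3 + 1 - 1 = 2 * e + 3 by omega]
    refine vcodim_le n _ l hl0 _ _ ?_ ?_ (hmapUV U) ?_
    · rw [show 2 * e + 3 + 1 = (e + 2) + (e + 2) by ring]
      exact hmulle _ _ _ _ hU hU
    · rw [show 2 * e + 3 = (e + 2) + (e + 1) by ring]
      exact hmulle _ _ _ _ hU hVle
    · have := mul_sup_le n (e + 1) (e + 1) l U U hl1 hc1 hU hc1
      rwa [show e + 1 + (e + 1) + 1 = 2 * e + 3 by ring] at this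
  · intro hk
    have hc2 := hc2 hk
    have hVsup : formSpace n (e + 1) ≤ V ⊔ (formSpace n e).map (LinearMap.mulLeft ℂ l) := by
      intro f hf
      have hlf : l * f ∈ formSpace n (e + 2) := by
        have := linForm_pow_mul_mem n c 1 (e + 1) f hf
        rw [pow_one, show 1 + (e + 1) = e + 2 by ring] at this
        exact this
      obtain ⟨u, hu, _, ⟨g, hg, rfl⟩, hug⟩ := Submodule.mem_sup.mp (hc2 hlf)
      have hg' : g ∈ formSpace n e := hg
      have hlg : l * g ∈ formSpace n (e + 1) := by
        have := linForm_pow_mul_mem n c 1 e g hg'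
        rw [pow_one, show 1 + e = e + 1 by ring] at this
        exact this
      rw [LinearMap.mulLeft_apply] at hug
      refine Submodule.mem_sup.mpr ⟨f - l * g, ⟨?_, Submodule.sub_mem _ hf hlg⟩, l * g,
        ⟨g, hg', rfl⟩, by ring⟩
      change l * (f - l * g) ∈ U
      rw [show l * (f - l * g) = u by rw [mul_sub, ← hug]; ring]
      exact hu
    have hfirst : vcodim n (2 * (e + 2)) (U * U) ≤ vcodim n (2 * e + 3) (U * V) := by
      rw [show 2 * (e + 2) = (2 * e + 3) + 1 by ring]
      refine vcodim_le n _ l hl0 _ _ ?_ ?_ (hmapUV U) ?_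
      · rw [show 2 * e + 3 + 1 = (e + 2) + (e + 2) by ring]
        exact hmulle _ _ _ _ hU hU
      · rw [show 2 * e + 3 = (e + 2) + (e + 1) by ring]
        exact hmulle _ _ _ _ hU hVle
      · have := mul_sup_le n (e + 1) (e + 1) l U U hl1 hc1 hU hc1
        rwa [show e + 1 + (e + 1) + 1 = 2 * e + 3 by ring] at this
    refine hfirst.trans ?_
    rw [show 2 * (e + 2) - 2 = 2 * e + 2 by omega, show 2 * e + 3 = (2 * e + 2) + 1 by ring]
    refine vcodim_le n _ l hl0 _ _ ?_ ?_ ?_ ?_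
    · rw [show 2 * e + 2 + 1 = (e + 2) + (e + 1) by ring]
      exact hmulle _ _ _ _ hU hVle
    · rw [show 2 * e + 2 = (e + 1) + (e + 1) by ring]
      exact hmulle _ _ _ _ hVle hVle
    · rw [mul_comm U V]
      exact hmapUV V
    · have := mul_sup_le n (e + 1) e l U V hl1 hc1 hU hVsup
      rwa [show e + 1 + e + 1 = 2 * e + 2 by ring] at this
end

section
/- For every n ≥ 2 and all integers k, d with 1 ≤ k ≤ d, one has m(n, d, k) ≤ m(n, k, k); that is, for k ≤ d the function d ↦ m(n,d,k) is bounded by its value at d = k. -/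
open MvPolynomial Module

/-! ### A univariate Wronskian argument -/

lemma ker_wr (f h : Polynomial ℂ) (hf : f ≠ 0)
    (h0 : f * Polynomial.derivative h - Polynomial.derivative f * h = 0) :
    ∃ c : ℂ, h = c • f := by
  refine ⟨h.coeff f.natDegree / f.leadingCoeff, ?_⟩
  have hlc : f.leadingCoeff ≠ 0 := Polynomial.leadingCoeff_ne_zero.mpr hf
  set c := h.coeff f.natDegree / f.leadingCoeff with hc
  set g := h - c • f with hg
  have hg0 : f * Polynomial.derivative g = Polynomial.derivative f * g := by
    simp only [hg, map_sub, Polynomial.derivative_smul]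
    linear_combination h0 + (by
      simp only [Polynomial.smul_eq_C_mul]; ring :
        f * (c • Polynomial.derivative f) * (-1) + Polynomial.derivative f * (c • f) = 0)
  have hgc : g.coeff f.natDegree = 0 := by
    simp only [hg, Polynomial.coeff_sub, Polynomial.coeff_smul, smul_eq_mul, hc]
    change _ - _ / _ * f.leadingCoeff = 0
    field_simp
    ring
  by_contra hne
  have hgne : g ≠ 0 := by
    intro h1
    apply hne
    exact sub_eq_zero.mp h1
  have hgl : g.leadingCoeff ≠ 0 := Polynomial.leadingCoeff_ne_zero.mpr hgne
  have h1 := congrArg Polynomial.leadingCoeff hg0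
  simp only [Polynomial.leadingCoeff_mul, Polynomial.leadingCoeff_derivative] at h1
  have h2 : (g.natDegree : ℂ) = f.natDegree := by
    apply mul_left_cancel₀ (mul_ne_zero hlc hgl)
    linear_combination h1
  have h3 : g.natDegree = f.natDegree := by exact_mod_cast h2
  apply hgl
  rw [Polynomial.leadingCoeff, h3, hgc]

lemma uni (k : ℕ) : ∀ S : Submodule ℂ (Polynomial ℂ), FiniteDimensional ℂ S → finrank ℂ S ≤ k →
    ∃ B : Finset ℂ, ∀ a ∉ B, ∀ p ∈ S, (Polynomial.X - Polynomial.C a) ^ k ∣ p → p = 0 := by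
  induction k with
  | zero =>
    intro S hS h
    have : S = ⊥ := Submodule.finrank_eq_zero.mp (by omega)
    subst this
    exact ⟨∅, fun a _ p hp _ => by simpa using hp⟩
  | succ k ih =>
    intro S hS h
    by_cases hb : S = ⊥
    · subst hb
      exact ⟨∅, fun a _ p hp _ => by simpa using hp⟩
    obtain ⟨f, hfS, hf⟩ := Submodule.exists_mem_ne_zero_of_ne_bot hb
    let L : Polynomial ℂ →ₗ[ℂ] Polynomial ℂ :=
      LinearMap.mulLeft ℂ f ∘ₗ Polynomial.derivative -
        LinearMap.mulLeft ℂ (Polynomial.derivative f)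
    have hL : ∀ g, L g = f * Polynomial.derivative g - Polynomial.derivative f * g := fun g => rfl
    have hker : 1 ≤ finrank ℂ (LinearMap.ker (L.domRestrict S)) := by
      rw [Nat.one_le_iff_ne_zero, Ne, Submodule.finrank_eq_zero]
      intro h0
      have : (⟨f, hfS⟩ : S) ∈ LinearMap.ker (L.domRestrict S) := by
        rw [LinearMap.mem_ker, LinearMap.domRestrict_apply, hL]; ring
      rw [h0, Submodule.mem_bot] at this
      exact hf (congrArg Subtype.val this)
    have hrn := LinearMap.finrank_range_add_finrank_ker (L.domRestrict S)
    obtain ⟨B, hB⟩ := ih (LinearMap.range (L.domRestrict S)) inferInstance (by omega)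
    refine ⟨B ∪ f.roots.toFinset, fun a ha p hp hdvd => ?_⟩
    simp only [Finset.mem_union, not_or] at ha
    have hfa : f.eval a ≠ 0 := by
      intro h0
      exact ha.2 (by simp [hf, h0])
    have h1 : L p = 0 := by
      apply hB a ha.1 _ ⟨⟨p, hp⟩, rfl⟩
      obtain ⟨q, rfl⟩ := hdvd
      rw [LinearMap.domRestrict_apply, hL]
      refine ⟨f * (((k + 1 : ℕ) : Polynomial ℂ) * q + (Polynomial.X - Polynomial.C a) * Polynomial.derivative q)
        - Polynomial.derivative f * ((Polynomial.X - Polynomial.C a) * q), ?_⟩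
      simp only [Polynomial.derivative_mul, Polynomial.derivative_X_sub_C_pow]
      simp only [Nat.add_sub_cancel, map_natCast]
      ring
    obtain ⟨c, rfl⟩ := ker_wr f p hf (by rw [← hL]; exact h1)
    have h2 : (c • f).eval a = 0 := by
      obtain ⟨q, hq⟩ := hdvd
      rw [hq]; simp
    rw [Polynomial.eval_smul, smul_eq_mul] at h2
    rcases mul_eq_zero.mp h2 with h3 | h3
    · simp [h3]
    · exact absurd h3 hfa

/-! ### Injectivity of base-`b` expansions -/

lemma digits_inj (b : ℕ) : ∀ (n : ℕ) (u v : Fin n → ℕ), (∀ i, u i < b) → (∀ i, v i < b) →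
    ∑ i : Fin n, b ^ (i : ℕ) * u i = ∑ i : Fin n, b ^ (i : ℕ) * v i → u = v := by
  intro n
  induction n with
  | zero => intro u v _ _ _; exact Subsingleton.elim _ _
  | succ n ih =>
    intro u v hu hv h
    have hkey : ∀ w : Fin (n + 1) → ℕ, ∑ i : Fin (n + 1), b ^ (i : ℕ) * w i
        = w 0 + b * ∑ i : Fin n, b ^ (i : ℕ) * w i.succ := by
      intro w
      rw [Fin.sum_univ_succ, Finset.mul_sum]
      simp [pow_succ, mul_assoc, mul_left_comm]
    rw [hkey, hkey] at h
    have hb : 0 < b := lt_of_le_of_lt (Nat.zero_le _) (hu 0)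
    have h0 : u 0 = v 0 := by
      have := congrArg (· % b) h
      simpa [Nat.add_mul_mod_self_left, Nat.mod_eq_of_lt (hu 0), Nat.mod_eq_of_lt (hv 0)] using this
    rw [h0] at h
    have h1 := Nat.eq_of_mul_eq_mul_left hb (Nat.add_left_cancel h)
    have h2 := ih (fun i => u i.succ) (fun i => v i.succ) (fun i => hu _) (fun i => hv _) h1
    funext i
    refine Fin.cases h0 (fun j => congrFun h2 j) i

instance formSpace_fin (n d : ℕ) : FiniteDimensional ℂ (formSpace n d) :=
  Module.Finite.iff_fg.mpr (homogeneousSubmodule_fg (σ := Fin n) (R := ℂ) d)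

lemma finrank_map_mulLeft (n : ℕ) (l : PolyR n) (hl : l ≠ 0) (V : Submodule ℂ (PolyR n)) :
    finrank ℂ (V.map (LinearMap.mulLeft ℂ l)) = finrank ℂ V :=
  (Submodule.equivMapOfInjective (LinearMap.mulLeft ℂ l)
    (fun _ _ h => mul_left_cancel₀ hl h) V).finrank_eq.symm

/-! ### Extending functionals to polynomial coefficients -/

/-- The `ℂ[X]`-linear extension of a functional on `PolyR n`. -/
noncomputable def hat {n : ℕ} (φ : PolyR n →ₗ[ℂ] ℂ) :
    MvPolynomial (Fin n) (Polynomial ℂ) →ₗ[Polynomial ℂ] Polynomial ℂ :=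
  (basisMonomials (Fin n) (Polynomial ℂ)).constr (Polynomial ℂ)
    (fun m => Polynomial.C (φ (monomial m 1)))

lemma hat_monomial {n : ℕ} (φ : PolyR n →ₗ[ℂ] ℂ) (m : Fin n →₀ ℕ) (a : Polynomial ℂ) :
    hat φ (monomial m a) = a * Polynomial.C (φ (monomial m 1)) := by
  have h : monomial m a = a • (basisMonomials (Fin n) (Polynomial ℂ) m) := by
    simp [coe_basisMonomials, smul_monomial]
  rw [h, map_smul, hat, Basis.constr_basis, smul_eq_mul]

lemma hat_apply {n : ℕ} (φ : PolyR n →ₗ[ℂ] ℂ) (f : MvPolynomial (Fin n) (Polynomial ℂ)) :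
    hat φ f = ∑ m ∈ f.support, f.coeff m * Polynomial.C (φ (monomial m 1)) := by
  conv_lhs => rw [f.as_sum, map_sum]
  exact Finset.sum_congr rfl fun m _ => hat_monomial φ m _

lemma hat_map {n : ℕ} (φ : PolyR n →ₗ[ℂ] ℂ) (q : PolyR n) :
    hat φ (map Polynomial.C q) = Polynomial.C (φ q) := by
  rw [q.as_sum, map_sum, map_sum, map_sum, map_sum]
  refine Finset.sum_congr rfl fun m _ => ?_
  rw [map_monomial, hat_monomial, ← Polynomial.C_mul, ← smul_eq_mul, ← map_smul, smul_monomial]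
  simp

lemma hat_mul_eq_zero {n : ℕ} (φ : PolyR n →ₗ[ℂ] ℂ) (g : PolyR n)
    (h : ∀ m, φ (g * monomial m 1) = 0) (A : MvPolynomial (Fin n) (Polynomial ℂ)) :
    hat φ (map Polynomial.C g * A) = 0 := by
  rw [A.as_sum, Finset.mul_sum, map_sum]
  refine Finset.sum_eq_zero fun m _ => ?_
  have : map Polynomial.C g * monomial m (A.coeff m)
      = A.coeff m • map Polynomial.C (g * monomial m 1) := by
    rw [map_mul, map_monomial, map_one, smul_eq_C_mul, mul_left_comm, C_mul_monomial, mul_one]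
  rw [this, map_smul, hat_map, h]
  simp

lemma binom_split {R : Type*} [CommRing R] (a b : R) (d : ℕ) :
    ∃ A, (a + b) ^ (d + 2) = a ^ 2 * A + b ^ (d + 1) * (((d + 2 : ℕ) : R) * a + b) := by
  induction d with
  | zero => exact ⟨1, by push_cast; ring⟩
  | succ d ih =>
    obtain ⟨A, hA⟩ := ih
    refine ⟨A * (a + b) + b ^ (d + 1) * ((d + 2 : ℕ) : R), ?_⟩
    rw [show d + 1 + 2 = (d + 2) + 1 from rfl, pow_succ, hA]
    push_cast
    ring

/-- The generic linear form along a Kronecker curve. -/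
noncomputable def genLin (n b : ℕ) : MvPolynomial (Fin n) (Polynomial ℂ) :=
  ∑ i : Fin n, C ((Polynomial.X : Polynomial ℂ) ^ (b ^ (i : ℕ))) * X i

/-- The member of the Kronecker curve of linear forms at parameter `t`. -/
noncomputable def spLin (n b : ℕ) (t : ℂ) : PolyR n :=
  ∑ i : Fin n, C (t ^ (b ^ (i : ℕ))) * X i

lemma genLin_split (n b : ℕ) (t : ℂ) : ∃ r, genLin n b =
    map Polynomial.C (spLin n b t) + C (Polynomial.X - Polynomial.C t) * r := by
  have h : ∀ i : Fin n, ∃ q : Polynomial ℂ, Polynomial.X ^ (b ^ (i : ℕ)) =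
      Polynomial.C (t ^ (b ^ (i : ℕ))) + (Polynomial.X - Polynomial.C t) * q := by
    intro i
    obtain ⟨q, hq⟩ := sub_dvd_pow_sub_pow (Polynomial.X : Polynomial ℂ) (Polynomial.C t)
      (b ^ (i : ℕ))
    refine ⟨q, ?_⟩
    rw [← hq, Polynomial.C_pow]
    ring
  choose q hq using h
  refine ⟨∑ i : Fin n, C (q i) * X i, ?_⟩
  rw [genLin, spLin, map_sum, Finset.mul_sum, ← Finset.sum_add_distrib]
  refine Finset.sum_congr rfl fun i _ => ?_
  rw [hq i]
  simp only [map_add, map_mul, map_C, map_X]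
  ring

lemma genLin_pow (n b D : ℕ) : genLin n b ^ D =
    ∑ k ∈ Finset.piAntidiag Finset.univ D, monomial (Finsupp.equivFunOnFinite.symm k)
      (Polynomial.monomial (∑ i : Fin n, b ^ (i : ℕ) * k i)
        ((Nat.multinomial Finset.univ k : ℕ) : ℂ)) := by
  rw [genLin, Finset.sum_pow_eq_sum_piAntidiag]
  refine Finset.sum_congr rfl fun k _ => ?_
  rw [monomial_eq, Finsupp.prod_fintype _ _ (by simp)]
  simp only [mul_pow, Finset.prod_mul_distrib, Finsupp.equivFunOnFinite_symm_apply_apply]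
  rw [← mul_assoc]
  congr 1
  rw [← Polynomial.C_mul_X_pow_eq_monomial, ← Finset.prod_pow_eq_pow_sum]
  simp [pow_mul]

/-- Extension by zero of a functional on forms of degree `D`. -/
noncomputable def extF (n D : ℕ) : Dual ℂ (formSpace n D) →ₗ[ℂ] (PolyR n →ₗ[ℂ] ℂ) :=
  LinearMap.lcomp ℂ ℂ ((homogeneousComponent D).codRestrict (formSpace n D)
    (fun p => homogeneousComponent_mem D p))

lemma extF_of_mem (n D : ℕ) (φ : Dual ℂ (formSpace n D)) (p : PolyR n) (hp : p ∈ formSpace n D) :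
    extF n D φ p = φ ⟨p, hp⟩ := by
  change φ _ = _
  congr 1
  apply Subtype.ext
  exact homogeneousComponent_eq_self hp

lemma extF_of_mem_ne (n D E : ℕ) (φ : Dual ℂ (formSpace n D)) (p : PolyR n)
    (hp : p ∈ formSpace n E) (h : D ≠ E) : extF n D φ p = 0 := by
  change φ _ = _
  rw [← map_zero φ]
  congr 1
  apply Subtype.ext
  change homogeneousComponent D p = 0
  rw [homogeneousComponent_of_mem hp, if_neg]
  omega

/-- The univariate polynomial attached to a functional. -/
noncomputable def toUni (n D : ℕ) : Dual ℂ (formSpace n D) →ₗ[ℂ] Polynomial ℂ where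
  toFun φ := hat (extF n D φ) (genLin n (D + 1) ^ D)
  map_add' φ ψ := by
    simp only [hat_apply, map_add, LinearMap.add_apply, mul_add, Finset.sum_add_distrib]
  map_smul' c φ := by
    simp only [hat_apply, map_smul, LinearMap.smul_apply, smul_eq_mul, map_mul, Finset.smul_sum,
      RingHom.id_apply, Polynomial.smul_eq_C_mul]
    refine Finset.sum_congr rfl fun m _ => by ring

lemma toUni_inj (n D : ℕ) (φ : Dual ℂ (formSpace n D)) (h : toUni n D φ = 0) : φ = 0 := by
  have hmon : ∀ k ∈ Finset.piAntidiag (Finset.univ : Finset (Fin n)) D,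
      extF n D φ (monomial (Finsupp.equivFunOnFinite.symm k) 1) = 0 := by
    intro k hk
    have hlt : ∀ k' ∈ Finset.piAntidiag (Finset.univ : Finset (Fin n)) D, ∀ i, k' i < D + 1 := by
      intro k' hk' i
      rw [Finset.mem_piAntidiag] at hk'
      have := Finset.single_le_sum (f := k') (fun _ _ => Nat.zero_le _) (Finset.mem_univ i)
      have h2 : ∑ j, k' j = D := hk'.1
      omega
    have h1 : hat (extF n D φ) (genLin n (D + 1) ^ D) = 0 := h
    rw [genLin_pow, map_sum] at h1
    have h2 := congrArg (fun p => Polynomial.coeff p (∑ i : Fin n, (D + 1) ^ (i : ℕ) * k i)) h1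
    simp only [hat_monomial, Polynomial.finsetSum_coeff, Polynomial.coeff_mul_C,
      Polynomial.coeff_zero, Polynomial.coeff_monomial] at h2
    rw [Finset.sum_eq_single k] at h2
    · rw [if_pos rfl] at h2
      rcases mul_eq_zero.mp h2 with h3 | h3
      · exact absurd (Nat.cast_eq_zero.mp h3) (Nat.multinomial_pos _ _).ne'
      · exact h3
    · intro k' hk' hne
      rw [if_neg, zero_mul]
      intro he
      exact hne (digits_inj (D + 1) n k' k (hlt k' hk') (hlt k hk) he)
    · intro h'; exact absurd hk h'
  ext ⟨p, hp⟩
  rw [← extF_of_mem n D φ p hp, LinearMap.zero_apply]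
  conv_lhs => rw [p.as_sum, map_sum]
  refine Finset.sum_eq_zero fun m hm => ?_
  have hdeg : m.degree = D := IsHomogeneous.degree_eq_sum_deg_support hp hm |>.symm
  have := hmon m (by
    rw [Finset.mem_piAntidiag]
    refine ⟨?_, fun _ _ => Finset.mem_univ _⟩
    rw [← hdeg, Finsupp.degree_eq_sum])
  have e : (monomial m (coeff m p) : PolyR n) = coeff m p •
      monomial (Finsupp.equivFunOnFinite.symm m) 1 := by
    simp [smul_monomial]
  rw [e, map_smul, this, smul_zero]

lemma spLin_mem (n b : ℕ) (t : ℂ) : spLin n b t ∈ formSpace n 1 :=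
  IsHomogeneous.sum _ _ _ fun i _ => isHomogeneous_C_mul_X _ i

lemma spLin_ne_zero (n b : ℕ) (t : ℂ) (hn : 2 ≤ n) (ht : t ≠ 0) : spLin n b t ≠ 0 := by
  intro h
  have h1 := congrArg (eval (Pi.single (⟨0, by omega⟩ : Fin n) (1 : ℂ))) h
  simp [spLin, Pi.single_apply] at h1
  exact ht h1

lemma key (n d k : ℕ) (hn : 2 ≤ n) (hkd : k ≤ d + 1) (U : Submodule ℂ (PolyR n))
    (hU : U ≤ formSpace n (d + 2)) (hUk : vcodim n (d + 2) U = k) :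
    ∃ l : PolyR n, l ≠ 0 ∧ l ∈ formSpace n 1 ∧
      formSpace n (d + 2) ≤ U ⊔ (formSpace n d).map (LinearMap.mulLeft ℂ (l ^ 2)) := by
  set V : Submodule ℂ (formSpace n (d + 2)) := U.comap (formSpace n (d + 2)).subtype with hV
  have hVU : finrank ℂ V = finrank ℂ U := (Submodule.comapSubtypeEquivOfLe hU).finrank_eq
  have hann := Subspace.finrank_add_finrank_dualAnnihilator_eq V
  have hW : finrank ℂ (V.dualAnnihilator.map (toUni n (d + 2))) ≤ k := by
    refine (Submodule.finrank_map_le _ _).trans ?_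
    unfold vcodim at hUk
    omega
  obtain ⟨B, hB⟩ := uni k (V.dualAnnihilator.map (toUni n (d + 2))) inferInstance hW
  obtain ⟨t, ht⟩ := Infinite.exists_notMem_finset (insert 0 B)
  rw [Finset.mem_insert, not_or] at ht
  set l := spLin n (d + 2 + 1) t with hl
  have hl1 : l ∈ formSpace n 1 := spLin_mem _ _ _
  have hl2 : l ^ 2 ∈ formSpace n 2 := (IsHomogeneous.pow (φ := l) (m := 1) hl1 2)
  refine ⟨l, spLin_ne_zero _ _ _ hn ht.1, hl1, ?_⟩
  intro p hp
  by_contra hnot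
  obtain ⟨f, hfp, hf⟩ := Submodule.exists_le_ker_of_notMem hnot
  set φ : Dual ℂ (formSpace n (d + 2)) := f ∘ₗ (formSpace n (d + 2)).subtype with hφ
  have hφW : φ ∈ V.dualAnnihilator := by
    rw [Submodule.mem_dualAnnihilator]
    rintro ⟨u, hu⟩ huV
    exact hf (Submodule.mem_sup_left huV)
  have hz : ∀ m, extF n (d + 2) φ (l ^ 2 * monomial m 1) = 0 := by
    intro m
    have hm : (monomial m 1 : PolyR n) ∈ formSpace n m.degree := isHomogeneous_monomial 1 rfl
    have hlm : l ^ 2 * monomial m 1 ∈ formSpace n (2 + m.degree) := IsHomogeneous.mul hl2 hm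
    by_cases hd : m.degree = d
    · rw [hd, add_comm] at hlm
      rw [extF_of_mem _ _ _ _ hlm]
      rw [hd] at hm
      exact hf (Submodule.mem_sup_right ⟨_, hm, rfl⟩)
    · exact extF_of_mem_ne _ _ _ _ _ hlm (by omega)
  have hdvd : (Polynomial.X - Polynomial.C t) ^ k ∣ toUni n (d + 2) φ := by
    refine (pow_dvd_pow _ hkd).trans ?_
    change _ ∣ hat _ _
    obtain ⟨r, hr⟩ := genLin_split n (d + 2 + 1) t
    rw [hr]
    obtain ⟨A, hA⟩ := binom_split (map Polynomial.C l)
      (C (Polynomial.X - Polynomial.C t) * r) d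
    rw [hA, map_add, ← map_pow, hat_mul_eq_zero _ _ hz, zero_add, mul_pow, ← map_pow, mul_assoc,
      ← smul_eq_C_mul, map_smul, smul_eq_mul]
    exact Dvd.intro _ rfl
  have h0 := toUni_inj _ _ _ (hB t ht.2 _ ⟨φ, hφW, rfl⟩ hdvd)
  apply hfp
  exact LinearMap.congr_fun h0 ⟨p, hp⟩

lemma step_s13 (n d k : ℕ) (hn : 2 ≤ n) (hk : 1 ≤ k) (hkd : k ≤ d) :
    mMax n (d + 1) k ≤ mMax n d k := by
  unfold mMax
  apply csSup_le'
  rintro s ⟨U, hU, hUk, rfl⟩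
  obtain ⟨d', rfl⟩ : ∃ d', d = d' + 1 := ⟨d - 1, by omega⟩
  obtain ⟨l, hl0, hl1, hle⟩ := key n d' k hn hkd U hU hUk
  set μ := LinearMap.mulLeft ℂ l with hμ
  set U' := Submodule.comap μ U ⊓ formSpace n (d' + 1) with hU'
  have hU'le : U' ≤ formSpace n (d' + 1) := inf_le_right
  have fU : FiniteDimensional ℂ U := Submodule.finiteDimensional_of_le hU
  have fU' : FiniteDimensional ℂ U' := Submodule.finiteDimensional_of_le hU'le
  have hll : l ^ 2 ≠ 0 := pow_ne_zero 2 hl0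
  have hl2 : l ^ 2 ∈ formSpace n 2 := (IsHomogeneous.pow (φ := l) (m := 1) hl1 2)
  have mulmem : ∀ {a b c : ℕ} {p q : PolyR n}, p ∈ formSpace n a → q ∈ formSpace n b → a + b = c →
      p * q ∈ formSpace n c := by
    intro a b c p q hp hq h
    subst h
    exact IsHomogeneous.mul hp hq
  -- first dimension count
  have hsup : U ⊔ (formSpace n (d' + 1)).map μ = formSpace n (d' + 2) := by
    apply le_antisymm
    · apply sup_le hU
      rintro _ ⟨q, hq, rfl⟩
      exact mulmem hl1 hq (by omega)
    · refine hle.trans (sup_le le_sup_left (le_trans ?_ le_sup_right))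
      rintro _ ⟨q, hq, rfl⟩
      refine ⟨l * q, mulmem hl1 hq (by omega), ?_⟩
      simp [hμ]; ring
  have hinf : U ⊓ (formSpace n (d' + 1)).map μ = U'.map μ := by
    ext p
    constructor
    · rintro ⟨hp, q, hq, rfl⟩
      exact ⟨q, ⟨hp, hq⟩, rfl⟩
    · rintro ⟨q, ⟨h1, h2⟩, rfl⟩
      exact ⟨h1, q, h2, rfl⟩
  have c1 := Submodule.finrank_sup_add_finrank_inf_eq U ((formSpace n (d' + 1)).map μ)
  rw [hsup, hinf, hμ, finrank_map_mulLeft n l hl0, finrank_map_mulLeft n l hl0] at c1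
  have hUle := Submodule.finrank_mono hU
  have hk' : vcodim n (d' + 1) U' = k := by
    unfold vcodim at hUk ⊢
    rw [show d' + 1 + 1 = d' + 2 from rfl] at hUk hUle
    omega
  -- second dimension count
  have hUU : U * U ≤ formSpace n (2 * (d' + 2)) := by
    rw [two_mul, ← formSpace_mul]
    exact mul_le_mul' hU hU
  have hUU' : U' * U' ≤ formSpace n (2 * (d' + 1)) := by
    rw [two_mul, ← formSpace_mul]
    exact mul_le_mul' hU'le hU'le
  have fUU : FiniteDimensional ℂ ↥(U * U) := Submodule.finiteDimensional_of_le hUU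
  set ν := LinearMap.mulLeft ℂ (l ^ 2) with hν
  set M := (formSpace n (2 * (d' + 1))).map ν with hM
  have hMle : M ≤ formSpace n (2 * (d' + 2)) := by
    rintro _ ⟨q, hq, rfl⟩
    exact mulmem hl2 hq (by omega)
  have fM : FiniteDimensional ℂ M := Submodule.finiteDimensional_of_le hMle
  have hsup2 : U * U ⊔ M = formSpace n (2 * (d' + 2)) := by
    apply le_antisymm (sup_le hUU hMle)
    rw [two_mul, ← formSpace_mul]
    rw [Submodule.mul_le]
    intro p hp q hq
    obtain ⟨u, hu, _, ⟨a, ha, rfl⟩, rfl⟩ := Submodule.mem_sup.mp (hle hp)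
    obtain ⟨v, hv, _, ⟨b, hb, rfl⟩, rfl⟩ := Submodule.mem_sup.mp (hle hq)
    refine Submodule.mem_sup.mpr ⟨u * v, Submodule.mul_mem_mul hu hv,
      ν (u * b + v * a + a * (l ^ 2 * b)), ⟨_, ?_, rfl⟩, ?_⟩
    · refine add_mem (add_mem (mulmem (hU hu) hb (by omega)) (mulmem (hU hv) ha (by omega)))
        (mulmem ha (mulmem hl2 hb rfl) (by omega))
    · simp [hν]; ring
  have hinf2 : (U' * U').map ν ≤ U * U ⊓ M := by
    refine le_inf ?_ (Submodule.map_mono hUU')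
    rw [Submodule.map_le_iff_le_comap, Submodule.mul_le]
    intro p hp q hq
    have := Submodule.mul_mem_mul (show l * p ∈ U from hp.1) (show l * q ∈ U from hq.1)
    rw [Submodule.mem_comap]
    convert this using 1
    simp only [hν, LinearMap.mulLeft_apply]; ring
  have c2 := Submodule.finrank_sup_add_finrank_inf_eq (U * U) M
  have c3 := Submodule.finrank_mono hinf2
  rw [hsup2, hM, hν, finrank_map_mulLeft n _ hll] at c2
  rw [hM, hν, finrank_map_mulLeft n _ hll] at c3
  have hfin : vcodim n (2 * (d' + 2)) (U * U) ≤ vcodim n (2 * (d' + 1)) (U' * U') := by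
    unfold vcodim
    omega
  refine hfin.trans (le_csSup ?_ ⟨U', hU'le, hk', rfl⟩)
  refine ⟨finrank ℂ (formSpace n (2 * (d' + 1))), ?_⟩
  rintro _ ⟨V, _, _, rfl⟩
  exact Nat.sub_le _ _

theorem stmt13 (n d k : ℕ) (hn : 2 ≤ n) (hk : 1 ≤ k) (hkd : k ≤ d) :
    mMax n d k ≤ mMax n k k := by
  induction d, hkd using Nat.le_induction with
  | base => exact le_rfl
  | succ d hd ih => exact (step_s13 n d k hn hk hd).trans ih
end
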